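/- Let b, s be positive integers. There exists a constant c = c(b, s) such that for every prime power q and every choice of b polynomials f_1, ..., f_b on F_q^b each of total degree at most bs, the common zero set W = {y ∈ F_q^b : f_1(y) = ⋯ = f_b(y) = 0} satisfies either |W| < c or |W| ≥ q - c√q. -/

import Mathlib

section PlaneCurves

open Polynomial

/-- An increasing multiplicative filtration of an algebra by submodules. -/
structure IsAlgFiltration {K R : Type*} [CommRing K] [CommRing R] [Algebra K R]
    (F : ℕ → Submodule K R) : Prop where
  mono : Monotone F
  one_mem : (1 : R) ∈ F 0
  mul_mem : ∀ {a b : ℕ} {u v : R}, u ∈ F a → v ∈ F b → u * v ∈ F (a + b)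

namespace IsAlgFiltration

section General

variable {K R : Type*} [CommRing K] [CommRing R] [Algebra K R] {F : ℕ → Submodule K R}

lemma mem_of_le (hF : IsAlgFiltration F) {a b : ℕ} {u : R} (hu : u ∈ F a) (h : a ≤ b) :
    u ∈ F b := hF.mono h hu

lemma one_mem' (hF : IsAlgFiltration F) (a : ℕ) : (1 : R) ∈ F a :=
  hF.mem_of_le hF.one_mem (Nat.zero_le a)

lemma pow_mem (hF : IsAlgFiltration F) {a : ℕ} {u : R} (hu : u ∈ F a) (n : ℕ) :
    u ^ n ∈ F (n * a) := by
  induction n with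
  | zero => simpa using hF.one_mem
  | succ n ih =>
    rw [pow_succ, Nat.succ_mul]
    exact hF.mul_mem ih hu

lemma natCast_mul_mem {a : ℕ} {u : R} (hu : u ∈ F a) (n : ℕ) :
    (n : R) * u ∈ F a := by
  rw [← nsmul_eq_mul]
  exact (F a).smul_of_tower_mem n hu

lemma eval_mem (hF : IsAlgFiltration F) {a b n : ℕ} {p : R[X]} {z : R} (hp : ∀ i, p.coeff i ∈ F a)
    (hn : p.natDegree ≤ n) (hz : z ∈ F b) : p.eval z ∈ F (a + n * b) := by
  rw [eval_eq_sum_range]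
  refine Submodule.sum_mem _ fun i hi => ?_
  have hi' : i ≤ n := (Nat.lt_succ_iff.mp (Finset.mem_range.mp hi)).trans hn
  exact hF.mem_of_le (hF.mul_mem (hp i) (hF.pow_mem hz i))
    (Nat.add_le_add_left (Nat.mul_le_mul_right b hi') a)

lemma aeval_mem (hF : IsAlgFiltration F) {b n : ℕ} {p : K[X]} {z : R}
    (hn : p.natDegree ≤ n) (hz : z ∈ F b) : aeval z p ∈ F (n * b) := by
  rw [aeval_eq_sum_range]
  refine Submodule.sum_mem _ fun i hi => ?_
  have hi' : i ≤ n := (Nat.lt_succ_iff.mp (Finset.mem_range.mp hi)).trans hn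
  exact Submodule.smul_mem _ _ (hF.mem_of_le (hF.pow_mem hz i) (Nat.mul_le_mul_right b hi'))

lemma exists_aeval_sub_aeval (hF : IsAlgFiltration F) {n : ℕ} {p : K[X]} {u v : R}
    (hn : p.natDegree ≤ n) (hu : u ∈ F 1) (hv : v ∈ F 1) :
    ∃ r ∈ F n, aeval u p - aeval v p = (u - v) * r := by
  refine ⟨∑ i ∈ Finset.range (p.natDegree + 1), p.coeff i •
    ∑ j ∈ Finset.range i, u ^ j * v ^ (i - 1 - j), ?_, ?_⟩
  · refine Submodule.sum_mem _ fun i hi => Submodule.smul_mem _ _ <|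
      Submodule.sum_mem _ fun j hj => ?_
    rw [Finset.mem_range] at hi hj
    refine hF.mem_of_le (hF.mul_mem (hF.pow_mem hu j) (hF.pow_mem hv _)) ?_
    omega
  · rw [aeval_eq_sum_range, aeval_eq_sum_range, ← Finset.sum_sub_distrib, Finset.mul_sum]
    refine Finset.sum_congr rfl fun i _ => ?_
    rw [← smul_sub, mul_smul_comm, mul_comm (u - v), geom_sum₂_mul]

/-- The filtration of `R[X]` in which the variable has weight `-κ`. -/
def polyFiltration (F : ℕ → Submodule K R) (κ : ℕ) (e : ℕ) : Submodule K R[X] where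
  carrier := {p | ∀ m, p.coeff m ∈ F (κ * m + e)}
  add_mem' hp hq m := by
    rw [coeff_add]
    exact Submodule.add_mem _ (hp m) (hq m)
  zero_mem' m := by simp
  smul_mem' c p hp m := by
    rw [coeff_smul]
    exact Submodule.smul_mem _ _ (hp m)

lemma polyFiltration_isAlgFiltration (hF : IsAlgFiltration F) (κ : ℕ) :
    IsAlgFiltration (polyFiltration F κ) where
  mono a b hab p hp m := hF.mem_of_le (hp m) (by omega)
  one_mem m := by
    rw [coeff_one]
    split_ifs
    · exact hF.one_mem' _
    · exact Submodule.zero_mem _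
  mul_mem {a b u v} hu hv m := by
    rw [coeff_mul]
    refine Submodule.sum_mem _ fun i hi => ?_
    have := Finset.HasAntidiagonal.mem_antidiagonal.mp hi
    refine hF.mem_of_le (hF.mul_mem (hu i.1) (hv i.2)) (le_of_eq ?_)
    rw [← this]
    ring

lemma C_mem_polyFiltration (hF : IsAlgFiltration F) {κ e : ℕ} {r : R} (hr : r ∈ F e) :
    C r ∈ polyFiltration F κ e := by
  intro m
  rw [coeff_C]
  split_ifs
  · exact hF.mem_of_le hr (by omega)
  · exact Submodule.zero_mem _

lemma X_mul_mem_polyFiltration {κ e : ℕ} {p : R[X]}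
    (hp : p ∈ polyFiltration F κ (κ + e)) : X * p ∈ polyFiltration F κ e := by
  intro m
  cases m with
  | zero => simp
  | succ m =>
    rw [coeff_X_mul]
    convert hp m using 2
    ring

end General

end IsAlgFiltration

section Specialization

variable {K R S : Type*} [CommRing K] [CommRing R] [Algebra K R] [CommRing S] [Algebra K S]

/-- Substitute `x` for the inner variable of a bivariate polynomial. -/
noncomputable def specX (x : R) (f : K[X][X]) : R[X] := f.map (aeval x : K[X] →ₐ[K] R).toRingHom

lemma specX_coeff (x : R) (f : K[X][X]) (j : ℕ) : (specX x f).coeff j = aeval x (f.coeff j) := by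
  simp [specX, coeff_map]

lemma specX_map (φ : R →ₐ[K] S) (x : R) (f : K[X][X]) :
    (specX x f).map φ.toRingHom = specX (φ x) f := by
  ext j
  simp [specX_coeff, coeff_map, aeval_algHom_apply]

lemma map_eval_specX (φ : R →ₐ[K] S) (x y : R) (f : K[X][X]) :
    φ ((specX x f).eval y) = (specX (φ x) f).eval (φ y) := by
  rw [← specX_map, eval_map]
  exact hom_eval₂ (specX x f) (RingHom.id R) φ.toRingHom y

lemma specX_monic {f : K[X][X]} (hf : f.Monic) (x : R) : (specX x f).Monic := hf.map _

lemma natDegree_specX_le (x : R) (f : K[X][X]) : (specX x f).natDegree ≤ f.natDegree :=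
  natDegree_map_le

lemma specX_derivative (x : R) (f : K[X][X]) : specX x (derivative f) = derivative (specX x f) := by
  simp [specX, derivative_map]

end Specialization

section Taylor

open IsAlgFiltration

variable {K R : Type*} [CommRing K] [CommRing R] [Algebra K R] {F : ℕ → Submodule K R}

/-- A formal solution of `f(x + δ² s, Z) = 0` through the point `(x, z)`, with denominators cleared
by powers of `δ = f_Y(x, z)` and with control of the weights of all coefficients. -/
theorem exists_formal_branch (hF : IsAlgFiltration F) {f : K[X][X]} {d D : ℕ}
    (hd : f.natDegree ≤ d) (hD : ∀ j, (f.coeff j).natDegree ≤ D) {x z : R}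
    (hx : x ∈ F 1) (hz : z ∈ F D) (hxz : (specX x f).eval z = 0) {δ : R}
    (hδ : δ = (specX x (derivative f)).eval z) (M : ℕ) :
    ∃ Z ∈ polyFiltration F (2 * (D * (d + 1))) D, X ∣ Z - C z ∧
      X ^ M ∣ (specX (C x + C (δ ^ 2) * X : R[X]) f).eval Z := by
  classical
  set c := D * (d + 1) with hc
  set G := polyFiltration F (2 * c) with hG_def
  have hG : IsAlgFiltration G := hF.polyFiltration_isAlgFiltration _
  have hcoeff : ∀ i, (specX x f).coeff i ∈ F D := by
    intro i
    rw [specX_coeff]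
    simpa using hF.aeval_mem (hD i) hx
  have hδc : δ ∈ F c := by
    rw [hδ, specX_derivative]
    refine hF.mem_of_le (hF.eval_mem (a := D) (b := D) (n := d) ?_ ?_ hz) (by rw [hc]; lia)
    · intro i
      rw [coeff_derivative, mul_comm]
      exact_mod_cast natCast_mul_mem (hcoeff (i + 1)) (i + 1)
    · exact (natDegree_derivative_le _).trans
        ((Nat.sub_le _ _).trans ((natDegree_specX_le _ _).trans hd))
  set h : R[X] := C (δ ^ 2) * X with hh
  have hhG : h ∈ G 0 := by
    rw [hh, mul_comm]
    exact X_mul_mem_polyFiltration (hF.C_mem_polyFiltration (by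
      rw [add_zero]; exact hF.pow_mem hδc 2))
  have hxG : (C x : R[X]) ∈ G 1 := hF.C_mem_polyFiltration hx
  have hxhG : C x + h ∈ G 1 := Submodule.add_mem _ hxG (hG.mem_of_le hhG zero_le_one)
  have hq : ∀ j, ∃ r ∈ G D, aeval (C x + h) (f.coeff j) - aeval (C x : R[X]) (f.coeff j) = h * r := by
    intro j
    obtain ⟨r, hr, hr'⟩ := hG.exists_aeval_sub_aeval (hD j) hxhG hxG
    exact ⟨r, hr, by rw [hr']; ring⟩
  choose q hqG hq using hq
  -- the difference quotient of `f` in its first variable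
  set f₁ : R[X][X] := ∑ j ∈ Finset.range (d + 1), C (q j) * X ^ j with hf₁
  have hspec : ∀ W : R[X], (specX (C x + h) f).eval W
      = ((specX x f).map C).eval W + h * f₁.eval W := by
    intro W
    have h1 : (specX (C x + h) f).eval W
        = ∑ j ∈ Finset.range (d + 1), aeval (C x + h) (f.coeff j) * W ^ j := by
      rw [eval_eq_sum_range' (n := d + 1)
        (Nat.lt_succ_of_le ((natDegree_specX_le _ _).trans hd))]
      simp [specX_coeff]
    have h2 : ((specX x f).map C).eval W
        = ∑ j ∈ Finset.range (d + 1), aeval (C x : R[X]) (f.coeff j) * W ^ j := by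
      rw [eval_eq_sum_range' (n := d + 1)
        (Nat.lt_succ_of_le (natDegree_map_le.trans ((natDegree_specX_le _ _).trans hd)))]
      refine Finset.sum_congr rfl fun j _ => ?_
      rw [coeff_map, specX_coeff]
      congr 1
      exact (aeval_algHom_apply ((CAlgHom : R →ₐ[R] R[X]).restrictScalars K) x (f.coeff j)).symm
    rw [h1, h2, hf₁, eval_finsetSum, Finset.mul_sum, ← Finset.sum_add_distrib]
    refine Finset.sum_congr rfl fun j _ => ?_
    simp only [eval_mul, eval_C, eval_pow, eval_X]
    linear_combination W ^ j * hq j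
  -- second order Taylor remainder in the second variable
  set f₂ : R[X] := divX (divX (taylor z (specX x f))) with hf₂
  have htaylor : ∀ η : R[X], ((specX x f).map C).eval (C z + η)
      = η * (C δ + η * (f₂.map C).eval η) := by
    intro η
    have h0 : taylor z (specX x f) = X * (X * f₂ + C δ) := by
      have e1 := X_mul_divX_add (taylor z (specX x f))
      have e2 := X_mul_divX_add (divX (taylor z (specX x f)))
      rw [taylor_coeff_zero, hxz, C_0, add_zero] at e1
      rw [coeff_divX, zero_add, taylor_coeff_one, ← specX_derivative, ← hδ] at e2
      rw [hf₂, e2, e1]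
    have h1 : ((specX x f).map C).eval (C z + η)
        = ((taylor z (specX x f)).map C).eval η := by
      rw [taylor_apply, Polynomial.map_comp, eval_comp]
      simp [add_comm]
    rw [h1, h0]
    simp only [Polynomial.map_mul, Polynomial.map_add, map_X, map_C, eval_mul, eval_add, eval_X,
      eval_C]
    ring
  have hf₂G : ∀ η ∈ G 0, (f₂.map C).eval η ∈ G c := by
    intro η hη
    have := hG.eval_mem (p := f₂.map C) (a := c) (b := 0) (n := f₂.natDegree) (z := η) ?_
      natDegree_map_le hη
    · simpa using this
    intro i
    rw [coeff_map]
    refine hF.C_mem_polyFiltration ?_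
    rw [hf₂, coeff_divX, coeff_divX, taylor_coeff]
    refine hF.mem_of_le (hF.eval_mem (a := D) (b := D) (n := d) ?_ ?_ hz) (by rw [hc]; lia)
    · intro j
      rw [hasseDeriv_coeff]
      exact natCast_mul_mem (hcoeff _) _
    · exact (natDegree_hasseDeriv_le _ _).trans
        ((Nat.sub_le _ _).trans ((natDegree_specX_le _ _).trans hd))
  have hf₁G : ∀ W ∈ G D, f₁.eval W ∈ G c := by
    intro W hW
    rw [hf₁, eval_finsetSum]
    refine Submodule.sum_mem _ fun j hj => ?_
    rw [Finset.mem_range] at hj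
    simp only [eval_mul, eval_C, eval_pow, eval_X]
    refine hG.mem_of_le (hG.mul_mem (hqG j) (hG.pow_mem hW j)) ?_
    rw [hc]
    have : j * D ≤ d * D := Nat.mul_le_mul_right _ (by omega)
    lia
  have hη : ∀ v ∈ G c, C δ * (X * v) ∈ G 0 := by
    intro v hv
    have : C δ * (X * v) = X * (C δ * v) := by ring
    rw [this]
    refine X_mul_mem_polyFiltration (hG.mem_of_le
      (hG.mul_mem (hF.C_mem_polyFiltration hδc) hv) (by omega))
  have hzη : ∀ v ∈ G c, C z + C δ * (X * v) ∈ G D := fun v hv =>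
    Submodule.add_mem _ (hF.C_mem_polyFiltration hz) (hG.mem_of_le (hη v hv) (Nat.zero_le _))
  set Φ : R[X] → R[X] := fun v => -(f₁.eval (C z + C δ * (X * v))
    + X * (v ^ 2 * (f₂.map C).eval (C δ * (X * v)))) with hΦ
  have hΦG : ∀ v ∈ G c, Φ v ∈ G c := by
    intro v hv
    refine Submodule.neg_mem _ (Submodule.add_mem _ (hf₁G _ (hzη v hv)) ?_)
    refine X_mul_mem_polyFiltration ?_
    refine hG.mem_of_le (hG.mul_mem (hG.pow_mem hv 2) (hf₂G _ (hη v hv))) (by omega)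
  have hΦdvd : ∀ (k : ℕ) (v w : R[X]), X ^ k ∣ v - w → X ^ (k + 1) ∣ Φ v - Φ w := by
    intro k v w hvw
    have h0 : X ^ (k + 1) ∣ C δ * (X * v) - C δ * (X * w) := by
      have : C δ * (X * v) - C δ * (X * w) = C δ * (X * (v - w)) := by ring
      rw [this, pow_succ']
      exact Dvd.dvd.mul_left (mul_dvd_mul_left X hvw) _
    have h1 : X ^ (k + 1) ∣ f₁.eval (C z + C δ * (X * v)) - f₁.eval (C z + C δ * (X * w)) :=
      (by simpa using h0 : X ^ (k + 1) ∣ (C z + C δ * (X * v)) - (C z + C δ * (X * w))).trans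
        (sub_dvd_eval_sub _ _ _)
    have h2 : X ^ (k + 1) ∣ (f₂.map C).eval (C δ * (X * v)) - (f₂.map C).eval (C δ * (X * w)) :=
      h0.trans (sub_dvd_eval_sub _ _ _)
    have h3 : X ^ (k + 1) ∣ X * (v ^ 2 - w ^ 2) := by
      rw [pow_succ']
      refine mul_dvd_mul_left X (hvw.trans ?_)
      exact ⟨v + w, by ring⟩
    have : Φ v - Φ w = -(f₁.eval (C z + C δ * (X * v)) - f₁.eval (C z + C δ * (X * w)))
        - (X * (v ^ 2 - w ^ 2)) * (f₂.map C).eval (C δ * (X * v))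
        - X * w ^ 2 * ((f₂.map C).eval (C δ * (X * v)) - (f₂.map C).eval (C δ * (X * w))) := by
      rw [hΦ]
      ring
    rw [this]
    exact dvd_sub (dvd_sub (dvd_neg.mpr h1) (h3.mul_right _)) (h2.mul_left _)
  have hiter : ∀ k, ∃ v ∈ G c, X ^ k ∣ v - Φ v := by
    intro k
    induction k with
    | zero => exact ⟨0, Submodule.zero_mem _, by simp⟩
    | succ k ih =>
      obtain ⟨v, hv, hdv⟩ := ih
      exact ⟨Φ v, hΦG v hv, hΦdvd k _ _ hdv⟩
  obtain ⟨v, hv, hdv⟩ := hiter M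
  refine ⟨C z + C δ * (X * v), hzη v hv, ⟨C δ * v, by ring⟩, ?_⟩
  rw [hspec, htaylor]
  have : C δ * (X * v) * (C δ + C δ * (X * v) * (f₂.map C).eval (C δ * (X * v)))
      + h * f₁.eval (C z + C δ * (X * v)) = h * (v - Φ v) := by
    rw [hh, hΦ, C_pow]
    ring
  rw [this]
  exact hdv.mul_left _

end Taylor

section Monomials

variable {K S : Type*} [CommRing K] [CommRing S] [Algebra K S]

/-- The divided difference `(f(x,z) - f(x,y)) / (z - y)`. -/
noncomputable def divDiff (f : K[X][X]) (x y z : S) : S :=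
  ∑ j ∈ Finset.range (f.natDegree + 1),
    aeval x (f.coeff j) * ∑ i ∈ Finset.range j, z ^ i * y ^ (j - 1 - i)

lemma divDiff_mul_sub (f : K[X][X]) (x y z : S) :
    divDiff f x y z * (z - y) = (specX x f).eval z - (specX x f).eval y := by
  have h : ∀ w : S, (specX x f).eval w
      = ∑ j ∈ Finset.range (f.natDegree + 1), aeval x (f.coeff j) * w ^ j := by
    intro w
    rw [eval_eq_sum_range' (n := f.natDegree + 1) (Nat.lt_succ_of_le (natDegree_specX_le _ _))]
    simp [specX_coeff]
  rw [h, h, ← Finset.sum_sub_distrib, divDiff, Finset.sum_mul]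
  refine Finset.sum_congr rfl fun j _ => ?_
  rw [mul_assoc, geom_sum₂_mul]
  ring

lemma map_divDiff {T : Type*} [CommRing T] [Algebra K T] (φ : S →ₐ[K] T) (f : K[X][X])
    (x y z : S) : φ (divDiff f x y z) = divDiff f (φ x) (φ y) (φ z) := by
  simp [divDiff, map_sum, aeval_algHom_apply]

/-- The span of the monomials of weight at most `k`, where `x` has weight `1` and `y`, `z` have
weight `D`. -/
def monomialFiltration (K : Type*) {S : Type*} [CommRing K] [CommRing S] [Algebra K S] (D : ℕ)
    (x y z : S) (k : ℕ) : Submodule K S :=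
  Submodule.span K {w | ∃ a i j : ℕ, a + D * (i + j) ≤ k ∧ w = x ^ a * y ^ i * z ^ j}

lemma monomialFiltration_isAlgFiltration (D : ℕ) (x y z : S) :
    IsAlgFiltration (monomialFiltration K D x y z) where
  mono k l hkl := by
    refine Submodule.span_mono ?_
    rintro w ⟨a, i, j, h, rfl⟩
    exact ⟨a, i, j, h.trans hkl, rfl⟩
  one_mem := Submodule.subset_span ⟨0, 0, 0, by simp, by simp⟩
  mul_mem {k l u v} hu hv := by
    have := Submodule.mul_mem_mul hu hv
    rw [monomialFiltration, monomialFiltration, Submodule.span_mul_span] at this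
    refine Submodule.span_mono ?_ this
    rintro _ ⟨_, ⟨a, i, j, h, rfl⟩, _, ⟨a', i', j', h', rfl⟩, rfl⟩
    refine ⟨a + a', i + i', j + j', ?_, by ring⟩
    have : a + a' + D * (i + i' + (j + j')) = (a + D * (i + j)) + (a' + D * (i' + j')) := by ring
    omega

lemma monomial_mem_monomialFiltration (D : ℕ) (x y z : S) {a i j k : ℕ}
    (h : a + D * (i + j) ≤ k) : x ^ a * y ^ i * z ^ j ∈ monomialFiltration K D x y z k :=
  Submodule.subset_span ⟨a, i, j, h, rfl⟩

/-- The span of the reduced monomials of weight at most `k`. -/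
def reducedSpan (K : Type*) {S : Type*} [CommRing K] [CommRing S] [Algebra K S] (d D : ℕ)
    (x y z : S) (k : ℕ) : Submodule K S :=
  Submodule.span K {w | ∃ a i j : ℕ, a + D * (i + j) ≤ k ∧ i < d ∧ j < d - 1 ∧
    w = x ^ a * y ^ i * z ^ j}

lemma pow_mul_aeval_mul_mem {B : Submodule K S} {p : K[X]} {D a : ℕ} {x w : S}
    (hp : p.natDegree ≤ D) (h : ∀ m ≤ D, x ^ (a + m) * w ∈ B) : x ^ a * aeval x p * w ∈ B := by
  rw [aeval_eq_sum_range, Finset.mul_sum, Finset.sum_mul]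
  refine Submodule.sum_mem _ fun m hm => ?_
  rw [mul_smul_comm, smul_mul_assoc, ← pow_add]
  exact Submodule.smul_mem _ _ (h m ((Nat.lt_succ_iff.mp (Finset.mem_range.mp hm)).trans hp))

lemma monomial_mem_reducedSpan {f : K[X][X]} {d D : ℕ} (hf : f.Monic) (hd : f.natDegree = d)
    (hD : ∀ j, (f.coeff j).natDegree ≤ D) {x y z : S}
    (hy : (specX x f).eval y = 0) (hz : divDiff f x y z = 0) {k : ℕ} :
    ∀ n j i a : ℕ, i + j = n → a + D * (i + j) ≤ k →
      x ^ a * y ^ i * z ^ j ∈ reducedSpan K d D x y z k := by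
  have hlead : f.coeff d = 1 := by rw [← hd]; exact hf.coeff_natDegree
  have hy' : y ^ d = - ∑ l ∈ Finset.range d, aeval x (f.coeff l) * y ^ l := by
    rw [eval_eq_sum_range' (n := d + 1) (Nat.lt_succ_of_le ((natDegree_specX_le _ _).trans hd.le)),
      Finset.sum_range_succ] at hy
    simp only [specX_coeff, hlead, map_one, one_mul] at hy
    linear_combination hy
  have hz' : z ^ (d - 1) = - ∑ i ∈ Finset.range (d - 1), z ^ i * y ^ (d - 1 - i)
      - ∑ l ∈ Finset.range d, aeval x (f.coeff l) * ∑ i ∈ Finset.range l, z ^ i * y ^ (l - 1 - i) ∨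
      d = 0 := by
    rcases Nat.eq_zero_or_pos d with h0 | hpos
    · exact Or.inr h0
    left
    rw [divDiff, hd, Finset.sum_range_succ, hlead, map_one, one_mul] at hz
    obtain ⟨e, rfl⟩ : ∃ e, d = e + 1 := ⟨d - 1, by omega⟩
    simp only [Nat.add_sub_cancel] at hz ⊢
    rw [Finset.sum_range_succ (fun i => z ^ i * y ^ (e - i)), Nat.sub_self, pow_zero, mul_one] at hz
    linear_combination hz
  intro n
  induction n using Nat.strong_induction_on with
  | _ n ihn =>
  intro j
  induction j using Nat.strong_induction_on with
  | _ j ihj =>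
  intro i a hn hk
  by_cases hi : i < d
  swap
  · obtain ⟨i', rfl⟩ : ∃ i', i = d + i' := ⟨i - d, by omega⟩
    have : x ^ a * y ^ (d + i') * z ^ j
        = - ∑ l ∈ Finset.range d, x ^ a * aeval x (f.coeff l) * (y ^ (l + i') * z ^ j) := by
      rw [pow_add, hy', neg_mul, mul_neg, neg_mul, Finset.sum_mul, Finset.mul_sum, Finset.sum_mul]
      congr 1
      refine Finset.sum_congr rfl fun l _ => ?_
      ring
    rw [this]
    refine Submodule.neg_mem _ (Submodule.sum_mem _ fun l hl => ?_)
    rw [Finset.mem_range] at hl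
    refine pow_mul_aeval_mul_mem (hD l) fun m hm => ?_
    rw [← mul_assoc]
    refine ihn (l + i' + j) (by omega) j (l + i') (a + m) rfl ?_
    have : D * (l + i' + j) + D ≤ D * (d + i' + j) := by
      rw [← Nat.mul_succ]; exact Nat.mul_le_mul_left _ (by omega)
    omega
  by_cases hj : j < d - 1
  · exact Submodule.subset_span ⟨a, i, j, hk, hi, hj, rfl⟩
  obtain ⟨j', rfl⟩ : ∃ j', j = d - 1 + j' := ⟨j - (d - 1), by omega⟩
  have hz'' := hz'.resolve_right (by omega)
  have : x ^ a * y ^ i * z ^ (d - 1 + j')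
      = - ∑ u ∈ Finset.range (d - 1), x ^ a * y ^ (i + (d - 1 - u)) * z ^ (u + j')
        - ∑ l ∈ Finset.range d, ∑ u ∈ Finset.range l,
          x ^ a * aeval x (f.coeff l) * (y ^ (i + (l - 1 - u)) * z ^ (u + j')) := by
    rw [pow_add, hz'']
    have e1 : ∑ u ∈ Finset.range (d - 1), x ^ a * y ^ (i + (d - 1 - u)) * z ^ (u + j')
        = x ^ a * y ^ i * z ^ j' * ∑ u ∈ Finset.range (d - 1), z ^ u * y ^ (d - 1 - u) := by
      rw [Finset.mul_sum]
      refine Finset.sum_congr rfl fun u _ => ?_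
      rw [pow_add, pow_add]
      ring
    have e2 : ∑ l ∈ Finset.range d, ∑ u ∈ Finset.range l,
          x ^ a * aeval x (f.coeff l) * (y ^ (i + (l - 1 - u)) * z ^ (u + j'))
        = x ^ a * y ^ i * z ^ j' * ∑ l ∈ Finset.range d, aeval x (f.coeff l) *
          ∑ u ∈ Finset.range l, z ^ u * y ^ (l - 1 - u) := by
      rw [Finset.mul_sum]
      refine Finset.sum_congr rfl fun l _ => ?_
      rw [Finset.mul_sum, Finset.mul_sum]
      refine Finset.sum_congr rfl fun u _ => ?_
      rw [pow_add, pow_add]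
      ring
    rw [e1, e2]
    ring
  rw [this]
  refine Submodule.sub_mem _ (Submodule.neg_mem _ (Submodule.sum_mem _ fun u hu => ?_))
    (Submodule.sum_mem _ fun l hl => Submodule.sum_mem _ fun u hu => ?_)
  · rw [Finset.mem_range] at hu
    have e : i + (d - 1 - u) + (u + j') = i + (d - 1 + j') := by omega
    exact ihj (u + j') (by omega) (i + (d - 1 - u)) a (by omega) (by rw [e]; exact hk)
  · rw [Finset.mem_range] at hu hl
    refine pow_mul_aeval_mul_mem (hD l) fun m hm => ?_
    rw [← mul_assoc]
    refine ihn (i + (l - 1 - u) + (u + j')) (by omega) _ _ _ rfl ?_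
    have : D * (i + (l - 1 - u) + (u + j')) + D ≤ D * (i + (d - 1 + j')) := by
      rw [← Nat.mul_succ]; exact Nat.mul_le_mul_left _ (by omega)
    omega

end Monomials

section Dimension

variable {K S : Type*} [Field K] [CommRing S] [Algebra K S]

lemma monomialFiltration_finrank_le {f : K[X][X]} {d D : ℕ} (hf : f.Monic) (hd : f.natDegree = d)
    (hD : ∀ j, (f.coeff j).natDegree ≤ D) {x y z : S}
    (hy : (specX x f).eval y = 0) (hz : divDiff f x y z = 0) (k : ℕ) :
    FiniteDimensional K (monomialFiltration K D x y z k) ∧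
    Module.finrank K (monomialFiltration K D x y z k) ≤ (k + 1) * (d * (d - 1)) := by
  classical
  set s : Finset S := (Finset.range (k + 1) ×ˢ (Finset.range d ×ˢ Finset.range (d - 1))).image
    fun t => x ^ t.1 * y ^ t.2.1 * z ^ t.2.2 with hs
  have hle : monomialFiltration K D x y z k ≤ Submodule.span K (s : Set S) := by
    refine Submodule.span_le.mpr ?_
    rintro w ⟨a, i, j, h, rfl⟩
    have := monomial_mem_reducedSpan hf hd hD hy hz _ j i a rfl h
    refine Submodule.span_mono ?_ this
    rintro w ⟨a, i, j, h, hi, hj, rfl⟩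
    simp only [hs, Finset.coe_image, Set.mem_image, Finset.mem_coe, Finset.mem_product,
      Finset.mem_range]
    refine ⟨(a, i, j), ⟨?_, hi, hj⟩, rfl⟩
    have := Nat.le_add_right a (D * (i + j))
    exact Nat.lt_succ_of_le (this.trans h)
  have hfin : FiniteDimensional K (Submodule.span K (s : Set S)) :=
    FiniteDimensional.span_of_finite K s.finite_toSet
  refine ⟨Submodule.finiteDimensional_of_le hle, ?_⟩
  refine (Submodule.finrank_mono hle).trans ((finrank_span_finset_le_card s).trans ?_)
  refine Finset.card_image_le.trans ?_
  simp

end Dimension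

section AuxiliaryPolynomial

/-- The value `∑ c_{ijkl} x^i y^j u^k w^l`. -/
noncomputable def auxEval {K T : Type*} [CommRing K] [CommRing T] [Algebra K T] {A B d : ℕ}
    (c : Fin A × Fin d × Fin B × Fin d → K) (x y u w : T) : T :=
  ∑ t, c t • (x ^ (t.1 : ℕ) * y ^ (t.2.1 : ℕ) * u ^ (t.2.2.1 : ℕ) * w ^ (t.2.2.2 : ℕ))

lemma map_auxEval {K T S : Type*} [CommRing K] [CommRing T] [Algebra K T] [CommRing S] [Algebra K S]
    {A B d : ℕ} (φ : T →ₐ[K] S) (c : Fin A × Fin d × Fin B × Fin d → K) (x y u w : T) :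
    φ (auxEval c x y u w) = auxEval c (φ x) (φ y) (φ u) (φ w) := by
  simp [auxEval, map_sum]

/-- The universal algebra with three elements `x, y, z` such that `(x, y)` and `(x, z)` are
generically distinct points on the curve `f = 0`. -/
lemma exists_universal_conjugate_pair.{u, v} {K : Type u} [Field K] (f : K[X][X]) :
    ∃ (R : Type u) (_ : CommRing R) (_ : Algebra K R) (x y z : R), (specX x f).eval y = 0 ∧
      divDiff f x y z = 0 ∧ ∀ {O : Type v} [CommRing O] [Algebra K O] (x' y' z' : O),
        (specX x' f).eval y' = 0 → divDiff f x' y' z' = 0 →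
        ∃ φ : R →ₐ[K] O, φ x = x' ∧ φ y = y' ∧ φ z = z' := by
  let I : Ideal (MvPolynomial (Fin 3) K) :=
    Ideal.span {(specX (MvPolynomial.X 0 : MvPolynomial (Fin 3) K) f).eval (MvPolynomial.X 1),
    divDiff f (MvPolynomial.X 0 : MvPolynomial (Fin 3) K) (MvPolynomial.X 1) (MvPolynomial.X 2)}
  let π : MvPolynomial (Fin 3) K →ₐ[K] MvPolynomial (Fin 3) K ⧸ I := Ideal.Quotient.mkₐ K I
  refine ⟨MvPolynomial (Fin 3) K ⧸ I, inferInstance, inferInstance, π (MvPolynomial.X 0),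
    π (MvPolynomial.X 1), π (MvPolynomial.X 2), ?_, ?_, ?_⟩
  · rw [← map_eval_specX]
    exact Ideal.Quotient.eq_zero_iff_mem.mpr (Ideal.subset_span (by simp))
  · rw [← map_divDiff]
    exact Ideal.Quotient.eq_zero_iff_mem.mpr (Ideal.subset_span (by simp))
  intro O _ _ x' y' z' hxy' hxyz'
  let φ₀ : MvPolynomial (Fin 3) K →ₐ[K] O := MvPolynomial.aeval ![x', y', z']
  have h0 : φ₀ (MvPolynomial.X 0) = x' := by simp [φ₀]
  have h1 : φ₀ (MvPolynomial.X 1) = y' := by simp [φ₀]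
  have h2 : φ₀ (MvPolynomial.X 2) = z' := by simp [φ₀]
  have hφI : ∀ a ∈ I, φ₀ a = 0 := by
    intro a ha
    have : I ≤ RingHom.ker φ₀.toRingHom := by
      refine Ideal.span_le.mpr ?_
      rintro b (rfl | rfl)
      · change φ₀ _ = 0
        rw [map_eval_specX, h0, h1, hxy']
      · change φ₀ _ = 0
        rw [map_divDiff, h0, h1, h2, hxyz']
    exact this ha
  exact ⟨Ideal.Quotient.liftₐ I φ₀ hφI, h0, h1, h2⟩

open IsAlgFiltration in
/-- A nonzero auxiliary polynomial vanishing to high order along all formal branches through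
points `(x, y, x, z)` with `y`, `z` conjugate. -/
theorem exists_auxEval_dvd.{u, v} {K : Type u} [Field K] {f : K[X][X]} {d D : ℕ} (hf : f.Monic)
    (hd : f.natDegree = d) (hD : ∀ j, (f.coeff j).natDegree ≤ D) {A B M : ℕ}
    (hcount : ∑ m ∈ Finset.range M,
      (2 * (D * (d + 1)) * m + (A + B + 2 * d * D) + 1) * (d * (d - 1)) < A * (d * (B * d))) :
    ∃ c : Fin A × Fin d × Fin B × Fin d → K, c ≠ 0 ∧
      ∀ {O : Type v} [CommRing O] [Algebra K O] (x y z σ : O), (specX x f).eval y = 0 →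
        divDiff f x y z = 0 → ∃ Z : O, σ ∣ Z - z ∧
          σ ^ M ∣ (specX (x + (specX x (derivative f)).eval z ^ 2 * σ) f).eval Z ∧
          σ ^ M ∣ auxEval c x y (x + (specX x (derivative f)).eval z ^ 2 * σ) Z := by
  classical
  obtain ⟨R, _, _, x, y, z, hxy, hxyz, huniv⟩ := exists_universal_conjugate_pair.{u, v} f
  have hxz : (specX x f).eval z = 0 := by
    have := divDiff_mul_sub f x y z
    rw [hxyz, zero_mul, hxy, sub_zero] at this
    exact this.symm
  set F := monomialFiltration K D x y z with hFdef
  have hF : IsAlgFiltration F := monomialFiltration_isAlgFiltration D x y z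
  have hxF : x ∈ F 1 := by
    simpa using monomial_mem_monomialFiltration (K := K) D x y z (a := 1) (i := 0) (j := 0)
      (k := 1) (by simp)
  have hyF : y ∈ F D := by
    simpa using monomial_mem_monomialFiltration (K := K) D x y z (a := 0) (i := 1) (j := 0)
      (k := D) (by simp)
  have hzF : z ∈ F D := by
    simpa using monomial_mem_monomialFiltration (K := K) D x y z (a := 0) (i := 0) (j := 1)
      (k := D) (by simp)
  set δ := (specX x (derivative f)).eval z with hδ
  obtain ⟨Z, hZG, hZz, hZf⟩ := exists_formal_branch hF hd.le hD hxF hzF hxz hδ M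
  set κ := 2 * (D * (d + 1)) with hκ
  set G := polyFiltration F κ with hGdef
  have hG : IsAlgFiltration G := hF.polyFiltration_isAlgFiltration _
  set u : R[X] := C x + C (δ ^ 2) * X with hu
  have hδF : δ ∈ F (D * (d + 1)) := by
    rw [hδ, specX_derivative]
    refine hF.mem_of_le (hF.eval_mem (a := D) (b := D) (n := d) ?_ ?_ hzF) (by lia)
    · intro i
      rw [coeff_derivative, mul_comm, specX_coeff]
      have := hF.aeval_mem (hD (i + 1)) hxF
      rw [mul_one] at this
      exact_mod_cast natCast_mul_mem this (i + 1)
    · exact (natDegree_derivative_le _).trans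
        ((Nat.sub_le _ _).trans ((natDegree_specX_le _ _).trans hd.le))
  have huG : u ∈ G 1 := by
    refine Submodule.add_mem _ (hF.C_mem_polyFiltration hxF) ?_
    rw [mul_comm (C (δ ^ 2))]
    exact hG.mem_of_le (a := 0) (X_mul_mem_polyFiltration (hF.C_mem_polyFiltration (by
      rw [add_zero]; exact hF.pow_mem hδF 2))) zero_le_one
  have haux : ∀ c : Fin A × Fin d × Fin B × Fin d → K,
      auxEval c (C x) (C y) u Z ∈ G (A + B + 2 * d * D) := by
    intro c
    refine Submodule.sum_mem _ fun t _ => Submodule.smul_mem _ _ ?_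
    refine hG.mem_of_le (hG.mul_mem (hG.mul_mem (hG.mul_mem
      (hG.pow_mem (hF.C_mem_polyFiltration hxF) _) (hG.pow_mem (hF.C_mem_polyFiltration hyF) _))
      (hG.pow_mem huG _)) (hG.pow_mem hZG _)) ?_
    have h1 := t.1.2
    have h2 : (t.2.1 : ℕ) * D ≤ d * D := Nat.mul_le_mul_right _ t.2.1.2.le
    have h3 := t.2.2.1.2
    have h4 : (t.2.2.2 : ℕ) * D ≤ d * D := Nat.mul_le_mul_right _ t.2.2.2.2.le
    lia
  have hfin := fun k => (monomialFiltration_finrank_le hf hd hD hxy hxyz k).1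
  have hrank := fun k => (monomialFiltration_finrank_le hf hd hD hxy hxyz k).2
  set L : (Fin A × Fin d × Fin B × Fin d → K) →ₗ[K]
      ((m : Fin M) → F (κ * m + (A + B + 2 * d * D))) :=
    { toFun := fun c m => ⟨(auxEval c (C x) (C y) u Z).coeff m, haux c m⟩
      map_add' := by
        intro c c'
        ext m
        simp [auxEval, add_smul, Finset.sum_add_distrib]
      map_smul' := by
        intro r c
        ext m
        simp [auxEval, mul_smul, ← Finset.smul_sum] } with hL
  have : ∀ m : Fin M, FiniteDimensional K (F (κ * m + (A + B + 2 * d * D))) := fun m => hfin _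
  have hker : LinearMap.ker L ≠ ⊥ := by
    refine LinearMap.ker_ne_bot_of_finrank_lt ?_
    rw [Module.finrank_pi_fintype, Module.finrank_fintype_fun_eq_card]
    refine lt_of_le_of_lt (Finset.sum_le_sum fun m _ => hrank _) ?_
    rw [Fin.sum_univ_eq_sum_range
      (fun m => (κ * m + (A + B + 2 * d * D) + 1) * (d * (d - 1))) M]
    simpa using hcount
  obtain ⟨c, hcker, hc0⟩ := Submodule.exists_mem_ne_zero_of_ne_bot hker
  refine ⟨c, hc0, ?_⟩
  have hauxdvd : X ^ M ∣ auxEval c (C x) (C y) u Z := by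
    rw [X_pow_dvd_iff]
    intro m hm
    have := congrFun (LinearMap.mem_ker.mp hcker) ⟨m, hm⟩
    exact congrArg Subtype.val this
  intro O _ _ x' y' z' σ hxy' hxyz'
  obtain ⟨φ, hφx, hφy, hφz⟩ := huniv x' y' z' hxy' hxyz'
  set ψ : R[X] →ₐ[K] O := eval₂AlgHom φ σ (fun _ => Commute.all _ _) with hψ
  have hψC : ∀ r, ψ (C r) = φ r := fun r => by simp [hψ]
  have hψX : ψ X = σ := by simp [hψ]
  have hδ' : φ δ = (specX x' (derivative f)).eval z' := by rw [hδ, map_eval_specX, hφx, hφz]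
  have hψu : ψ u = x' + (specX x' (derivative f)).eval z' ^ 2 * σ := by
    rw [hu, map_add, map_mul, hψC, hψC, hψX, map_pow, hδ', hφx]
  refine ⟨ψ Z, ?_, ?_, ?_⟩
  · have := map_dvd ψ hZz
    rwa [map_sub, hψC, hψX, hφz] at this
  · have := map_dvd ψ hZf
    rwa [map_pow, hψX, map_eval_specX, hψu] at this
  · have := map_dvd ψ hauxdvd
    rwa [map_pow, hψX, map_auxEval, hψC, hψC, hφx, hφy, hψu] at this

end AuxiliaryPolynomial

section LocalBranches

variable {K k : Type*} [Field K] [Field k] [Algebra K k]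

/-- The generic point `x₀ + t` of the formal neighbourhood of `x₀`. -/
noncomputable def nearPoint (k : Type*) {K : Type*} [Field K] [Field k] [Algebra K k] (x₀ : K) :
    PowerSeries k := algebraMap K (PowerSeries k) x₀ + PowerSeries.X

/-- The constant coefficient as a homomorphism of algebras over a subfield. -/
noncomputable def constCoeffHom (K k : Type*) [Field K] [Field k] [Algebra K k] :
    PowerSeries k →ₐ[K] k where
  __ := PowerSeries.constantCoeff (R := k)
  commutes' r := by simp [PowerSeries.algebraMap_apply]

lemma constCoeffHom_apply (p : PowerSeries k) :
    constCoeffHom K k p = PowerSeries.constantCoeff p := rfl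

lemma constCoeffHom_nearPoint (x₀ : K) :
    constCoeffHom K k (nearPoint k x₀) = algebraMap K k x₀ := by
  rw [nearPoint, map_add, AlgHom.commutes, constCoeffHom_apply, PowerSeries.constantCoeff_X,
    add_zero]

lemma exists_branch {f : K[X][X]} (hf : f.Monic) {x₀ : K} {ρ : k}
    (hρ : (specX (algebraMap K k x₀) f).eval ρ = 0)
    (hρ' : (specX (algebraMap K k x₀) (derivative f)).eval ρ ≠ 0) :
    ∃ y : PowerSeries k, (specX (nearPoint k x₀) f).eval y = 0 ∧
      PowerSeries.constantCoeff y = ρ := by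
  have key : ∀ g : K[X][X], PowerSeries.constantCoeff
      ((specX (nearPoint k x₀) g).eval (PowerSeries.C ρ))
      = (specX (algebraMap K k x₀) g).eval ρ := by
    intro g
    rw [← constCoeffHom_apply (K := K), map_eval_specX, constCoeffHom_nearPoint,
      constCoeffHom_apply]
    simp
  obtain ⟨y, hy, hy'⟩ := HenselianRing.is_henselian (I := Ideal.span {PowerSeries.X})
    (specX (nearPoint k x₀) f) (specX_monic hf _) (PowerSeries.C ρ)
    (by rw [Ideal.mem_span_singleton, PowerSeries.X_dvd_iff, key, hρ])
    (by
      refine IsUnit.map _ ?_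
      rw [PowerSeries.isUnit_iff_constantCoeff, ← specX_derivative, key]
      exact isUnit_iff_ne_zero.mpr hρ')
  refine ⟨y, hy, ?_⟩
  rw [Ideal.mem_span_singleton, PowerSeries.X_dvd_iff, map_sub, sub_eq_zero] at hy'
  simpa using hy'

lemma sub_dvd_auxEval_sub {T : Type*} [CommRing T] [Algebra K T] {A B d : ℕ}
    (c : Fin A × Fin d × Fin B × Fin d → K) (x y u v w : T) :
    v - w ∣ auxEval c x y u v - auxEval c x y u w := by
  rw [auxEval, auxEval, ← Finset.sum_sub_distrib]
  refine Finset.dvd_sum fun t _ => ?_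
  rw [← smul_sub, ← mul_sub]
  exact dvd_smul_of_dvd _ ((sub_dvd_pow_sub_pow v w _).mul_left _)

/-- The auxiliary polynomial vanishes to high order along the graph of Frobenius at every branch
which is not fixed by Frobenius. -/
lemma X_pow_dvd_auxEval_frobenius [Fintype K] {f : K[X][X]} (hf : f.Monic) {A B M d : ℕ}
    {c : Fin A × Fin d × Fin B × Fin d → K}
    (hc : ∀ (x y z σ : PowerSeries k), (specX x f).eval y = 0 →
        divDiff f x y z = 0 → ∃ Z : PowerSeries k, σ ∣ Z - z ∧
          σ ^ M ∣ (specX (x + (specX x (derivative f)).eval z ^ 2 * σ) f).eval Z ∧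
          σ ^ M ∣ auxEval c x y (x + (specX x (derivative f)).eval z ^ 2 * σ) Z)
    {x₀ : K} {y : PowerSeries k} (hy : (specX (nearPoint k x₀) f).eval y = 0)
    (hne : PowerSeries.constantCoeff y ^ Fintype.card K ≠ PowerSeries.constantCoeff y)
    (hsep : ∀ ρ : k, (specX (algebraMap K k x₀) f).eval ρ = 0 →
      (specX (algebraMap K k x₀) (derivative f)).eval ρ ≠ 0) :
    (PowerSeries.X : PowerSeries k) ^ M ∣ auxEval c (nearPoint k x₀) y
      (nearPoint k x₀ ^ Fintype.card K) (y ^ Fintype.card K) := by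
  classical
  set q := Fintype.card K with hq
  set ρ := PowerSeries.constantCoeff y with hρdef
  set x := nearPoint k x₀ with hx
  have hq0 : q ≠ 0 := Fintype.card_ne_zero
  have hx₀q : algebraMap K k x₀ ^ q = algebraMap K k x₀ := by
    rw [← map_pow, FiniteField.pow_card]
  have hρ : (specX (algebraMap K k x₀) f).eval ρ = 0 := by
    have := congrArg (constCoeffHom K k) hy
    rwa [map_eval_specX, constCoeffHom_nearPoint, map_zero] at this
  have hρq : (specX (algebraMap K k x₀) f).eval (ρ ^ q) = 0 := by
    have := congrArg (FiniteField.frobeniusAlgHom K k) hρ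
    rw [map_eval_specX, map_zero] at this
    simpa [FiniteField.coe_frobeniusAlgHom, ← hq, hx₀q] using this
  obtain ⟨z, hz, hz0⟩ := exists_branch hf hρq (hsep _ hρq)
  have hdiv : divDiff f x y z = 0 := by
    have h1 := divDiff_mul_sub f x y z
    rw [hy, hz, sub_zero] at h1
    refine (mul_eq_zero.mp h1).resolve_right fun h => hne ?_
    rw [sub_eq_zero] at h
    rw [← hz0, h]
  set δ := (specX x (derivative f)).eval z with hδ
  have hδunit : IsUnit δ := by
    rw [PowerSeries.isUnit_iff_constantCoeff, ← constCoeffHom_apply (K := K), hδ, map_eval_specX,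
      constCoeffHom_nearPoint, constCoeffHom_apply, hz0]
    exact isUnit_iff_ne_zero.mpr (hsep _ hρq)
  obtain ⟨ε, hε⟩ := hδunit.exists_right_inv
  set σ := ε ^ 2 * (x ^ q - x) with hσ
  have hxσ : x + δ ^ 2 * σ = x ^ q := by
    rw [hσ]
    linear_combination (δ * ε + 1) * (x ^ q - x) * hε
  have hXσ : (PowerSeries.X : PowerSeries k) ∣ σ := by
    refine Dvd.dvd.mul_left ?_ _
    rw [PowerSeries.X_dvd_iff, ← constCoeffHom_apply (K := K), map_sub, map_pow, hx,
      constCoeffHom_nearPoint, hx₀q, sub_self]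
  obtain ⟨Z, hZz, hZf, hZaux⟩ := hc x y z σ hy hdiv
  rw [← hδ, hxσ] at hZf hZaux
  have hZf' := (pow_dvd_pow_of_dvd hXσ M).trans hZf
  have hZaux' := (pow_dvd_pow_of_dvd hXσ M).trans hZaux
  have hZ0 : PowerSeries.constantCoeff Z = ρ ^ q := by
    have := hXσ.trans hZz
    rw [PowerSeries.X_dvd_iff, map_sub, hz0, sub_eq_zero] at this
    exact this
  have hw : (specX (x ^ q) f).eval (y ^ q) = 0 := by
    have := congrArg (FiniteField.frobeniusAlgHom K (PowerSeries k)) hy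
    rw [map_eval_specX, map_zero] at this
    simpa [FiniteField.coe_frobeniusAlgHom, ← hq] using this
  have hZw : (PowerSeries.X : PowerSeries k) ^ M ∣ Z - y ^ q := by
    obtain ⟨r, hr⟩ := (specX (x ^ q) f).binomExpansion (y ^ q) (Z - y ^ q)
    rw [add_sub_cancel, hw, zero_add] at hr
    rw [hr] at hZf'
    have hu : IsUnit ((derivative (specX (x ^ q) f)).eval (y ^ q) + r * (Z - y ^ q)) := by
      rw [PowerSeries.isUnit_iff_constantCoeff, map_add, map_mul, map_sub, hZ0, map_pow,
        ← hρdef, sub_self, mul_zero, add_zero, ← specX_derivative, ← constCoeffHom_apply (K := K),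
        map_eval_specX, map_pow, map_pow, hx, constCoeffHom_nearPoint, hx₀q, constCoeffHom_apply]
      exact isUnit_iff_ne_zero.mpr (hsep _ hρq)
    have e : (derivative (specX (x ^ q) f)).eval (y ^ q) * (Z - y ^ q) + r * (Z - y ^ q) ^ 2
        = ((derivative (specX (x ^ q) f)).eval (y ^ q) + r * (Z - y ^ q)) * (Z - y ^ q) := by ring
    rw [e] at hZf'
    exact (hu.dvd_mul_left).mp hZf'
  have := dvd_sub hZaux' (hZw.trans (sub_dvd_auxEval_sub c x y (x ^ q) Z (y ^ q)))
  simpa using this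

end LocalBranches

section ResultantDegree

variable {K : Type*} [CommRing K]

lemma natDegree_det_le {ι : Type*} [Fintype ι] [DecidableEq ι] (M : Matrix ι ι K[X]) (e : ι → ℕ)
    (h : ∀ i j, (M i j).natDegree ≤ e j) : M.det.natDegree ≤ ∑ j, e j := by
  rw [Matrix.det_apply]
  refine natDegree_sum_le_of_forall_le _ _ fun σ _ => ?_
  refine (natDegree_smul_le _ _).trans ((natDegree_prod_le _ _).trans ?_)
  exact Finset.sum_le_sum fun i _ => h _ _

lemma natDegree_resultant_le {f g : K[X][X]} {m n D E : ℕ} (hf : ∀ i, (f.coeff i).natDegree ≤ D)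
    (hg : ∀ i, (g.coeff i).natDegree ≤ E) : (resultant f g m n).natDegree ≤ m * E + n * D := by
  refine (natDegree_det_le (sylvester f g m n)
    (fun j => j.addCases (fun _ => E) (fun _ => D)) ?_).trans (le_of_eq ?_)
  · intro i j
    induction j using Fin.addCases with
    | left j =>
      simp only [sylvester, Matrix.of_apply, Fin.addCases_left]
      split_ifs
      · exact hg _
      · simp
    | right j =>
      simp only [sylvester, Matrix.of_apply, Fin.addCases_right]
      split_ifs
      · exact hf _
      · simp
  · rw [Fin.sum_univ_add]
    simp

end ResultantDegree

section Specialization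

variable {K R : Type*} [CommRing K] [CommRing R] [Algebra K R]

/-- Evaluation of bivariate polynomials as an algebra homomorphism. -/
noncomputable def evalHom (x y : R) : K[X][X] →ₐ[K] R :=
  eval₂AlgHom (aeval x) y fun _ => Commute.all _ _

lemma evalHom_apply (x y : R) (f : K[X][X]) : evalHom x y f = (specX x f).eval y := by
  rw [specX, eval_map]
  rfl

lemma evalHom_X (x y : R) : evalHom (K := K) x y X = y := by
  rw [evalHom_apply]; simp [specX]

lemma evalHom_C_X (x y : R) : evalHom (K := K) x y (C X) = x := by
  rw [evalHom_apply]; simp [specX]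

end Specialization

section AuxPoly

variable {K : Type*} [CommRing K] {A B d : ℕ}

/-- The auxiliary polynomial restricted to the graph of the `q`-power map. -/
noncomputable def auxPoly (q : ℕ) (c : Fin A × Fin d × Fin B × Fin d → K) : K[X][X] :=
  auxEval c (C X) X (C X ^ q) (X ^ q)

lemma eval_specX_auxPoly {R : Type*} [CommRing R] [Algebra K R] (q : ℕ)
    (c : Fin A × Fin d × Fin B × Fin d → K) (x y : R) :
    (specX x (auxPoly q c)).eval y = auxEval c x y (x ^ q) (y ^ q) := by
  rw [← evalHom_apply, auxPoly, map_auxEval, map_pow, map_pow, evalHom_X, evalHom_C_X]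

lemma auxPoly_eq_sum (q : ℕ) (c : Fin A × Fin d × Fin B × Fin d → K) :
    auxPoly q c = ∑ t, C (C (c t) * X ^ ((t.1 : ℕ) + q * t.2.2.1))
      * X ^ ((t.2.1 : ℕ) + q * t.2.2.2) := by
  rw [auxPoly, auxEval]
  refine Finset.sum_congr rfl fun t _ => ?_
  have : ∀ (a : K) (p : K[X][X]), a • p = C (C a) * p := fun a p => by
    rw [← smul_eq_C_mul]
    exact (IsScalarTower.algebraMap_smul K[X] a p).symm
  rw [this]
  simp only [map_mul, map_pow]
  ring

lemma natDegree_auxPoly_le (q : ℕ) (c : Fin A × Fin d × Fin B × Fin d → K) :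
    (auxPoly q c).natDegree ≤ (d - 1) * (1 + q) := by
  rw [auxPoly_eq_sum]
  refine natDegree_sum_le_of_forall_le _ _ fun t _ => ?_
  refine (natDegree_C_mul_X_pow_le _ _).trans ?_
  have h1 : (t.2.1 : ℕ) ≤ d - 1 := by have := t.2.1.2; omega
  have h2 : q * (t.2.2.2 : ℕ) ≤ q * (d - 1) :=
    Nat.mul_le_mul_left _ (by have := t.2.2.2.2; omega)
  lia

lemma natDegree_coeff_auxPoly_le (q : ℕ) (c : Fin A × Fin d × Fin B × Fin d → K) (n : ℕ) :
    ((auxPoly q c).coeff n).natDegree ≤ A + q * B := by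
  rw [auxPoly_eq_sum, finsetSum_coeff]
  refine natDegree_sum_le_of_forall_le _ _ fun t _ => ?_
  rw [coeff_C_mul, coeff_X_pow, mul_ite, mul_one, mul_zero]
  have h1 := t.1.2
  have h2 : q * (t.2.2.1 : ℕ) ≤ q * B := Nat.mul_le_mul_left _ t.2.2.1.2.le
  split_ifs
  · refine (natDegree_C_mul_X_pow_le _ _).trans ?_
    omega
  · simp

end AuxPoly

section RootCount

variable {K : Type*} [Field K] [Fintype K]

lemma mem_range_algebraMap_of_pow_card_eq {k : Type*} [Field k] [Algebra K k] {ρ : k}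
    (h : ρ ^ Fintype.card K = ρ) : ∃ a : K, algebraMap K k a = ρ := by
  classical
  have h1 : (X ^ Fintype.card K - X : K[X]) = ∏ a : K, (X - C a) := by
    have hm : (X ^ Fintype.card K - X : K[X]).Monic :=
      monic_X_pow_sub (by rw [degree_X]; exact_mod_cast Fintype.one_lt_card)
    have hc : (X ^ Fintype.card K - X : K[X]).roots.card
        = (X ^ Fintype.card K - X : K[X]).natDegree := by
      rw [FiniteField.roots_X_pow_card_sub_X, FiniteField.X_pow_card_sub_X_natDegree_eq K
        Fintype.one_lt_card]
      rfl
    have := prod_multiset_X_sub_C_of_monic_of_roots_card_eq hm hc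
    rw [FiniteField.roots_X_pow_card_sub_X] at this
    exact this.symm
  have h2 := congrArg (aeval ρ) h1
  simp only [map_sub, map_pow, aeval_X, h, sub_self, map_prod, aeval_C] at h2
  obtain ⟨a, -, ha⟩ := Finset.prod_eq_zero_iff.mp h2.symm
  exact ⟨a, (sub_eq_zero.mp ha).symm⟩

open Classical in
/-- The number of `K`-points on the curve `f = 0` above `x₀`. -/
noncomputable def fiberCard (f : K[X][X]) (x₀ : K) : ℕ := (specX x₀ f).roots.toFinset.card

lemma X_sub_C_pow_dvd_of_X_pow_dvd_aeval {k : Type*} [Field k] [Algebra K k] {r : K[X]} {x₀ : K}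
    {e : ℕ} (h : (PowerSeries.X : PowerSeries k) ^ e ∣ aeval (nearPoint k x₀) r) :
    (X - C x₀) ^ e ∣ r := by
  rw [X_sub_C_pow_dvd_iff]
  have h1 : aeval (nearPoint k x₀) r
      = (((r.comp (X + C x₀)).map (algebraMap K k) : k[X]) : PowerSeries k) := by
    have : aeval (nearPoint k x₀) r
        = aeval (PowerSeries.X : PowerSeries k) (r.comp (X + C x₀)) := by
      rw [aeval_comp, map_add, aeval_X, aeval_C, nearPoint, add_comm]
    rw [this, ← aeval_map_algebraMap k]
    exact Polynomial.eval₂_C_X_eq_coe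
  rw [h1, PowerSeries.X_pow_dvd_iff] at h
  rw [X_pow_dvd_iff]
  intro m hm
  have := h m hm
  rw [coeff_coe, coeff_map] at this
  exact (map_eq_zero _).mp this

/-- Each branch of the curve which is not fixed by Frobenius contributes to the vanishing order of
the resultant of `f` with the auxiliary polynomial. -/
lemma X_sub_C_pow_dvd_resultant {f : K[X][X]} (hf : f.Monic) {A B M d : ℕ} (hd : f.natDegree = d)
    {c : Fin A × Fin d × Fin B × Fin d → K}
    (hc : ∀ (x y z σ : PowerSeries (AlgebraicClosure K)), (specX x f).eval y = 0 →
        divDiff f x y z = 0 → ∃ Z : PowerSeries (AlgebraicClosure K), σ ∣ Z - z ∧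
          σ ^ M ∣ (specX (x + (specX x (derivative f)).eval z ^ 2 * σ) f).eval Z ∧
          σ ^ M ∣ auxEval c x y (x + (specX x (derivative f)).eval z ^ 2 * σ) Z)
    {x₀ : K} (hsep : (specX x₀ f : K[X]).Separable) :
    (X - C x₀) ^ (M * (d - fiberCard f x₀)) ∣
      resultant f (auxPoly (Fintype.card K) c) d ((d - 1) * (1 + Fintype.card K)) := by
  classical
  set k := AlgebraicClosure K
  set q := Fintype.card K with hq
  have hmap : specX (algebraMap K k x₀) f = (specX x₀ f).map (algebraMap K k) :=
    (specX_map (Algebra.ofId K k) x₀ f).symm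
  have hsepk : (specX (algebraMap K k x₀) f).Separable := by rw [hmap]; exact hsep.map
  set s := (specX (algebraMap K k x₀) f).roots.toFinset with hs
  have hne : specX (algebraMap K k x₀) f ≠ 0 := (specX_monic hf _).ne_zero
  have hmem : ∀ ρ, ρ ∈ s ↔ (specX (algebraMap K k x₀) f).eval ρ = 0 := by
    intro ρ
    rw [hs, Multiset.mem_toFinset, mem_roots hne, IsRoot]
  have hscard : s.card = d := by
    rw [hs, Multiset.toFinset_card_of_nodup (nodup_roots hsepk),
      IsAlgClosed.card_roots_eq_natDegree, specX, hf.natDegree_map, hd]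
  have hderiv : ∀ ρ : k, (specX (algebraMap K k x₀) f).eval ρ = 0 →
      (specX (algebraMap K k x₀) (derivative f)).eval ρ ≠ 0 := by
    intro ρ hρ
    rw [specX_derivative]
    have := hsepk.eval₂_derivative_ne_zero (RingHom.id k) (x := ρ) (by simpa [eval₂_id] using hρ)
    simpa using this
  have hbranch : ∀ ρ : s, ∃ y : PowerSeries k, (specX (nearPoint k x₀) f).eval y = 0 ∧
      PowerSeries.constantCoeff y = ρ := fun ρ =>
    exists_branch hf ((hmem _).mp ρ.2) (hderiv _ ((hmem _).mp ρ.2))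
  choose y hy hy0 using hbranch
  have hyinj : Function.Injective y := by
    intro ρ ρ' h
    apply Subtype.ext
    rw [← hy0, ← hy0, h]
  have hprod : specX (nearPoint k x₀) f = ∏ ρ : s, (X - C (y ρ)) := by
    have hmon := specX_monic (R := PowerSeries k) hf (nearPoint k x₀)
    have hle : (Finset.univ.image y).val ≤ (specX (nearPoint k x₀) f).roots := by
      rw [Multiset.le_iff_subset (Finset.nodup _)]
      intro a ha
      obtain ⟨ρ, -, rfl⟩ := Finset.mem_image.mp ha
      exact (mem_roots hmon.ne_zero).mpr (hy ρ)
    have hcard : Multiset.card (Finset.univ.image y).val = d := by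
      rw [Finset.card_val, Finset.card_image_of_injective _ hyinj, Finset.card_univ,
        Fintype.card_coe, hscard]
    have hdeg : (specX (nearPoint k x₀) f).natDegree = d := by
      rw [specX, hf.natDegree_map, hd]
    have heq : (Finset.univ.image y).val = (specX (nearPoint k x₀) f).roots := by
      refine Multiset.eq_of_le_of_card_le hle ?_
      rw [hcard, ← hdeg]
      exact card_roots' _
    rw [← prod_multiset_X_sub_C_of_monic_of_roots_card_eq hmon (by rw [← heq, hcard, hdeg]), ← heq]
    exact (Finset.prod_image (f := fun a => X - C a) (fun a _ b _ h => hyinj h))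
  apply X_sub_C_pow_dvd_of_X_pow_dvd_aeval (k := k)
  have hres : aeval (nearPoint k x₀) (resultant f (auxPoly q c) d ((d - 1) * (1 + q)))
      = ∏ ρ : s, auxEval c (nearPoint k x₀) (y ρ) (nearPoint k x₀ ^ q) (y ρ ^ q) := by
    have h1 := resultant_map_map f (auxPoly q c) d ((d - 1) * (1 + q))
      (aeval (nearPoint k x₀) : K[X] →ₐ[K] PowerSeries k).toRingHom
    have hdeg : (∏ ρ : s, (X - C (y ρ))).natDegree = d := by
      rw [← hprod, specX, hf.natDegree_map, hd]
    have hle : (specX (nearPoint k x₀) (auxPoly q c)).natDegree ≤ (d - 1) * (1 + q) :=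
      (natDegree_specX_le _ _).trans (natDegree_auxPoly_le q c)
    have h2 := resultant_prod_left (Finset.univ : Finset s) (fun ρ => X - C (y ρ))
      (specX (nearPoint k x₀) (auxPoly q c)) ((d - 1) * (1 + q)) (by simp) hle
    rw [hdeg, ← hprod] at h2
    refine h1.symm.trans (h2.trans (Finset.prod_congr rfl fun ρ _ => ?_))
    rw [natDegree_X_sub_C, resultant_X_sub_C_left _ _ _ hle, eval_specX_auxPoly]
  rw [hres]
  set bad : Finset s := Finset.univ.filter fun ρ => (ρ : k) ^ q ≠ ρ with hbad
  have hdvd : (PowerSeries.X : PowerSeries k) ^ (M * bad.card) ∣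
      ∏ ρ : s, auxEval c (nearPoint k x₀) (y ρ) (nearPoint k x₀ ^ q) (y ρ ^ q) := by
    refine Dvd.dvd.trans ?_ (Finset.prod_dvd_prod_of_subset bad Finset.univ _
      (Finset.subset_univ _))
    rw [pow_mul, ← Finset.prod_const]
    refine Finset.prod_dvd_prod_of_dvd _ _ fun ρ hρ => ?_
    refine X_pow_dvd_auxEval_frobenius hf hc (hy ρ) ?_ hderiv
    rw [hy0]
    exact (Finset.mem_filter.mp hρ).2
  refine (pow_dvd_pow _ (Nat.mul_le_mul_left M ?_)).trans hdvd
  have hsum : bad.card + badᶜ.card = d := by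
    rw [Finset.card_add_card_compl, Fintype.card_coe, hscard]
  have hgood : badᶜ.card ≤ fiberCard f x₀ := by
    have : Finset.image (fun ρ : s => (ρ : k)) badᶜ
        ⊆ Finset.image (algebraMap K k) (specX x₀ f).roots.toFinset := by
      intro a ha
      obtain ⟨ρ, hρ, rfl⟩ := Finset.mem_image.mp ha
      have hρ' : (ρ : k) ^ q = ρ := by simpa [hbad] using hρ
      obtain ⟨b, hb⟩ := mem_range_algebraMap_of_pow_card_eq hρ'
      refine Finset.mem_image.mpr ⟨b, ?_, hb⟩
      rw [Multiset.mem_toFinset, mem_roots (specX_monic hf _).ne_zero, IsRoot]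
      have h0 := (hmem _).mp ρ.2
      rw [← hb, hmap, eval_map_algebraMap, aeval_algebraMap_apply] at h0
      simpa using h0
    have h1 := Finset.card_le_card this
    rw [Finset.card_image_of_injective _ Subtype.val_injective,
      Finset.card_image_of_injective _ (algebraMap K k).injective] at h1
    rw [fiberCard]
    convert h1
  omega

end RootCount

section Independence

variable {K : Type*} [Field K] [Fintype K]

lemma sum_pow_card_mul_X_pow_eq_zero {p : ℕ → K[X]}
    (h : ∑ i ∈ Finset.range (Fintype.card K), p i ^ Fintype.card K * X ^ i = 0) :
    ∀ i < Fintype.card K, p i = 0 := by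
  classical
  set q := Fintype.card K with hq
  have hq0 : 0 < q := Fintype.card_pos
  intro i hi
  ext k
  have h1 := congrArg (fun r => coeff r (k * q + i)) h
  simp only [finsetSum_coeff, coeff_zero] at h1 ⊢
  rw [Finset.sum_eq_single i] at h1
  · rwa [coeff_mul_X_pow, hq, ← FiniteField.expand_card, coeff_expand_mul hq0] at h1
  · intro j hj hji
    rw [Finset.mem_range] at hj
    rw [coeff_mul_X_pow']
    split_ifs with hle
    · rw [← FiniteField.expand_card, coeff_expand hq0, if_neg]
      rintro ⟨e, he⟩
      apply hji
      have h2 : k * q + i = q * e + j := by omega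
      have h3 := congrArg (· % q) h2
      simp only [Nat.mul_add_mod, Nat.mul_add_mod_self_right] at h3
      rw [Nat.mod_eq_of_lt hj, Nat.mod_eq_of_lt hi] at h3
      exact h3.symm
    · rfl
  · intro hi'
    exact absurd (Finset.mem_range.mpr hi) hi'

lemma pow_card_aeval {k E : Type*} [Field k] [Field E] [Algebra k E] [Algebra K k] [Algebra K E]
    (w : E) (g : k[X]) : aeval w g ^ Fintype.card K
    = aeval (w ^ Fintype.card K) (g.map (FiniteField.frobeniusAlgHom K k).toRingHom) := by
  rw [aeval_def, aeval_def, eval₂_map]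
  have h1 := hom_eval₂ g (algebraMap k E) (FiniteField.frobeniusAlgHom K E).toRingHom w
  have h2 : (FiniteField.frobeniusAlgHom K E).toRingHom.comp (algebraMap k E)
      = (algebraMap k E).comp (FiniteField.frobeniusAlgHom K k).toRingHom := by
    ext a
    simp
  rw [h2] at h1
  simpa using h1

variable {k : Type*} [Field k] [Algebra K[X] k] [IsFractionRing K[X] k]

lemma sum_pow_card_mul_pow_eq_zero {a : ℕ → k}
    (h : ∑ i ∈ Finset.range (Fintype.card K),
      a i ^ Fintype.card K * algebraMap K[X] k X ^ i = 0) :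
    ∀ i < Fintype.card K, a i = 0 := by
  classical
  obtain ⟨b, hb⟩ := IsLocalization.exist_integer_multiples (nonZeroDivisors K[X])
    (Finset.range (Fintype.card K)) a
  choose! p hp using hb
  have hb0 : algebraMap K[X] k b ≠ 0 :=
    IsFractionRing.to_map_ne_zero_of_mem_nonZeroDivisors b.2
  have hp' : ∀ i < Fintype.card K, algebraMap K[X] k (p i) = algebraMap K[X] k b * a i := by
    intro i hi
    rw [hp i (Finset.mem_range.mpr hi), Algebra.smul_def]
  have hz := sum_pow_card_mul_X_pow_eq_zero (p := p) (by
    apply IsFractionRing.injective K[X] k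
    rw [map_zero, map_sum, ← mul_zero (algebraMap K[X] k b ^ Fintype.card K), ← h, Finset.mul_sum]
    refine Finset.sum_congr rfl fun i hi => ?_
    rw [map_mul, map_pow, map_pow, hp' i (Finset.mem_range.mp hi)]
    ring)
  intro i hi
  have := hp' i hi
  rw [hz i hi, map_zero] at this
  exact (mul_eq_zero.mp this.symm).resolve_left hb0

variable [Algebra K k] {E : Type*} [Field E] [Algebra k E] [Algebra K E]

/-- The powers `1, u, …, u^(q-1)` of the coordinate function of a separable cover of the line
are linearly independent over `q`-th powers. -/
lemma eq_zero_of_sum_pow_card_mul_pow_eq_zero {w : E} (hw : IsSeparable k w)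
    (htop : Algebra.adjoin k {w} = ⊤) {τ : ℕ → E}
    (h : ∑ i ∈ Finset.range (Fintype.card K),
      τ i ^ Fintype.card K * algebraMap k E (algebraMap K[X] k X) ^ i = 0) :
    ∀ i < Fintype.card K, τ i = 0 := by
  classical
  set q := Fintype.card K with hq
  have hwint : IsIntegral k w := hw.isIntegral
  have hex : ∀ i, ∃ g : k[X], g.degree < (minpoly k w).degree ∧ aeval w g = τ i := by
    intro i
    have : τ i ∈ Algebra.adjoin k {w} := by rw [htop]; trivial
    rw [Algebra.adjoin_singleton_eq_range_aeval] at this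
    obtain ⟨g, hg⟩ := this
    refine ⟨g %ₘ minpoly k w, degree_modByMonic_lt _ (minpoly.monic hwint), ?_⟩
    rw [← hg]
    exact minpoly.aeval_modByMonic_minpoly g w
  choose g hgdeg hg using hex
  have hdeg : (minpoly k (w ^ q)).natDegree = (minpoly k w).natDegree := by
    obtain ⟨p, hp⟩ := CharP.exists K
    obtain ⟨n, hpp, hn⟩ := FiniteField.card K p
    have : Fact p.Prime := ⟨hpp⟩
    have : CharP k p := charP_of_injective_algebraMap (algebraMap K k).injective p
    have : ExpChar k p := ExpChar.prime hpp
    have h1 := IntermediateField.adjoin_simple_eq_adjoin_pow_expChar_pow_of_isSeparable k E hw p n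
    rw [← hn, ← hq] at h1
    rw [← IntermediateField.adjoin.finrank hwint, ← IntermediateField.adjoin.finrank (hwint.pow q),
      ← h1]
  set u := algebraMap K[X] k X with hu
  set H : k[X] := ∑ i ∈ Finset.range q,
    (g i).map (FiniteField.frobeniusAlgHom K k).toRingHom * C (u ^ i) with hH
  have hHeval : aeval (w ^ q) H = 0 := by
    rw [hH, map_sum, ← h]
    refine Finset.sum_congr rfl fun i _ => ?_
    rw [map_mul, aeval_C, ← pow_card_aeval, hg, map_pow]
  have hHdeg : H.degree < (minpoly k (w ^ q)).degree := by
    have e : (minpoly k (w ^ q)).degree = (minpoly k w).degree := by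
      rw [degree_eq_natDegree (minpoly.ne_zero hwint),
        degree_eq_natDegree (minpoly.ne_zero (hwint.pow q)), hdeg]
    rw [e]
    refine (degree_sum_le _ _).trans_lt ?_
    rw [Finset.sup_lt_iff (bot_lt_iff_ne_bot.mpr fun hb =>
      minpoly.ne_zero hwint (degree_eq_bot.mp hb))]
    intro i _
    refine lt_of_le_of_lt ?_ (hgdeg i)
    refine (degree_mul_le _ _).trans ((add_le_add degree_map_le degree_C_le).trans ?_)
    simp
  have hH0 : H = 0 := by
    by_contra hne
    exact absurd (minpoly.degree_le_of_ne_zero k (w ^ q) hne hHeval) (not_le.mpr hHdeg)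
  intro i hi
  rw [← hg i]
  suffices g i = 0 by rw [this, map_zero]
  ext l
  have h1 := congrArg (fun r => coeff r l) hH0
  simp only [hH, finsetSum_coeff, coeff_mul_C, coeff_map, coeff_zero] at h1
  exact sum_pow_card_mul_pow_eq_zero (a := fun i => (g i).coeff l) h1 i hi

end Independence

/-- A bivariate polynomial is absolutely irreducible if it is irreducible over every extension of
its field of coefficients. -/
def AbsIrr {K : Type} [Field K] (f : K[X][X]) : Prop :=
  ∀ (L : Type) [Field L] (φ : K →+* L), Irreducible (f.map (mapRingHom φ))

section Nonvanishing

lemma LinearIndependent.of_forall_eq {ι R M : Type*} [Semiring R] [AddCommMonoid M] [Module R M]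
    {v w : ι → M} (h : LinearIndependent R v) (e : ∀ i, v i = w i) : LinearIndependent R w := by
  rwa [← funext e]

lemma resultant_ne_zero_of_irreducible {k : Type*} [Field k] {f g : k[X]} (hf : f.Monic)
    (hirr : Irreducible f) {n : ℕ} (hg : g.natDegree ≤ n) (hfg : ¬ f ∣ g) :
    resultant f g f.natDegree n ≠ 0 := by
  have hco : IsCoprime f g := (hirr.coprime_iff_not_dvd).mpr hfg
  obtain ⟨e, rfl⟩ := Nat.exists_eq_add_of_le hg
  rw [resultant_add_right_deg _ _ _ _ _ le_rfl, coeff_natDegree, hf.leadingCoeff, one_pow, one_mul]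
  exact resultant_ne_zero f g hco

/-- The resultant of a monic irreducible polynomial with a polynomial it does
not divide is nonzero. -/
lemma resultant_ne_zero_of_not_dvd {R : Type*} [CommRing R] [IsDomain R] [IsIntegrallyClosed R]
    {f g : R[X]} (hf : f.Monic) (hirr : Irreducible f) {n : ℕ} (hg : g.natDegree ≤ n)
    (hfg : ¬ f ∣ g) : resultant f g f.natDegree n ≠ 0 := by
  intro h
  have hinj : Function.Injective (algebraMap R (FractionRing R)) := IsFractionRing.injective _ _
  have h1 : resultant (f.map (algebraMap R (FractionRing R)))
      (g.map (algebraMap R (FractionRing R))) f.natDegree n = 0 := by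
    rw [resultant_map_map, h, map_zero]
  rw [← hf.natDegree_map (algebraMap R (FractionRing R))] at h1
  refine resultant_ne_zero_of_irreducible (hf.map _)
    ((hf.irreducible_iff_irreducible_map_fraction_map).mp hirr) (natDegree_map_le.trans hg) ?_ h1
  intro hdvd
  exact hfg (map_dvd_map _ hinj hf |>.mp hdvd)

variable {K : Type} [Field K] [Fintype K] {A B d D : ℕ}

lemma auxEval_pow_card_ne_zero {f : K[X][X]} (hf : f.Monic) (hd : f.natDegree = d) (hd0 : 0 < d)
    (hD : ∀ j, (f.coeff j).natDegree ≤ D) (habs : AbsIrr f)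
    {c : Fin A × Fin d × Fin B × Fin d → K} (hc : c ≠ 0)
    (hq : d * A + (d - 1) * D < Fintype.card K)
    {E : Type} [Field E] [Algebra K E] {u w : E} (huw : (specX u f).eval w = 0)
    (hli : LinearIndependent K fun p : Fin B × Fin d => u ^ (p.1 : ℕ) * w ^ (p.2 : ℕ))
    (hind : ∀ τ : ℕ → E, ∑ i ∈ Finset.range (Fintype.card K), τ i ^ Fintype.card K * u ^ i = 0 →
      ∀ i < Fintype.card K, τ i = 0) :
    auxEval c u w (u ^ Fintype.card K) (w ^ Fintype.card K) ≠ 0 := by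
  classical
  intro hzero
  set q := Fintype.card K with hqdef
  set P : E[X][X] := auxEval c (C X) X (C (C u)) (C (C w)) with hP
  have hPsum : P = ∑ t, C (C (c t • (u ^ (t.2.2.1 : ℕ) * w ^ (t.2.2.2 : ℕ))) * X ^ (t.1 : ℕ))
      * X ^ (t.2.1 : ℕ) := by
    rw [hP, auxEval]
    refine Finset.sum_congr rfl fun t _ => ?_
    have : ∀ (a : K) (p : E[X][X]), a • p = C (C (algebraMap K E a)) * p := fun a p => by
      rw [Algebra.smul_def]
      rfl
    rw [this, Algebra.smul_def]
    simp only [map_mul, map_pow]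
    ring
  have hcoeff : ∀ i j, (P.coeff j).coeff i = ∑ t : Fin A × Fin d × Fin B × Fin d,
      if j = (t.2.1 : ℕ) ∧ i = (t.1 : ℕ) then c t • (u ^ (t.2.2.1 : ℕ) * w ^ (t.2.2.2 : ℕ))
      else 0 := by
    intro i j
    rw [hPsum, finsetSum_coeff, finsetSum_coeff]
    refine Finset.sum_congr rfl fun t _ => ?_
    rw [coeff_C_mul, coeff_X_pow, mul_ite, mul_one, mul_zero]
    by_cases h1 : j = t.2.1
    · rw [if_pos h1, coeff_C_mul, coeff_X_pow]
      by_cases h2 : i = t.1 <;> simp [h1, h2]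
    · simp [h1]
  have hP0 : P ≠ 0 := by
    intro h0
    apply hc
    ext ⟨i, j, k, l⟩
    have h1 := hcoeff i j
    rw [h0, coeff_zero, coeff_zero] at h1
    rw [Fintype.sum_prod_type, Finset.sum_eq_single i, Fintype.sum_prod_type,
      Finset.sum_eq_single j] at h1
    · exact Fintype.linearIndependent_iff.mp hli (fun p => c (i, j, p)) (by simpa using h1.symm)
        (k, l)
    · intro j' _ hj'
      refine Finset.sum_eq_zero fun p _ => if_neg ?_
      rintro ⟨h, -⟩
      exact hj' (Fin.ext h.symm)
    · simp
    · intro i' _ hi'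
      refine Finset.sum_eq_zero fun p _ => if_neg ?_
      rintro ⟨-, h⟩
      exact hi' (Fin.ext h.symm)
    · simp
  have hPdeg : P.natDegree ≤ d - 1 := by
    rw [hPsum]
    refine natDegree_sum_le_of_forall_le _ _ fun t _ => ?_
    refine (natDegree_C_mul_X_pow_le _ _).trans ?_
    have := t.2.1.2
    omega
  have hPcoeff : ∀ j, (P.coeff j).natDegree ≤ A := by
    intro j
    rw [natDegree_le_iff_coeff_eq_zero]
    intro i hi
    rw [hcoeff]
    refine Finset.sum_eq_zero fun t _ => if_neg ?_
    rintro ⟨-, h⟩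
    have := t.1.2
    omega
  set fE : E[X][X] := f.map (mapRingHom (algebraMap K E)) with hfE
  have hfEm : fE.Monic := hf.map _
  have hfEd : fE.natDegree = d := by rw [hfE, hf.natDegree_map, hd]
  have hfED : ∀ j, (fE.coeff j).natDegree ≤ D := by
    intro j
    rw [hfE, coeff_map]
    exact natDegree_map_le.trans (hD j)
  have hnd : ¬ fE ∣ P := by
    intro h
    have := natDegree_le_of_dvd h hP0
    omega
  have hr := resultant_ne_zero_of_not_dvd hfEm (habs E (algebraMap K E)) hPdeg hnd
  rw [hfEd] at hr
  set r := resultant fE P d (d - 1) with hrdef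
  have hrdeg : r.natDegree < q := (natDegree_resultant_le hfED hPcoeff).trans_lt hq
  obtain ⟨p, s, -, -, hps⟩ := exists_mul_add_mul_eq_C_resultant fE P hfEd.le hPdeg
    (Or.inl hd0.ne')
  let Ψ₀ : E[X] →ₐ[K] E := eval₂AlgHom (FiniteField.frobeniusAlgHom K E) u fun _ => Commute.all _ _
  let Ψ : E[X][X] →ₐ[K] E := eval₂AlgHom Ψ₀ w fun _ => Commute.all _ _
  have hΨ₀ : ∀ g, Ψ₀ g = g.eval₂ (FiniteField.frobeniusAlgHom K E).toRingHom u := fun g => rfl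
  have hΨ : ∀ g, Ψ g = g.eval₂ Ψ₀.toRingHom w := fun g => rfl
  have hΨC : ∀ a, Ψ (C a) = Ψ₀ a := fun a => by rw [hΨ, eval₂_C]; rfl
  have hΨ₀C : ∀ a, Ψ₀ (C a) = a ^ q := fun a => by rw [hΨ₀, eval₂_C]; rfl
  have hΨ₀X : Ψ₀ X = u := by rw [hΨ₀, eval₂_X]
  have hΨX : Ψ X = w := by rw [hΨ, eval₂_X]
  have h1 := congrArg Ψ hps
  have hΨf : Ψ fE = 0 := by
    rw [← huw, hΨ, hfE, eval₂_map, specX, eval_map]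
    congr 1
    ext a
    · simp only [RingHom.comp_apply, coe_mapRingHom, map_C]
      change Ψ₀ (C _) = aeval u (C a)
      rw [hΨ₀C, ← map_pow, FiniteField.pow_card, aeval_C]
    · simp only [RingHom.comp_apply, coe_mapRingHom, map_X]
      change Ψ₀ X = aeval u X
      rw [hΨ₀X, aeval_X]
  have hΨP : Ψ P = 0 := by
    rw [hP, map_auxEval, hΨC, hΨC, hΨC, hΨ₀C, hΨ₀C, hΨ₀X, hΨX, hzero]
  rw [map_add, map_mul, map_mul, hΨf, hΨP, zero_mul, zero_mul, add_zero, hΨC, hΨ₀,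
    eval₂_eq_sum_range' _ hrdeg] at h1
  have h2 := hind (fun i => r.coeff i) h1.symm
  apply hr
  ext i
  rw [coeff_zero]
  by_cases hi : i < q
  · exact h2 i hi
  · exact coeff_eq_zero_of_natDegree_lt (by omega)

/-- The discriminant (up to sign) of a bivariate polynomial with respect to the outer variable. -/
noncomputable def disc {R : Type*} [CommRing R] (f : R[X]) : R :=
  resultant f (derivative f) f.natDegree (f.natDegree - 1)

lemma separable_map_of_disc_ne_zero {R k : Type*} [CommRing R] [Field k] (φ : R →+* k) {f : R[X]}
    (h0 : f.natDegree ≠ 0) (h : φ (disc f) ≠ 0) : (f.map φ).Separable := by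
  obtain ⟨p, s, -, -, hps⟩ := exists_mul_add_mul_eq_C_resultant f (derivative f) le_rfl
    (natDegree_derivative_le f) (Or.inl h0)
  change _ = C (disc f) at hps
  have h1 := congrArg (map φ) hps
  rw [Polynomial.map_add, Polynomial.map_mul, Polynomial.map_mul, map_C] at h1
  rw [separable_def, derivative_map]
  refine ⟨C (φ (disc f))⁻¹ * p.map φ, C (φ (disc f))⁻¹ * s.map φ, ?_⟩
  rw [mul_assoc, mul_assoc, ← mul_add, mul_comm (p.map φ), mul_comm (s.map φ), h1, ← C_mul,
    inv_mul_cancel₀ h, C_1]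

lemma resultant_auxPoly_ne_zero {f : K[X][X]} (hf : f.Monic) (hd : f.natDegree = d) (hd0 : 0 < d)
    (hD : ∀ j, (f.coeff j).natDegree ≤ D) (habs : AbsIrr f) (hdisc : disc f ≠ 0)
    {c : Fin A × Fin d × Fin B × Fin d → K} (hc : c ≠ 0)
    (hq : d * A + (d - 1) * D < Fintype.card K) :
    resultant f (auxPoly (Fintype.card K) c) d ((d - 1) * (1 + Fintype.card K)) ≠ 0 := by
  have hirr : Irreducible f := by
    simpa [mapRingHom_id] using habs K (RingHom.id K)
  have key : ¬ f ∣ auxPoly (Fintype.card K) c := by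
    intro hdvd
    let k := FractionRing K[X]
    have hinj : Function.Injective (algebraMap K[X] k) := IsFractionRing.injective _ _
    have hf0irr : Irreducible (f.map (algebraMap K[X] k)) :=
      (hf.irreducible_iff_irreducible_map_fraction_map).mp hirr
    have hsep : (f.map (algebraMap K[X] k)).Separable :=
      separable_map_of_disc_ne_zero _ (by omega) ((map_ne_zero_iff _ hinj).mpr hdisc)
    set f0 := f.map (algebraMap K[X] k) with hf0
    have hf0m : f0.Monic := hf.map _
    have : Fact (Irreducible f0) := ⟨hf0irr⟩
    let E := AdjoinRoot f0
    let w : E := AdjoinRoot.root f0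
    let u : E := algebraMap k E (algebraMap K[X] k X)
    have hau : ∀ p : K[X], aeval u p = algebraMap k E (algebraMap K[X] k p) := by
      intro p
      have : u = algebraMap K[X] E X := (IsScalarTower.algebraMap_apply K[X] k E X).symm
      rw [this, ← IsScalarTower.algebraMap_apply K[X] k E p, aeval_algebraMap_apply, aeval_X_left_apply]
    have hspec : ∀ g : K[X][X], (specX u g).eval w = aeval w (g.map (algebraMap K[X] k)) := by
      intro g
      rw [specX, eval_map, aeval_def, eval₂_map]
      congr 1
      exact RingHom.ext hau
    have hw : aeval w f0 = 0 := by
      rw [AdjoinRoot.aeval_eq, AdjoinRoot.mk_self]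
    have hmin : minpoly k w = f0 := (minpoly.eq_of_irreducible_of_monic hf0irr hw hf0m).symm
    have hnat : f0.natDegree = d := by rw [hf0, hf.natDegree_map, hd]
    refine auxEval_pow_card_ne_zero hf hd hd0 hD habs hc hq (E := E) (u := u) (w := w)
      ?_ ?_ ?_ ?_
    · rw [hspec, hw]
    · have h1 : LinearIndependent K fun i : Fin B => (algebraMap K[X] k X) ^ (i : ℕ) := by
        have := (Polynomial.basisMonomials K).linearIndependent
        have h2 := this.map' (IsScalarTower.toAlgHom K K[X] k).toLinearMap
          (LinearMap.ker_eq_bot.mpr hinj)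
        have h3 := h2.comp (fun i : Fin B => (i : ℕ)) Fin.val_injective
        refine h3.of_forall_eq fun i => ?_
        simp [← X_pow_eq_monomial]
      have h2 : LinearIndependent k fun j : Fin d => w ^ (j : ℕ) := by
        have := (AdjoinRoot.powerBasis hf0irr.ne_zero).basis.linearIndependent
        have h3 := this.comp (Fin.cast (by rw [AdjoinRoot.powerBasis_dim, hnat]) : Fin d → _)
          (Fin.cast_injective _)
        refine h3.of_forall_eq fun j => ?_
        simp [w]
      refine (linearIndependent_smul h1 h2).of_forall_eq fun p => ?_
      rw [Algebra.smul_def, map_pow]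
    · intro τ hτ
      refine eq_zero_of_sum_pow_card_mul_pow_eq_zero (k := k) (w := w) ?_ ?_ hτ
      · rw [IsSeparable, hmin]; exact hsep
      · exact AdjoinRoot.adjoinRoot_eq_top
    · rw [← eval_specX_auxPoly, ← evalHom_apply]
      obtain ⟨g, hg⟩ := hdvd
      rw [hg, map_mul, evalHom_apply, hspec, hw, zero_mul]
  have := resultant_ne_zero_of_not_dvd hf hirr (natDegree_auxPoly_le (Fintype.card K) c) key
  rwa [hd] at this

end Nonvanishing

section CurvePoints

variable {K : Type} [Field K]

lemma fiberCard_le {f : K[X][X]} {d : ℕ} (hd : f.natDegree = d) (x₀ : K) : fiberCard f x₀ ≤ d := by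
  classical
  rw [fiberCard, ← hd]
  exact (Multiset.toFinset_card_le _).trans ((card_roots' _).trans (natDegree_specX_le _ _))

lemma natDegree_disc_le {f : K[X][X]} {d D : ℕ} (hd : f.natDegree = d)
    (hD : ∀ j, (f.coeff j).natDegree ≤ D) : (disc f).natDegree ≤ 2 * d * D := by
  rw [disc, hd]
  refine (natDegree_resultant_le (E := D) hD fun i => ?_).trans ?_
  · rw [coeff_derivative]
    refine natDegree_mul_le.trans ?_
    have : ((i : K[X]) + 1).natDegree = 0 := by
      rw [← Nat.cast_one (R := K[X]), ← Nat.cast_add, natDegree_natCast]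
    rw [this]
    simpa using hD (i + 1)
  · have : (d - 1) * D ≤ d * D := Nat.mul_le_mul_right _ (by omega)
    nlinarith

lemma sum_mul_sub_fiberCard_le [Fintype K] {f : K[X][X]} (hf : f.Monic) {A B M d D : ℕ}
    (hd : f.natDegree = d) (hd0 : 0 < d) (hD : ∀ j, (f.coeff j).natDegree ≤ D) (habs : AbsIrr f)
    (hdisc : disc f ≠ 0) (hcount : ∑ m ∈ Finset.range M,
      (2 * (D * (d + 1)) * m + (A + B + 2 * d * D) + 1) * (d * (d - 1)) < A * (d * (B * d)))
    (hq : d * A + (d - 1) * D < Fintype.card K) (S : Finset K)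
    (hS : ∀ x ∈ S, (specX x f : K[X]).Separable) :
    ∑ x ∈ S, M * (d - fiberCard f x)
      ≤ d * (A + Fintype.card K * B) + (d - 1) * (1 + Fintype.card K) * D := by
  obtain ⟨c, hc0, hc⟩ := exists_auxEval_dvd.{0, 0} hf hd hD hcount
  have hne := resultant_auxPoly_ne_zero hf hd hd0 hD habs hdisc hc0 hq
  have hdvd : ∏ x ∈ S, (X - C x) ^ (M * (d - fiberCard f x)) ∣
      resultant f (auxPoly (Fintype.card K) c) d ((d - 1) * (1 + Fintype.card K)) := by
    refine Finset.prod_dvd_of_coprime (fun x _ y _ hxy => ?_) fun x hx =>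
      X_sub_C_pow_dvd_resultant hf hd (fun x y z σ => hc x y z σ) (hS x hx)
    exact (isCoprime_X_sub_C_of_isUnit_sub (sub_ne_zero.mpr hxy).isUnit).pow
  have h1 := natDegree_le_of_dvd hdvd hne
  rw [natDegree_prod_of_monic _ _ fun x _ => (monic_X_sub_C x).pow _] at h1
  simp only [natDegree_pow, natDegree_X_sub_C, mul_one] at h1
  exact h1.trans (natDegree_resultant_le hD (natDegree_coeff_auxPoly_le _ c))

set_option maxHeartbeats 1000000 in
/-- The lower bound for the number of points on an absolutely irreducible plane curve. -/
theorem exists_card_le_sum_fiberCard (d D : ℕ) (hd0 : 0 < d) :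
    ∃ c : ℕ, ∀ (K : Type) [Field K] [Fintype K] (f : K[X][X]), f.Monic → f.natDegree = d →
      (∀ j, (f.coeff j).natDegree ≤ D) → disc f ≠ 0 → AbsIrr f →
      Fintype.card K ≤ ∑ x, fiberCard f x + c * Nat.sqrt (Fintype.card K) := by
  classical
  set κ := 2 * (D * (d + 1)) with hκ
  set C2 := κ * d + d + 2 * d * D + 1 with hC2
  set e := 4 * d * d * C2 with he
  refine ⟨e * e + (2 * d * d * D + 4 * (1 + e + 2 * D)), fun K _ _ f hf hd hD hdisc habs => ?_⟩
  set q := Fintype.card K with hqdef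
  set s := Nat.sqrt q with hs
  have hs1 : s * s ≤ q := Nat.sqrt_le q
  have hs2 : q < (s + 1) * (s + 1) := Nat.lt_succ_sqrt q
  have hq0 : 0 < q := Fintype.card_pos
  have hs0 : 0 < s := Nat.sqrt_pos.mpr hq0
  rcases lt_or_ge q (e * e) with hlt | hge
  · have : e * e ≤ (e * e + (2 * d * d * D + 4 * (1 + e + 2 * D))) * s :=
      (Nat.le_add_right _ _).trans (Nat.le_mul_of_pos_right _ hs0)
    omega
  have hes : e ≤ s := Nat.le_sqrt.mpr hge
  obtain ⟨d', rfl⟩ : ∃ d', d = d' + 1 := ⟨d - 1, by omega⟩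
  have hC2pos : 1 ≤ C2 := by omega
  have he4 : 4 * (d' + 1) ≤ e := by
    rw [he, mul_assoc (4 * (d' + 1))]
    exact Nat.le_mul_of_pos_right _ (by positivity)
  have heD : 2 * (d' + 1) * D < e := by
    have : 2 * (d' + 1) * D < C2 := by omega
    exact this.trans_le (he ▸ Nat.le_mul_of_pos_left _ (by positivity))
  have hsq : s ≤ q := Nat.sqrt_le_self q
  set A := q / (2 * (d' + 1)) with hA
  set B := d' * s + e with hB
  have hA1 : A * (2 * (d' + 1)) ≤ q := Nat.div_mul_le_self _ _
  have hA2 : q < (A + 1) * (2 * (d' + 1)) := by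
    rw [mul_comm]
    exact Nat.lt_mul_div_succ q (by omega)
  have hqA : q ≤ 4 * (d' + 1) * A := by nlinarith
  have hAe : q * ((d' + 1) * C2) ≤ A * e := by
    calc q * ((d' + 1) * C2) ≤ 4 * (d' + 1) * A * ((d' + 1) * C2) := Nat.mul_le_mul_right _ hqA
      _ = A * e := by rw [he]; ring
  have hmain : (d' * s) * (κ * ((d' + 1) * s) + B + 2 * (d' + 1) * D + 1) < A * e := by
    refine lt_of_lt_of_le ?_ hAe
    have h1 : κ * ((d' + 1) * s) + B + 2 * (d' + 1) * D + 1 ≤ C2 * s := by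
      rw [hC2, hB]
      have : 2 * (d' + 1) * D + 1 ≤ (2 * (d' + 1) * D + 1) * s := Nat.le_mul_of_pos_right _ hs0
      nlinarith
    calc _ ≤ (d' * s) * (C2 * s) := Nat.mul_le_mul_left _ h1
      _ = (s * s) * (d' * C2) := by ring
      _ ≤ q * (d' * C2) := Nat.mul_le_mul_right _ hs1
      _ < q * ((d' + 1) * C2) := by
        refine Nat.mul_lt_mul_of_pos_left ?_ hq0
        nlinarith
  have hcount : ∑ m ∈ Finset.range ((d' + 1) * s),
      (2 * (D * (d' + 1 + 1)) * m + (A + B + 2 * (d' + 1) * D) + 1) * ((d' + 1) * (d' + 1 - 1))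
        < A * ((d' + 1) * (B * (d' + 1))) := by
    rw [Nat.add_sub_cancel]
    calc _ ≤ ∑ m ∈ Finset.range ((d' + 1) * s),
        (κ * ((d' + 1) * s) + (A + B + 2 * (d' + 1) * D) + 1) * ((d' + 1) * d') := by
          refine Finset.sum_le_sum fun m hm => Nat.mul_le_mul_right _ ?_
          exact Nat.add_le_add_right (Nat.add_le_add_right
            (Nat.mul_le_mul_left _ (Finset.mem_range.mp hm).le) _) _
      _ = (d' + 1) * (d' + 1) * ((d' * s) * (κ * ((d' + 1) * s) + B + 2 * (d' + 1) * D + 1)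
          + A * (d' * s)) := by
          rw [Finset.sum_const, Finset.card_range, smul_eq_mul]; ring
      _ < (d' + 1) * (d' + 1) * (A * e + A * (d' * s)) :=
          Nat.mul_lt_mul_of_pos_left (Nat.add_lt_add_right hmain _) (by positivity)
      _ = _ := by rw [hB]; ring
  set S := Finset.univ.filter fun x : K => (disc f).eval x ≠ 0 with hS
  have hsep : ∀ x ∈ S, (specX x f : K[X]).Separable := by
    intro x hx
    refine separable_map_of_disc_ne_zero _ (by omega) ?_
    rw [hS, Finset.mem_filter] at hx
    simpa [aeval_def] using hx.2
  have hScard : q ≤ S.card + 2 * (d' + 1) * D := by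
    have h1 : Sᶜ.card ≤ 2 * (d' + 1) * D := by
      refine le_trans ?_ ((card_roots' _).trans (natDegree_disc_le hd hD))
      refine le_trans (Finset.card_le_card ?_) (Multiset.toFinset_card_le _)
      intro x hx
      rw [Multiset.mem_toFinset, mem_roots hdisc]
      simpa [hS] using hx
    have h2 := S.card_add_card_compl
    rw [← hqdef] at h2
    linarith
  have hsum := sum_mul_sub_fiberCard_le hf hd hd0 hD habs hdisc hcount (by
    rw [Nat.add_sub_cancel]; nlinarith) S hsep
  rw [← Finset.mul_sum, Nat.add_sub_cancel] at hsum
  set T := ∑ x ∈ S, (d' + 1 - fiberCard f x) with hT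
  have hT1 : T + ∑ x ∈ S, fiberCard f x = S.card * (d' + 1) := by
    rw [hT, ← Finset.sum_add_distrib, ← smul_eq_mul, ← Finset.sum_const]
    exact Finset.sum_congr rfl fun x _ => Nat.sub_add_cancel (fiberCard_le hd x)
  have hT2 : ∑ x ∈ S, fiberCard f x ≤ ∑ x, fiberCard f x :=
    Finset.sum_le_sum_of_subset (Finset.subset_univ _)
  have hT3 : s * T ≤ q * d' * s + q * (1 + e + 2 * D) := by
    have hAq : A ≤ q := Nat.div_le_self _ _
    have : (d' + 1) * (s * T) ≤ (d' + 1) * (q * d' * s + q * (1 + e + 2 * D)) := by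
      calc (d' + 1) * (s * T) = (d' + 1) * s * T := by ring
        _ ≤ _ := hsum
        _ ≤ (d' + 1) * (q + q * B) + (d' + 1) * (q + q) * D := by
          gcongr <;> omega
        _ = _ := by rw [hB]; ring
    exact Nat.le_of_mul_le_mul_left this (by omega)
  have hT4 : T ≤ q * d' + 4 * s * (1 + e + 2 * D) := by
    have h4 : q ≤ 4 * s * s := by nlinarith
    have : s * T ≤ s * (q * d' + 4 * s * (1 + e + 2 * D)) := by
      have := Nat.mul_le_mul_right (1 + e + 2 * D) h4
      calc s * T ≤ _ := hT3
        _ ≤ q * d' * s + 4 * s * s * (1 + e + 2 * D) := by omega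
        _ = _ := by ring
    exact Nat.le_of_mul_le_mul_left this hs0
  have h5 : (d' + 1) * q ≤ (d' + 1) * (S.card + 2 * (d' + 1) * D) := Nat.mul_le_mul_left _ hScard
  have h6 : 2 * (d' + 1) * (d' + 1) * D ≤ 2 * (d' + 1) * (d' + 1) * D * s :=
    Nat.le_mul_of_pos_right _ hs0
  calc q ≤ ∑ x, fiberCard f x + (2 * (d' + 1) * (d' + 1) * D * s + 4 * s * (1 + e + 2 * D)) := by
        linarith
    _ ≤ ∑ x, fiberCard f x + (e * e * s
        + (2 * (d' + 1) * (d' + 1) * D * s + 4 * s * (1 + e + 2 * D))) := by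
        linarith [Nat.zero_le (e * e * s)]
    _ = _ := by ring

end CurvePoints

section BivariateDegree

lemma coeff_coeff_swap {R : Type*} [CommRing R] (p : R[X][X]) (i j : ℕ) :
    ((Bivariate.swap p).coeff i).coeff j = (p.coeff j).coeff i := by
  induction p using Polynomial.induction_on' with
  | add p q hp hq => simp only [map_add, coeff_add, hp, hq]
  | monomial n a =>
    induction a using Polynomial.induction_on' with
    | add a b ha hb => simp only [map_add, coeff_add, ha, hb]
    | monomial m r =>
      rw [Bivariate.swap_monomial_monomial]
      simp only [coeff_monomial]
      split_ifs <;> simp_all [coeff_monomial]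

lemma natDegree_swap_le_iff {R : Type*} [CommRing R] {p : R[X][X]} {D : ℕ} :
    (Bivariate.swap p).natDegree ≤ D ↔ ∀ j, (p.coeff j).natDegree ≤ D := by
  simp only [natDegree_le_iff_coeff_eq_zero]
  constructor
  · intro h j N hN
    rw [← coeff_coeff_swap, h N hN, coeff_zero]
  · intro h N hN
    ext j
    rw [coeff_coeff_swap, h j N hN, coeff_zero]

lemma natDegree_coeff_le_of_mul {R : Type*} [CommRing R] [IsDomain R] {g h : R[X][X]} {D : ℕ}
    (hh : h ≠ 0) (hD : ∀ j, ((g * h).coeff j).natDegree ≤ D) (j : ℕ) :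
    (g.coeff j).natDegree ≤ D := by
  rcases eq_or_ne g 0 with rfl | hg
  · simp
  revert j
  rw [← natDegree_swap_le_iff] at hD ⊢
  refine le_trans ?_ hD
  rw [map_mul, natDegree_mul (by simpa using hg) (by simpa using hh)]
  exact Nat.le_add_right _ _

lemma exists_bound_natDegree_coeff {R : Type*} [CommRing R] (p : R[X][X]) :
    ∃ D, ∀ j, (p.coeff j).natDegree ≤ D :=
  ⟨_, natDegree_swap_le_iff.mp le_rfl⟩

end BivariateDegree

section Ultraproduct

variable {I : Type*} (U : Ultrafilter I) (L : I → Type*) [∀ i, Field (L i)]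

/-- The ideal of families vanishing almost everywhere. -/
def ultraIdeal : Ideal (∀ i, L i) where
  carrier := {r | ∀ᶠ i in U, r i = 0}
  add_mem' ha hb := by
    filter_upwards [ha, hb] with i h1 h2
    simp [h1, h2]
  zero_mem' := Filter.Eventually.of_forall fun _ => rfl
  smul_mem' c x hx := by
    filter_upwards [hx] with i h
    simp [h]

lemma mem_ultraIdeal {r : ∀ i, L i} : r ∈ ultraIdeal U L ↔ ∀ᶠ i in U, r i = 0 := Iff.rfl

instance ultraIdeal_isMaximal : (ultraIdeal U L).IsMaximal := by
  rw [Ideal.isMaximal_iff]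
  refine ⟨fun h => ?_, fun J x hJ hx hxJ => ?_⟩
  · rw [mem_ultraIdeal] at h
    obtain ⟨i, hi⟩ := h.exists
    exact one_ne_zero hi
  · rw [mem_ultraIdeal, ← Ultrafilter.eventually_not] at hx
    have h1 : x * (fun i => (x i)⁻¹) ∈ J := J.mul_mem_right _ hxJ
    have h2 : 1 - x * (fun i => (x i)⁻¹) ∈ J := by
      apply hJ
      rw [mem_ultraIdeal]
      filter_upwards [hx] with i hi
      simp [hi]
    simpa using J.add_mem h1 h2

/-- The ultraproduct of a family of fields. -/
abbrev UltraProd := (∀ i, L i) ⧸ ultraIdeal U L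

noncomputable instance : Field (UltraProd U L) := Ideal.Quotient.field _

/-- The class of a family in the ultraproduct. -/
abbrev ultraMk : (∀ i, L i) →+* UltraProd U L := Ideal.Quotient.mk (ultraIdeal U L)

variable {U L}

lemma ultraMk_eq_zero_iff {r : ∀ i, L i} : ultraMk U L r = 0 ↔ ∀ᶠ i in U, r i = 0 :=
  Ideal.Quotient.eq_zero_iff_mem

lemma ultraMk_eq_iff {r s : ∀ i, L i} : ultraMk U L r = ultraMk U L s ↔ ∀ᶠ i in U, r i = s i := by
  rw [← sub_eq_zero, ← map_sub, ultraMk_eq_zero_iff]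
  simp [sub_eq_zero]

lemma ultraMk_ne_zero_iff {r : ∀ i, L i} : ultraMk U L r ≠ 0 ↔ ∀ᶠ i in U, r i ≠ 0 := by
  rw [Ne, ultraMk_eq_zero_iff, Ultrafilter.eventually_not]

lemma exists_pi_lift {d D : ℕ} (g : ∀ i, (L i)[X][X]) (hd : ∀ i, (g i).natDegree ≤ d)
    (hD : ∀ i j, ((g i).coeff j).natDegree ≤ D) :
    ∃ G : (∀ i, L i)[X][X], ∀ i, G.map (mapRingHom (Pi.evalRingHom L i)) = g i := by
  refine ⟨∑ j ∈ Finset.range (d + 1), ∑ l ∈ Finset.range (D + 1),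
    monomial j (monomial l fun i => ((g i).coeff j).coeff l), fun i => ?_⟩
  conv_rhs => rw [as_sum_range' (g i) (d + 1) (Nat.lt_succ_of_le (hd i))]
  rw [Polynomial.map_sum]
  refine Finset.sum_congr rfl fun j _ => ?_
  conv_rhs => rw [as_sum_range' ((g i).coeff j) (D + 1) (Nat.lt_succ_of_le (hD i j))]
  rw [Polynomial.map_sum, map_sum]
  refine Finset.sum_congr rfl fun l _ => ?_
  rw [map_monomial, coe_mapRingHom, map_monomial]
  rfl

lemma coeff_coeff_map_ultraMk (G : (∀ i, L i)[X][X]) (j l : ℕ) :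
    ((G.map (mapRingHom (ultraMk U L))).coeff j).coeff l = ultraMk U L ((G.coeff j).coeff l) := by
  rw [coeff_map, coe_mapRingHom, coeff_map]

lemma map_ultraMk_eq_of_eventually {G H : (∀ i, L i)[X][X]}
    (h : ∀ᶠ i in U, G.map (mapRingHom (Pi.evalRingHom L i))
      = H.map (mapRingHom (Pi.evalRingHom L i))) :
    G.map (mapRingHom (ultraMk U L)) = H.map (mapRingHom (ultraMk U L)) := by
  ext j l
  rw [coeff_coeff_map_ultraMk, coeff_coeff_map_ultraMk, ultraMk_eq_iff]
  filter_upwards [h] with i hi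
  have := congrArg (fun p => (p.coeff j).coeff l) hi
  simpa [coeff_map] using this

/-- Reducibility of monic bivariate polynomials passes to ultraproducts. -/
theorem not_irreducible_map_ultraMk {f : (∀ i, L i)[X][X]} (hf : f.Monic)
    (h : ∀ᶠ i in U, ¬ Irreducible (f.map (mapRingHom (Pi.evalRingHom L i)))) :
    ¬ Irreducible (f.map (mapRingHom (ultraMk U L))) := by
  classical
  obtain ⟨D, hD⟩ := exists_bound_natDegree_coeff f
  have key : ∀ i, ∃ g k : (L i)[X][X], g.natDegree ≤ f.natDegree ∧ k.natDegree ≤ f.natDegree ∧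
      (∀ j, (g.coeff j).natDegree ≤ D) ∧ (∀ j, (k.coeff j).natDegree ≤ D) ∧
      (¬ Irreducible (f.map (mapRingHom (Pi.evalRingHom L i))) →
        f.map (mapRingHom (Pi.evalRingHom L i)) ≠ 1 → g.Monic ∧ k.Monic ∧
        g * k = f.map (mapRingHom (Pi.evalRingHom L i)) ∧ g.natDegree ≠ 0 ∧ k.natDegree ≠ 0) := by
    intro i
    by_cases hi : Irreducible (f.map (mapRingHom (Pi.evalRingHom L i)))
    · exact ⟨0, 0, by simp, by simp, by simp, by simp, fun h => absurd hi h⟩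
    by_cases hi1 : f.map (mapRingHom (Pi.evalRingHom L i)) = 1
    · exact ⟨0, 0, by simp, by simp, by simp, by simp, fun _ h => absurd hi1 h⟩
    have hm : (f.map (mapRingHom (Pi.evalRingHom L i))).Monic := hf.map _
    have h1 := mt hm.irreducible_iff_natDegree.mpr hi
    push Not at h1
    obtain ⟨g, k, hg, hk, hgk, hg0, hk0⟩ := h1 hi1
    have hdeg : g.natDegree + k.natDegree ≤ f.natDegree := by
      rw [← hg.natDegree_mul hk, hgk]
      exact natDegree_map_le
    have hDi : ∀ j, ((g * k).coeff j).natDegree ≤ D := by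
      intro j
      rw [hgk, coeff_map]
      exact natDegree_map_le.trans (hD j)
    refine ⟨g, k, by omega, by omega, natDegree_coeff_le_of_mul hk.ne_zero hDi,
      natDegree_coeff_le_of_mul hg.ne_zero (by rwa [mul_comm] at hDi), fun _ _ =>
      ⟨hg, hk, hgk, hg0, hk0⟩⟩
  choose g k hgd hkd hgD hkD hgk using key
  obtain ⟨G, hG⟩ := exists_pi_lift g hgd hgD
  obtain ⟨H, hH⟩ := exists_pi_lift k hkd hkD
  intro hirr
  have hne1 : ∀ᶠ i in U, f.map (mapRingHom (Pi.evalRingHom L i)) ≠ 1 := by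
    by_contra hcon
    rw [← Ultrafilter.eventually_not] at hcon
    have : f.map (mapRingHom (ultraMk U L)) =
        (1 : (∀ i, L i)[X][X]).map (mapRingHom (ultraMk U L)) := by
      apply map_ultraMk_eq_of_eventually
      filter_upwards [hcon] with i hi
      simpa using hi
    rw [this, Polynomial.map_one] at hirr
    exact not_irreducible_one hirr
  have hprod : f.map (mapRingHom (ultraMk U L))
      = G.map (mapRingHom (ultraMk U L)) * H.map (mapRingHom (ultraMk U L)) := by
    rw [← Polynomial.map_mul]
    apply map_ultraMk_eq_of_eventually
    filter_upwards [h, hne1] with i h1 h2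
    rw [Polynomial.map_mul, hG, hH, (hgk i h1 h2).2.2.1]
  have hnonunit : ∀ (G : (∀ i, L i)[X][X]) (g : ∀ i, (L i)[X][X]),
      (∀ i, G.map (mapRingHom (Pi.evalRingHom L i)) = g i) →
      (∀ᶠ i in U, (g i).natDegree ≠ 0 ∧ (g i).Monic) → (∀ i, (g i).natDegree ≤ f.natDegree) →
      ¬ IsUnit (G.map (mapRingHom (ultraMk U L))) := by
    intro G g hG hg hgd hunit
    have h1 : ∀ᶠ i in U, ∃ e : Fin (f.natDegree + 1), (e : ℕ) ≠ 0 ∧ (g i).coeff e = 1 := by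
      filter_upwards [hg] with i hi
      exact ⟨⟨(g i).natDegree, Nat.lt_succ_of_le (hgd i)⟩, hi.1, hi.2.coeff_natDegree⟩
    rw [Ultrafilter.eventually_exists_iff] at h1
    obtain ⟨e, he⟩ := h1
    obtain ⟨i₀, he0, -⟩ := he.exists
    have h2 : ((G.map (mapRingHom (ultraMk U L))).coeff e).coeff 0 = 1 := by
      rw [coeff_coeff_map_ultraMk, ← map_one (ultraMk U L), ultraMk_eq_iff]
      filter_upwards [he] with i hi
      have := congrArg (fun p => (p.coeff e).coeff 0) (hG i)
      simp only [hi.2, coeff_map, coe_mapRingHom, coeff_one_zero] at this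
      exact this
    have h3 := natDegree_eq_zero_of_isUnit hunit
    have h4 : (G.map (mapRingHom (ultraMk U L))).coeff e = 0 :=
      coeff_eq_zero_of_natDegree_lt (by omega)
    rw [h4, coeff_zero] at h2
    exact zero_ne_one h2
  have hev := h.and hne1
  rcases hirr.isUnit_or_isUnit hprod with hu | hu
  · refine hnonunit G g hG ?_ hgd hu
    filter_upwards [hev] with i hi
    exact ⟨(hgk i hi.1 hi.2).2.2.2.1, (hgk i hi.1 hi.2).1⟩
  · refine hnonunit H k hH ?_ hkd hu
    filter_upwards [hev] with i hi
    exact ⟨(hgk i hi.1 hi.2).2.2.2.2, (hgk i hi.1 hi.2).2.1⟩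

end Ultraproduct

section FiniteCurve

lemma eval_specX_self {R : Type*} [CommRing R] (x y : R) (f : R[X][X]) :
    (specX x f).eval y = f.evalEval x y := by
  rw [← map_evalRingHom_eval]
  rfl

lemma disc_map {R S : Type*} [CommRing R] [CommRing S] [Nontrivial S] {f : R[X]} (hf : f.Monic)
    (φ : R →+* S) : disc (f.map φ) = φ (disc f) := by
  rw [disc, disc, hf.natDegree_map, derivative_map, resultant_map_map]

open Classical in
/-- The points of the plane curve `f = 0` with `v ≠ 0`. -/
noncomputable def curvePoints {K : Type*} [Field K] [Fintype K] (f : K[X][X]) (v : K[X]) :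
    Finset (K × K) :=
  Finset.univ.filter fun p => f.evalEval p.1 p.2 = 0 ∧ v.eval p.1 ≠ 0

lemma mem_curvePoints {K : Type*} [Field K] [Fintype K] {f : K[X][X]} {v : K[X]} {p : K × K} :
    p ∈ curvePoints f v ↔ f.evalEval p.1 p.2 = 0 ∧ v.eval p.1 ≠ 0 := by
  simp [curvePoints]

lemma sum_fiberCard_le_card_curvePoints {K : Type} [Field K] [Fintype K] {f : K[X][X]}
    {v : K[X]} (hv : v ≠ 0) :
    ∑ x, fiberCard f x ≤ (curvePoints f v).card + f.natDegree * v.natDegree := by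
  classical
  rw [← Finset.sum_filter_add_sum_filter_not Finset.univ fun x => v.eval x ≠ 0]
  refine add_le_add ?_ ?_
  · simp only [fiberCard]
    rw [← Finset.card_sigma]
    refine Finset.card_le_card_of_injOn (fun p => (p.1, p.2)) ?_ ?_
    · rintro ⟨x, y⟩ hp
      simp only [Finset.coe_sigma, Set.mem_sigma_iff, Finset.coe_filter, Finset.mem_univ, true_and,
        Set.mem_ofPred_eq, Finset.mem_coe, Multiset.mem_toFinset] at hp
      rw [Finset.mem_coe, mem_curvePoints]
      refine ⟨?_, hp.1⟩
      rw [← eval_specX_self]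
      exact (mem_roots'.mp hp.2).2
    · rintro ⟨x, y⟩ - ⟨x', y'⟩ - h
      simpa using h
  · calc _ ≤ ∑ x ∈ Finset.univ.filter (fun x => ¬ v.eval x ≠ 0), f.natDegree :=
          Finset.sum_le_sum fun x _ => fiberCard_le rfl x
      _ = (Finset.univ.filter (fun x => ¬ v.eval x ≠ 0)).card * f.natDegree := by
          rw [Finset.sum_const, smul_eq_mul]
      _ ≤ v.natDegree * f.natDegree := by
          refine Nat.mul_le_mul_right _ ?_
          refine le_trans (Finset.card_le_card ?_)
            ((Multiset.toFinset_card_le _).trans (card_roots' v))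
          intro x hx
          rw [Finset.mem_filter] at hx
          rw [Multiset.mem_toFinset, mem_roots hv]
          simpa using hx.2
      _ = _ := mul_comm _ _

end FiniteCurve

section Transfer

variable {I : Type} {U : Ultrafilter I} {F : I → Type} [∀ i, Field (F i)]

lemma eventually_map_ne_zero {v : (∀ i, F i)[X]} (hv : v.map (ultraMk U F) ≠ 0) :
    ∀ᶠ i in U, v.map (Pi.evalRingHom F i) ≠ 0 := by
  obtain ⟨j, hj⟩ : ∃ j, (v.map (ultraMk U F)).coeff j ≠ 0 := by
    by_contra h
    push Not at h
    exact hv (Polynomial.ext fun j => by rw [h j, coeff_zero])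
  rw [coeff_map, ultraMk_ne_zero_iff] at hj
  filter_upwards [hj] with i hi h
  apply hi
  have := congrArg (fun p => p.coeff j) h
  simpa [coeff_map] using this

lemma eventually_absIrr {f : (∀ i, F i)[X][X]} (hf : f.Monic)
    (habs : AbsIrr (f.map (mapRingHom (ultraMk U F)))) :
    ∀ᶠ i in U, AbsIrr (f.map (mapRingHom (Pi.evalRingHom F i))) := by
  classical
  by_contra hcon
  rw [← Ultrafilter.eventually_not] at hcon
  have key : ∀ i, ∃ (L : Type) (_ : Field L) (φ : F i →+* L),
      ¬ AbsIrr (f.map (mapRingHom (Pi.evalRingHom F i))) →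
        ¬ Irreducible ((f.map (mapRingHom (Pi.evalRingHom F i))).map (mapRingHom φ)) := by
    intro i
    by_cases h : AbsIrr (f.map (mapRingHom (Pi.evalRingHom F i)))
    · exact ⟨F i, inferInstance, RingHom.id _, fun h' => absurd h h'⟩
    · have h' := h
      simp only [AbsIrr] at h'
      push Not at h'
      obtain ⟨L, _, φ, hφ⟩ := h'
      exact ⟨L, inferInstance, φ, fun _ => hφ⟩
  choose L hL φ hφ using key
  let ψ : (∀ i, F i) →+* (∀ i, L i) := RingHom.pi fun i => (φ i).comp (Pi.evalRingHom F i)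
  have hψ : ∀ r i, ψ r i = φ i (r i) := fun r i => rfl
  let ρ : UltraProd U F →+* UltraProd U L := Ideal.Quotient.lift (ultraIdeal U F)
    ((ultraMk U L).comp ψ) (by
      intro a ha
      rw [RingHom.comp_apply, ultraMk_eq_zero_iff]
      filter_upwards [ha] with i hi
      rw [hψ, hi, map_zero])
  have h1 := habs (UltraProd U L) ρ
  rw [map_map, mapRingHom_comp] at h1
  have h2 : ρ.comp (ultraMk U F) = (ultraMk U L).comp ψ := RingHom.ext fun r => rfl
  rw [h2, ← mapRingHom_comp, ← map_map] at h1
  refine not_irreducible_map_ultraMk (hf.map (mapRingHom ψ)) ?_ h1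
  filter_upwards [hcon] with i hi
  have h3 := hφ i hi
  rw [map_map, mapRingHom_comp] at h3 ⊢
  exact h3

/-- Almost all the curves represented by an absolutely irreducible curve over an ultraproduct of
finite fields have many points. -/
theorem exists_eventually_card_le [∀ i, Fintype (F i)] {f : (∀ i, F i)[X][X]} (hf : f.Monic)
    (hd : 0 < f.natDegree) (habs : AbsIrr (f.map (mapRingHom (ultraMk U F))))
    (hdisc : disc (f.map (mapRingHom (ultraMk U F))) ≠ 0) {v : (∀ i, F i)[X]}
    (hv : v.map (ultraMk U F) ≠ 0) :
    ∃ c : ℕ, ∀ᶠ i in U, Fintype.card (F i) ≤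
      (curvePoints (f.map (mapRingHom (Pi.evalRingHom F i))) (v.map (Pi.evalRingHom F i))).card
        + c * Nat.sqrt (Fintype.card (F i)) := by
  obtain ⟨D, hD⟩ := exists_bound_natDegree_coeff f
  obtain ⟨c, hc⟩ := exists_card_le_sum_fiberCard f.natDegree D hd
  refine ⟨c + f.natDegree * v.natDegree, ?_⟩
  rw [disc_map hf] at hdisc
  filter_upwards [eventually_absIrr hf habs, eventually_map_ne_zero hv,
    eventually_map_ne_zero hdisc] with i h1 h2 h3
  have hm : (f.map (mapRingHom (Pi.evalRingHom F i))).Monic := hf.map _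
  have h4 := hc (F i) (f.map (mapRingHom (Pi.evalRingHom F i))) hm (hf.natDegree_map _)
    (fun j => by rw [coeff_map]; exact natDegree_map_le.trans (hD j))
    (by rw [disc_map hf]; exact h3) h1
  have h5 := sum_fiberCard_le_card_curvePoints (f := f.map (mapRingHom (Pi.evalRingHom F i))) h2
  rw [hf.natDegree_map] at h5
  have h6 : f.natDegree * (v.map (Pi.evalRingHom F i)).natDegree
      ≤ f.natDegree * v.natDegree * Nat.sqrt (Fintype.card (F i)) :=
    (Nat.mul_le_mul_left _ natDegree_map_le).trans
      (Nat.le_mul_of_pos_right _ (Nat.sqrt_pos.mpr Fintype.card_pos))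
  rw [add_mul]
  omega

/-- A field is curve-pseudo-algebraically closed if every absolutely irreducible separable plane
curve has points outside any given finite set of fibres. -/
def CurvePAC (K : Type) [Field K] : Prop :=
  ∀ f : K[X][X], f.Monic → 0 < f.natDegree → disc f ≠ 0 → AbsIrr f → ∀ v : K[X], v ≠ 0 →
    ∃ x y : K, f.evalEval x y = 0 ∧ v.eval x ≠ 0

lemma exists_monic_lift {f : (UltraProd U F)[X][X]} (hf : f.Monic) :
    ∃ f' : (∀ i, F i)[X][X], f'.Monic ∧ f'.natDegree = f.natDegree ∧
      f'.map (mapRingHom (ultraMk U F)) = f := by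
  have hsurj : Function.Surjective (mapRingHom (ultraMk U F)) :=
    map_surjective _ Ideal.Quotient.mk_surjective
  have h : f ∈ lifts (mapRingHom (ultraMk U F)) := by
    rw [mem_lifts]
    exact map_surjective _ hsurj f
  obtain ⟨f', h1, h2, h3⟩ := lifts_and_natDegree_eq_and_monic h hf
  exact ⟨f', h3, h2, h1⟩

theorem curvePAC_ultraProd [∀ i, Fintype (F i)]
    (hF : ∀ N : ℕ, ∀ᶠ i in U, N ≤ Fintype.card (F i)) : CurvePAC (UltraProd U F) := by
  classical
  intro f hf hd hdisc habs v hv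
  obtain ⟨f', hf', hdeg, rfl⟩ := exists_monic_lift hf
  obtain ⟨v', rfl⟩ := map_surjective (ultraMk U F) Ideal.Quotient.mk_surjective v
  obtain ⟨c, hc⟩ := exists_eventually_card_le hf' (hdeg ▸ hd) habs hdisc hv
  have hex : ∀ᶠ i in U, ∃ p : F i × F i,
      p ∈ curvePoints (f'.map (mapRingHom (Pi.evalRingHom F i))) (v'.map (Pi.evalRingHom F i)) := by
    filter_upwards [hc, hF (c * c + 1)] with i h1 h2
    by_contra hne
    push Not at hne
    rw [Finset.card_eq_zero.mpr (Finset.eq_empty_of_forall_notMem hne), zero_add] at h1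
    have h3 := Nat.sqrt_le (Fintype.card (F i))
    have h4 : Nat.sqrt (Fintype.card (F i)) ≤ c :=
      Nat.le_of_mul_le_mul_right (h3.trans h1) (Nat.sqrt_pos.mpr Fintype.card_pos)
    have h5 := Nat.mul_le_mul_left c h4
    omega
  have key : ∀ i, ∃ p : F i × F i, (∃ p : F i × F i, p ∈ curvePoints
      (f'.map (mapRingHom (Pi.evalRingHom F i))) (v'.map (Pi.evalRingHom F i))) →
      p ∈ curvePoints (f'.map (mapRingHom (Pi.evalRingHom F i)))
        (v'.map (Pi.evalRingHom F i)) := by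
    intro i
    by_cases h : ∃ p : F i × F i, p ∈ curvePoints
      (f'.map (mapRingHom (Pi.evalRingHom F i))) (v'.map (Pi.evalRingHom F i))
    · exact ⟨h.choose, fun _ => h.choose_spec⟩
    · exact ⟨0, fun h' => absurd h' h⟩
  choose p hp using key
  refine ⟨ultraMk U F fun i => (p i).1, ultraMk U F fun i => (p i).2, ?_, ?_⟩
  · rw [map_mapRingHom_evalEval, ultraMk_eq_zero_iff]
    filter_upwards [hex] with i hi
    have h1 := (mem_curvePoints.mp (hp i hi)).1
    have h2 := map_mapRingHom_evalEval (Pi.evalRingHom F i) f' (fun i => (p i).1) fun i => (p i).2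
    exact h2.symm.trans h1
  · rw [eval_map_apply, ultraMk_ne_zero_iff]
    filter_upwards [hex] with i hi
    have h1 := (mem_curvePoints.mp (hp i hi)).2
    have h2 : (v'.map (Pi.evalRingHom F i)).eval (Pi.evalRingHom F i fun i => (p i).1) = _ :=
      eval_map_apply _ _
    exact fun h0 => h1 (h2.trans h0)

end Transfer

section UltraPerfect

variable {I : Type} {U : Ultrafilter I} {F : I → Type} [∀ i, Field (F i)]

instance perfectField_ultraProd [∀ i, Fintype (F i)] : PerfectField (UltraProd U F) := by
  classical
  obtain ⟨p, hp⟩ := ExpChar.exists (UltraProd U F)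
  cases hp with
  | zero => infer_instance
  | prime hprime =>
    rename_i hchar
    have : Fact p.Prime := ⟨hprime⟩
    have hev : ∀ᶠ i in U, (p : F i) = 0 := by
      have h := CharP.cast_eq_zero (UltraProd U F) p
      have h2 : (ultraMk U F) (p : ∀ i, F i) = 0 := by rw [map_natCast]; exact h
      rw [ultraMk_eq_zero_iff] at h2
      filter_upwards [h2] with i hi
      simpa using hi
    have hsurj : Function.Surjective (frobenius (UltraProd U F) p) := by
      intro z
      obtain ⟨z, rfl⟩ := Ideal.Quotient.mk_surjective z
      have key : ∀ i, ∃ w : F i, (p : F i) = 0 → w ^ p = z i := by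
        intro i
        by_cases h : (p : F i) = 0
        · have : CharP (F i) p := by
            obtain ⟨r, hr⟩ := CharP.exists (F i)
            have h1 := (CharP.cast_eq_zero_iff (F i) r p).mp h
            rcases (Nat.dvd_prime hprime).mp h1 with h2 | h2
            · subst h2
              exact absurd rfl (CharP.char_ne_one (F i) 1)
            · exact h2 ▸ hr
          have : ExpChar (F i) p := ExpChar.prime hprime
          obtain ⟨w, hw⟩ := (bijective_frobenius (F i) p).2 (z i)
          exact ⟨w, fun _ => hw⟩
        · exact ⟨0, fun h' => absurd h' h⟩
      choose w hw using key
      refine ⟨ultraMk U F w, ?_⟩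
      rw [frobenius_def, ← map_pow]
      refine ultraMk_eq_iff.mpr ?_
      filter_upwards [hev] with i hi
      exact hw i hi
    have : PerfectRing (UltraProd U F) p := PerfectRing.ofSurjective _ p hsurj
    exact PerfectRing.toPerfectField (UltraProd U F) p

end UltraPerfect

section KernelOfEvaluation

lemma evalHom_map {k L E M : Type*} [CommRing k] [CommRing L] [CommRing E] [CommRing M]
    [Algebra k E] [Algebra L M] (φ : k →+* L) (ψ : E →+* M)
    (h : ∀ a, algebraMap L M (φ a) = ψ (algebraMap k E a)) (t y : E) (g : k[X][X]) :
    evalHom (ψ t) (ψ y) (g.map (mapRingHom φ)) = ψ (evalHom t y g) := by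
  have h1 : ((evalHom (K := L) (ψ t) (ψ y)).toRingHom).comp (mapRingHom (mapRingHom φ))
      = ψ.comp (evalHom (K := k) t y).toRingHom := by
    refine Polynomial.ringHom_ext' (Polynomial.ringHom_ext' ?_ ?_) ?_
    · ext a
      have h2 : evalHom (ψ t) (ψ y) (C (C (φ a))) = algebraMap L M (φ a) :=
        (evalHom (ψ t) (ψ y)).commutes (φ a)
      have h3 : evalHom t y (C (C a)) = algebraMap k E a := (evalHom t y).commutes a
      simp [h2, h3, h]
    · simp [evalHom_C_X]
    · simp [evalHom_X]
  exact RingHom.congr_fun h1 g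

/-- A polynomial vanishing at a generic point of an irreducible curve is divisible by its
equation. -/
lemma dvd_of_evalHom_eq_zero {k E : Type*} [Field k] [Field E] [Algebra k E] {t y : E}
    (ht : Transcendental k t) {f g : k[X][X]} (hf : f.Monic) (hirr : Irreducible f)
    (hy : evalHom t y f = 0) (hg : evalHom t y g = 0) : f ∣ g := by
  by_contra hdvd
  have hd : f.natDegree ≠ 0 := fun h =>
    hirr.not_isUnit (by rw [hf.natDegree_eq_zero.mp h]; exact isUnit_one)
  have hne := resultant_ne_zero_of_not_dvd hf hirr le_rfl hdvd
  obtain ⟨p, q, -, -, hpq⟩ := exists_mul_add_mul_eq_C_resultant f g le_rfl le_rfl (Or.inl hd)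
  have h := congrArg (evalHom t y) hpq
  rw [map_add, map_mul, map_mul, hy, hg, zero_mul, zero_mul, zero_add, evalHom_apply, specX,
    map_C, eval_C] at h
  exact hne (transcendental_iff.mp ht _ h.symm)

lemma exists_sum_C_mul_map {ι A B : Type*} [Fintype ι] [CommRing A] [CommRing B] (φ : A →+* B)
    {b : ι → B} (hb : ∀ x : B, ∃ c : ι → A, x = ∑ i, b i * φ (c i)) (P : B[X]) :
    ∃ c : ι → A[X], P = ∑ i, C (b i) * mapRingHom φ (c i) := by
  induction P using Polynomial.induction_on' with
  | add P Q hP hQ =>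
    obtain ⟨c, hc⟩ := hP
    obtain ⟨c', hc'⟩ := hQ
    refine ⟨c + c', ?_⟩
    conv_lhs => rw [hc, hc']
    simp only [← Finset.sum_add_distrib, ← mul_add, Pi.add_apply, map_add]
  | monomial n a =>
    obtain ⟨c, hc⟩ := hb a
    refine ⟨fun i => monomial n (c i), ?_⟩
    conv_lhs => rw [hc]
    simp only [coe_mapRingHom, map_monomial, map_sum, C_mul_monomial]

/-- If `k` is relatively algebraically closed in `E` then monic irreducible polynomials over `k`
stay irreducible over `E`. -/
lemma irreducible_map_of_algebraicClosure_eq_bot {k E : Type*} [Field k] [Field E] [Algebra k E]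
    (hk : algebraicClosure k E = ⊥) {P : k[X]} (hP : P.Monic) (hirr : Irreducible P) :
    Irreducible (P.map (algebraMap k E)) := by
  rw [(hP.map _).irreducible_iff_natDegree]
  have hirr' := hirr
  rw [hP.irreducible_iff_natDegree] at hirr'
  have hlift : ∀ g : E[X], g.Monic → g ∣ P.map (algebraMap k E) → g ∈ lifts (algebraMap k E) := by
    intro g hg hdvd
    have h := integralClosure.mem_lifts_of_monic_of_dvd_map E hP hg hdvd
    rw [lifts_iff_coeff_lifts] at h ⊢
    intro n
    obtain ⟨a, ha⟩ := h n
    have h1 : g.coeff n ∈ algebraicClosure k E :=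
      mem_algebraicClosure_iff.mpr (ha ▸ a.2.isAlgebraic)
    rw [hk, IntermediateField.mem_bot] at h1
    exact h1
  refine ⟨fun h => ?_, fun g h hg hh hgh => ?_⟩
  · rw [← Polynomial.map_one (algebraMap k E)] at h
    exact hirr'.1 (map_injective _ (algebraMap k E).injective h)
  · obtain ⟨g', hg', hdg, hgm⟩ := lifts_and_natDegree_eq_and_monic
      (hlift g hg (Dvd.intro _ hgh)) hg
    obtain ⟨h', hh', hdh, hhm⟩ := lifts_and_natDegree_eq_and_monic
      (hlift h hh (Dvd.intro_left _ hgh)) hh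
    have h2 := hirr'.2 g' h' hgm hhm
      (map_injective _ (algebraMap k E).injective (by rw [Polynomial.map_mul, hg', hh', hgh]))
    rwa [hdg, hdh] at h2

/-- A curve with a generic point in `E` stays irreducible over simple algebraic extensions of
a relatively algebraically closed subfield. -/
lemma irreducible_map_adjoin_simple {k E L : Type*} [Field k] [Field E] [Algebra k E]
    [Field L] [Algebra k L] [FiniteDimensional k L]
    (hk : algebraicClosure k E = ⊥) {t y : E} (ht : Transcendental k t) {f : k[X][X]}
    (hf : f.Monic) (hirr : Irreducible f) (hy : evalHom t y f = 0)
    {α : L} (hα : IntermediateField.adjoin k {α} = ⊤) :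
    Irreducible (f.map (mapRingHom (algebraMap k L))) := by
  have hαint : IsIntegral k α := IsIntegral.of_finite k α
  let B : PowerBasis k L := PowerBasis.ofAdjoinEqTop hαint
    ((IntermediateField.adjoin_simple_toSubalgebra_of_isAlgebraic hαint.isAlgebraic).symm.trans
      (by rw [hα]; rfl))
  have hBgen : B.gen = α := PowerBasis.ofAdjoinEqTop_gen ..
  set P := minpoly k B.gen with hPdef
  have hPm : P.Monic := minpoly.monic (B.isIntegral_gen)
  have hPE := irreducible_map_of_algebraicClosure_eq_bot hk hPm (minpoly.irreducible B.isIntegral_gen)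
  have : Fact (Irreducible (P.map (algebraMap k E))) := ⟨hPE⟩
  let E' := AdjoinRoot (P.map (algebraMap k E))
  let j : L →ₐ[k] E' := B.lift (AdjoinRoot.root (P.map (algebraMap k E))) (by
    rw [← aeval_map_algebraMap E]
    exact AdjoinRoot.aeval_eq _ |>.trans AdjoinRoot.mk_self)
  have hj : j B.gen = AdjoinRoot.root (P.map (algebraMap k E)) := B.lift_gen _ _
  let B' : PowerBasis E E' := AdjoinRoot.powerBasis hPE.ne_zero
  have hB' : B'.gen = AdjoinRoot.root (P.map (algebraMap k E)) := AdjoinRoot.powerBasis_gen ..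
  have hdim : B.dim = B'.dim := by
    rw [AdjoinRoot.powerBasis_dim, natDegree_map, hPdef, B.natDegree_minpoly]
  let _ : Algebra L E' := j.toRingHom.toAlgebra
  have hcompat : ∀ a, algebraMap L E' (algebraMap k L a) = algebraMap E E' (algebraMap k E a) := by
    intro a
    refine (j.commutes a).trans ?_
    exact IsScalarTower.algebraMap_apply k E E' a
  have hev := evalHom_map (algebraMap k L) (algebraMap E E') hcompat t y
  have hdecomp : ∀ x : L, ∃ c : Fin B.dim → k, x =
      ∑ i : Fin B.dim, B.gen ^ (i : ℕ) * algebraMap k L (c i) := by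
    intro x
    refine ⟨B.basis.repr x, ?_⟩
    conv_lhs => rw [← B.basis.sum_repr x]
    exact Finset.sum_congr rfl fun i _ => by rw [B.basis_eq_pow, Algebra.smul_def, mul_comm]
  have hzero : ∀ g : L[X][X], evalHom (algebraMap E E' t) (algebraMap E E' y) g = 0 →
      f.map (mapRingHom (algebraMap k L)) ∣ g := by
    intro g hg
    obtain ⟨c, rfl⟩ := exists_sum_C_mul_map _ (exists_sum_C_mul_map _ hdecomp) g
    have hlin : LinearIndependent E fun i : Fin B.dim => B'.gen ^ (i : ℕ) := by
      have h := B'.basis.linearIndependent.comp (finCongr hdim) (finCongr hdim).injective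
      have h2 : (B'.basis ∘ finCongr hdim) = fun i : Fin B.dim => B'.gen ^ (i : ℕ) := by
        funext i
        simp
      rwa [h2] at h
    rw [Fintype.linearIndependent_iff] at hlin
    have hc := hlin (fun i => evalHom t y (c i)) (by
      rw [map_sum] at hg
      rw [← hg]
      refine Finset.sum_congr rfl fun i _ => ?_
      have h2 : evalHom (algebraMap E E' t) (algebraMap E E' y) (C (C (B.gen ^ (i : ℕ))))
          = algebraMap L E' (B.gen ^ (i : ℕ)) := AlgHom.commutes _ _
      have h3 : algebraMap L E' (B.gen ^ (i : ℕ)) = B'.gen ^ (i : ℕ) := by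
        rw [hB', ← hj, map_pow]
        rfl
      rw [map_mul, h2, h3, Algebra.smul_def, mul_comm]
      exact congrArg _ (hev (c i)).symm)
    refine Finset.dvd_sum fun i _ => Dvd.dvd.mul_left ?_ _
    exact map_dvd (mapRingHom (mapRingHom (algebraMap k L)))
      (dvd_of_evalHom_eq_zero ht hf hirr hy (hc i))
  have hdeg : f.natDegree ≠ 0 := fun h =>
    hirr.not_isUnit (by rw [hf.natDegree_eq_zero.mp h]; exact isUnit_one)
  rw [(hf.map _).irreducible_iff_natDegree]
  refine ⟨fun h => hdeg ?_, fun g h hg hh hgh => ?_⟩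
  · rw [← hf.natDegree_map (mapRingHom (algebraMap k L)), h, natDegree_one]
  · have h0 := hev f
    rw [hy, map_zero, ← hgh, map_mul, mul_eq_zero] at h0
    have hsum := hg.natDegree_mul hh
    rw [hgh] at hsum
    rcases h0 with h0 | h0
    · have := natDegree_le_of_dvd (hzero g h0) hg.ne_zero
      right
      omega
    · have := natDegree_le_of_dvd (hzero h h0) hh.ne_zero
      left
      omega

end KernelOfEvaluation

section AbsoluteIrreducibility

lemma exists_finset_coeff_mem {R : Type*} [CommRing R] (g : R[X]) :
    ∃ T : Finset R, ∀ i, g.coeff i ∈ T := by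
  classical
  refine ⟨insert 0 g.coeffs, fun i => ?_⟩
  by_cases h : g.coeff i = 0
  · simp [h]
  · exact Finset.mem_insert_of_mem (coeff_mem_coeffs h)

lemma exists_finset_coeff_coeff_mem {R : Type*} [CommRing R] (g : R[X][X]) :
    ∃ T : Finset R, ∀ i j, (g.coeff i).coeff j ∈ T := by
  classical
  obtain ⟨S, hS⟩ := exists_finset_coeff_mem g
  choose T hT using fun p : R[X] => exists_finset_coeff_mem p
  exact ⟨S.biUnion T, fun i j => Finset.mem_biUnion.mpr ⟨_, hS i, hT _ j⟩⟩

lemma mem_lifts_mapRingHom {R S : Type*} [CommRing R] [CommRing S] {φ : R →+* S} {g : S[X][X]}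
    (hg : ∀ i j, (g.coeff i).coeff j ∈ Set.range φ) : g ∈ lifts (mapRingHom φ) := by
  rw [lifts_iff_coeff_lifts]
  intro i
  have h : g.coeff i ∈ lifts φ := by
    rw [lifts_iff_coeff_lifts]
    exact hg i
  rw [mem_lifts] at h
  exact h

lemma natDegree_eq_zero_or_of_mem_lifts {R S : Type*} [CommRing R] [NoZeroDivisors R] [CommRing S]
    [Nontrivial S] {φ : R →+* S} (hφ : Function.Injective φ) {f : R[X]} (hf : f.Monic)
    (hirr : Irreducible f) {g h : S[X]} (hg : g.Monic) (hh : h.Monic) (hgh : g * h = f.map φ)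
    (hgl : g ∈ lifts φ) (hhl : h ∈ lifts φ) : g.natDegree = 0 ∨ h.natDegree = 0 := by
  rw [hf.irreducible_iff_natDegree] at hirr
  obtain ⟨g', hg', hdg, hgm⟩ := lifts_and_natDegree_eq_and_monic hgl hg
  obtain ⟨h', hh', hdh, hhm⟩ := lifts_and_natDegree_eq_and_monic hhl hh
  have h2 := hirr.2 g' h' hgm hhm
    (map_injective _ hφ (by rw [Polynomial.map_mul, hg', hh', hgh]))
  rwa [hdg, hdh] at h2

lemma Polynomial.Monic.irreducible_of_natDegree {R : Type*} [CommRing R] [IsDomain R] {f : R[X]}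
    (hf : f.Monic) (hd : f.natDegree ≠ 0)
    (h : ∀ g h : R[X], g.Monic → h.Monic → g * h = f → g.natDegree = 0 ∨ h.natDegree = 0) :
    Irreducible f :=
  hf.irreducible_iff_natDegree.mpr ⟨fun h1 => hd (by rw [h1, natDegree_one]), h⟩

lemma Polynomial.Monic.natDegree_ne_zero_of_irreducible {R : Type*} [CommRing R] {f : R[X]}
    (hf : f.Monic) (hirr : Irreducible f) : f.natDegree ≠ 0 := fun h =>
  hirr.not_isUnit (by rw [hf.natDegree_eq_zero.mp h]; exact isUnit_one)

variable {k E : Type*} [Field k] [Field E] [Algebra k E]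

lemma irreducible_map_of_isSeparable {L : Type*} [Field L] [Algebra k L] [Algebra.IsSeparable k L]
    (hk : algebraicClosure k E = ⊥) {t y : E} (ht : Transcendental k t) {f : k[X][X]}
    (hf : f.Monic) (hirr : Irreducible f) (hy : evalHom t y f = 0) :
    Irreducible (f.map (mapRingHom (algebraMap k L))) := by
  classical
  refine (hf.map _).irreducible_of_natDegree
    (by rw [hf.natDegree_map]; exact hf.natDegree_ne_zero_of_irreducible hirr) ?_
  intro g h hg hh hgh
  obtain ⟨T, hT⟩ := exists_finset_coeff_coeff_mem g
  obtain ⟨T', hT'⟩ := exists_finset_coeff_coeff_mem h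
  let k' := IntermediateField.adjoin k ((T ∪ T' : Finset L) : Set L)
  have : FiniteDimensional k k' := IntermediateField.finiteDimensional_adjoin
    fun x _ => Algebra.IsIntegral.isIntegral x
  obtain ⟨α, hα⟩ := Field.exists_primitive_element k k'
  have hirr' := irreducible_map_adjoin_simple hk ht hf hirr hy hα
  have hinj : Function.Injective (mapRingHom (algebraMap k' L)) :=
    map_injective _ (algebraMap k' L).injective
  refine natDegree_eq_zero_or_of_mem_lifts hinj (hf.map _) hirr' hg hh ?_ ?_ ?_
  · rw [hgh, Polynomial.map_map, mapRingHom_comp, ← IsScalarTower.algebraMap_eq]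
  · exact mem_lifts_mapRingHom fun i j => ⟨⟨_, IntermediateField.subset_adjoin k _
      (Finset.mem_coe.mpr (Finset.mem_union_left _ (hT i j)))⟩, rfl⟩
  · exact mem_lifts_mapRingHom fun i j => ⟨⟨_, IntermediateField.subset_adjoin k _
      (Finset.mem_coe.mpr (Finset.mem_union_right _ (hT' i j)))⟩, rfl⟩

lemma exists_pow_mem_range_mapRingHom {A B : Type*} [CommRing A] [CommRing B] (φ : A →+* B) (p : ℕ)
    [ExpChar B p] (h : ∀ b : B, ∃ n, b ^ p ^ n ∈ φ.range) (P : B[X]) :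
    ∃ n, P ^ p ^ n ∈ (mapRingHom φ).range := by
  have hmono : ∀ (Q : B[X]) (m n : ℕ), m ≤ n → Q ^ p ^ m ∈ (mapRingHom φ).range →
      Q ^ p ^ n ∈ (mapRingHom φ).range := by
    intro Q m n hmn hQ
    obtain ⟨r, rfl⟩ := Nat.exists_eq_add_of_le hmn
    rw [pow_add, pow_mul]
    exact pow_mem hQ _
  induction P using Polynomial.induction_on' with
  | add P Q hP hQ =>
    obtain ⟨m, hm⟩ := hP
    obtain ⟨n, hn⟩ := hQ
    refine ⟨max m n, ?_⟩
    rw [add_pow_expChar_pow]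
    exact add_mem (hmono _ _ _ (le_max_left _ _) hm) (hmono _ _ _ (le_max_right _ _) hn)
  | monomial n a =>
    obtain ⟨m, b, hb⟩ := h a
    refine ⟨m, monomial (n * p ^ m) b, ?_⟩
    rw [coe_mapRingHom, map_monomial, hb, monomial_pow]

lemma irreducible_map_of_isAlgebraic {L : Type*} [Field L] [Algebra k L] [Algebra.IsAlgebraic k L]
    (hk : algebraicClosure k E = ⊥) {t y : E} (ht : Transcendental k t) {f : k[X][X]}
    (hf : f.Monic) (hirr : Irreducible f) (hy : evalHom t y f = 0) (hdisc : disc f ≠ 0) :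
    Irreducible (f.map (mapRingHom (algebraMap k L))) := by
  have hd := hf.natDegree_ne_zero_of_irreducible hirr
  refine (hf.map _).irreducible_of_natDegree (by rwa [hf.natDegree_map]) ?_
  intro g h hg hh hgh
  let S := separableClosure k L
  obtain ⟨p, hp⟩ := ExpChar.exists L
  have hpS : ExpChar S p := (algebraMap S L).expChar (algebraMap S L).injective p
  have hpow := exists_pow_mem_range_mapRingHom (mapRingHom (algebraMap S L)) p
    (exists_pow_mem_range_mapRingHom (algebraMap S L) p fun b =>
      IsPurelyInseparable.pow_mem S p b)
  obtain ⟨m, hm⟩ := hpow g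
  obtain ⟨n, hn⟩ := hpow h
  have hm' : g ^ p ^ (m + n) ∈ (mapRingHom (mapRingHom (algebraMap S L))).range := by
    rw [pow_add, pow_mul]
    exact pow_mem hm _
  have hn' : h ^ p ^ (m + n) ∈ (mapRingHom (mapRingHom (algebraMap S L))).range := by
    rw [add_comm, pow_add, pow_mul]
    exact pow_mem hn _
  generalize m + n = r at hm' hn'
  obtain ⟨G, hG⟩ := hm'
  obtain ⟨H, hH⟩ := hn'
  set fS := f.map (mapRingHom (algebraMap k S)) with hfS
  have hfSm : fS.Monic := hf.map _
  have hprime : Prime fS := (irreducible_map_of_isSeparable hk ht hf hirr hy).prime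
  have hinj : Function.Injective (mapRingHom (mapRingHom (algebraMap S L))) :=
    map_injective _ (map_injective _ (algebraMap S L).injective)
  have hfSL : mapRingHom (mapRingHom (algebraMap S L)) fS = g * h := by
    rw [hgh, coe_mapRingHom, hfS, Polynomial.map_map, mapRingHom_comp,
      ← IsScalarTower.algebraMap_eq]
  have hGH : G * H = fS ^ p ^ r := by
    apply hinj
    rw [map_mul, hG, hH, map_pow, hfSL, mul_pow]
  by_contra hcon
  push Not at hcon
  have hnotunit : ∀ (g : L[X][X]) (G : S[X][X]), g.Monic → g.natDegree ≠ 0 →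
      mapRingHom (mapRingHom (algebraMap S L)) G = g ^ p ^ r → G ∣ fS ^ p ^ r → fS ∣ G := by
    intro g G hg hg0 hG hdvd
    obtain ⟨i, -, u⟩ := (dvd_prime_pow hprime _).mp hdvd
    rcases Nat.eq_zero_or_pos i with rfl | hi
    · exfalso
      rw [pow_zero, associated_one_iff_isUnit] at u
      have h1 := u.map (mapRingHom (mapRingHom (algebraMap S L)))
      rw [hG] at h1
      have h2 : IsUnit g := (isUnit_pow_iff (expChar_pow_pos L p r).ne').mp h1
      exact hg0 (by rw [hg.eq_one_of_isUnit h2, natDegree_one])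
    · exact (dvd_pow_self fS hi.ne').trans u.symm.dvd
  have hdvdH := map_dvd (mapRingHom (mapRingHom (algebraMap S L)))
    (hnotunit h H hh hcon.2 hH (Dvd.intro_left _ hGH))
  rw [hfSL, hH] at hdvdH
  have hgdvd : g ∣ h ^ p ^ r := (dvd_mul_right g h).trans hdvdH
  let M := FractionRing L[X]
  let ψ : k[X] →+* M := (algebraMap L[X] M).comp (mapRingHom (algebraMap k L))
  have hψ : Function.Injective ψ := (IsFractionRing.injective L[X] M).comp
    (map_injective _ (algebraMap k L).injective)
  have hsep := separable_map_of_disc_ne_zero ψ hd ((map_ne_zero_iff ψ hψ).mpr hdisc)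
  rw [← Polynomial.map_map, ← hgh, Polynomial.map_mul] at hsep
  have hcop := hsep.isCoprime.pow_right (n := p ^ r)
  have hu := hcop.isUnit_of_dvd' dvd_rfl
    (by rw [← Polynomial.map_pow]; exact map_dvd (mapRingHom (algebraMap L[X] M)) hgdvd)
  have h1 := natDegree_eq_zero_of_isUnit hu
  rw [hg.natDegree_map] at h1
  exact hcon.1 h1

attribute [local instance] Polynomial.algebra in
lemma isIntegral_coeff_coeff_of_dvd {L : Type*} [Field L] [Algebra k L] {f : k[X][X]}
    (hf : f.Monic) {g : L[X][X]} (hg : g.Monic)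
    (hdvd : g ∣ f.map (mapRingHom (algebraMap k L))) (i j : ℕ) :
    IsIntegral k ((g.coeff i).coeff j) := by
  let M := FractionRing L[X]
  have h := integralClosure.mem_lifts_of_monic_of_dvd_map M hf (hg.map (algebraMap L[X] M)) (by
    rw [IsScalarTower.algebraMap_eq k[X] L[X] M, ← Polynomial.map_map]
    exact map_dvd (mapRingHom (algebraMap L[X] M)) hdvd)
  rw [lifts_iff_coeff_lifts] at h
  obtain ⟨a, ha⟩ := h i
  rw [coeff_map] at ha
  have h1 : IsIntegral k[X] (algebraMap L[X] M (g.coeff i)) := ha ▸ a.2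
  rw [isIntegral_algebraMap_iff (IsFractionRing.injective L[X] M)] at h1
  exact isIntegral_iff_isIntegral_coeff.mp h1 j

/-- The equation of a separable plane curve with a generic point in an extension `E` of `k`, in
which `k` is relatively algebraically closed, is absolutely irreducible. -/
theorem absIrr_of_algebraicClosure_eq_bot {k : Type} {E : Type*} [Field k] [Field E] [Algebra k E]
    (hk : algebraicClosure k E = ⊥) {t y : E} (ht : Transcendental k t) {f : k[X][X]}
    (hf : f.Monic) (hirr : Irreducible f) (hy : evalHom t y f = 0) (hdisc : disc f ≠ 0) :
    AbsIrr f := by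
  intro L _ φ
  let _ : Algebra k L := φ.toAlgebra
  change Irreducible (f.map (mapRingHom (algebraMap k L)))
  have hd := hf.natDegree_ne_zero_of_irreducible hirr
  refine (hf.map _).irreducible_of_natDegree (by rwa [hf.natDegree_map]) ?_
  intro g h hg hh hgh
  have hirr' := irreducible_map_of_isAlgebraic (L := algebraicClosure k L) hk ht hf hirr hy hdisc
  refine natDegree_eq_zero_or_of_mem_lifts (φ := mapRingHom (algebraMap (algebraicClosure k L) L))
    (map_injective _ (algebraMap (algebraicClosure k L) L).injective) (hf.map _) hirr' hg hh ?_ ?_ ?_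
  · rw [hgh, Polynomial.map_map, mapRingHom_comp, ← IsScalarTower.algebraMap_eq]
  · exact mem_lifts_mapRingHom fun i j => ⟨⟨_, mem_algebraicClosure_iff.mpr
      (isIntegral_coeff_coeff_of_dvd hf hg (Dvd.intro _ hgh) i j).isAlgebraic⟩, rfl⟩
  · exact mem_lifts_mapRingHom fun i j => ⟨⟨_, mem_algebraicClosure_iff.mpr
      (isIntegral_coeff_coeff_of_dvd hf hh (Dvd.intro_left _ hgh) i j).isAlgebraic⟩, rfl⟩

end AbsoluteIrreducibility

section SpecializeAbsIrr

open TensorProduct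

/-- Two field extensions of a common domain embed in a common field. -/
lemma exists_field_comp_eq {A L M : Type} [CommRing A] [IsDomain A] [Field L] [Field M]
    {φ : A →+* L} {ψ : A →+* M} (hφ : Function.Injective φ) (hψ : Function.Injective ψ) :
    ∃ (N : Type) (_ : Field N) (i : L →+* N) (j : M →+* N), i.comp φ = j.comp ψ := by
  let Q := FractionRing A
  let φ' : Q →+* L := IsFractionRing.lift hφ
  let ψ' : Q →+* M := IsFractionRing.lift hψ
  let _ : Algebra Q L := φ'.toAlgebra
  let _ : Algebra Q M := ψ'.toAlgebra
  obtain ⟨m, hm⟩ := Ideal.exists_maximal (L ⊗[Q] M)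
  let N := (L ⊗[Q] M) ⧸ m
  let _ : Field N := Ideal.Quotient.field m
  refine ⟨N, inferInstance,
    (Ideal.Quotient.mk m).comp Algebra.TensorProduct.includeLeftRingHom,
    (Ideal.Quotient.mk m).comp Algebra.TensorProduct.includeRight.toRingHom, ?_⟩
  ext a
  have h1 : φ a = algebraMap Q L (algebraMap A Q a) := (IsFractionRing.lift_algebraMap hφ a).symm
  have h2 : ψ a = algebraMap Q M (algebraMap A Q a) := (IsFractionRing.lift_algebraMap hψ a).symm
  have h3 : (algebraMap Q L (algebraMap A Q a)) ⊗ₜ[Q] (1 : M)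
      = (1 : L) ⊗ₜ[Q] (algebraMap Q M (algebraMap A Q a)) := by
    generalize algebraMap A Q a = z
    rw [Algebra.algebraMap_eq_smul_one, Algebra.algebraMap_eq_smul_one, TensorProduct.smul_tmul]
  simp only [RingHom.comp_apply, h1, h2]
  exact congrArg _ h3

/-- There is an ultrafilter on the nonzero elements of a domain which concentrates on the multiples
of each nonzero element. -/
lemma exists_ultrafilter_dvd (A : Type) [CommRing A] [IsDomain A] :
    ∃ U : Ultrafilter {g : A // g ≠ 0}, ∀ a : A, a ≠ 0 →
      ∀ᶠ g : {g : A // g ≠ 0} in U, a ∣ g.1 := by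
  let l : Filter {g : A // g ≠ 0} := ⨅ a : {g : A // g ≠ 0},
    Filter.principal {g : {g : A // g ≠ 0} | a.1 ∣ g.1}
  have hne : l.NeBot := by
    have : Nonempty {g : A // g ≠ 0} := ⟨⟨1, one_ne_zero⟩⟩
    refine Filter.iInf_neBot_of_directed ?_ ?_
    · intro a b
      refine ⟨⟨a.1 * b.1, mul_ne_zero a.2 b.2⟩, ?_, ?_⟩
      · exact Filter.principal_mono.mpr fun g hg => (dvd_mul_right _ _).trans hg
      · exact Filter.principal_mono.mpr fun g hg => (dvd_mul_left _ _).trans hg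
    · intro a
      exact Filter.principal_neBot_iff.mpr ⟨a, dvd_rfl⟩
  refine ⟨Ultrafilter.of l, fun a ha => ?_⟩
  exact Ultrafilter.of_le l (Filter.mem_iInf_of_mem (⟨a, ha⟩ : {g : A // g ≠ 0})
    (Filter.mem_principal_self _))

/-- A generically absolutely irreducible family of plane curves has absolutely irreducible
members. -/
theorem exists_specialization_absIrr {K A K' : Type} [Field K] [CommRing A] [IsDomain A]
    [Algebra K A] [Field K'] {ι : A →+* K'} (hι : Function.Injective ι) {f : A[X][X]}
    (hf : f.Monic) (habs : AbsIrr (f.map (mapRingHom ι)))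
    (hA : ∀ g : A, g ≠ 0 → ∃ φ : A →ₐ[K] K, φ g ≠ 0) {h : A} (hh : h ≠ 0) :
    ∃ φ : A →ₐ[K] K, φ h ≠ 0 ∧ AbsIrr (f.map (mapRingHom (φ : A →+* K))) := by
  by_contra hcon
  push Not at hcon
  choose φ hφ using fun g : {g : A // g ≠ 0} => hA (g.1 * h) (mul_ne_zero g.2 hh)
  have hφ1 : ∀ g, φ g g.1 ≠ 0 := fun g hg => hφ g (by rw [map_mul, hg, zero_mul])
  have hφ2 : ∀ g, φ g h ≠ 0 := fun g hg => hφ g (by rw [map_mul, hg, mul_zero])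
  have key : ∀ g, ∃ (L : Type) (_ : Field L) (ψ : K →+* L),
      ¬ Irreducible ((f.map (mapRingHom (φ g : A →+* K))).map (mapRingHom ψ)) := by
    intro g
    have h1 := hcon (φ g) (hφ2 g)
    simp only [AbsIrr] at h1
    push Not at h1
    obtain ⟨L, _, ψ, h2⟩ := h1
    exact ⟨L, inferInstance, ψ, h2⟩
  choose L hL ψ hψ using key
  obtain ⟨U, hU⟩ := exists_ultrafilter_dvd A
  let χ : A →+* (∀ g, L g) := RingHom.pi fun g => (ψ g).comp (φ g : A →+* K)
  have hχ : Function.Injective ((ultraMk U L).comp χ) := by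
    rw [injective_iff_map_eq_zero]
    intro a ha
    by_contra ha0
    rw [RingHom.comp_apply, ultraMk_eq_zero_iff] at ha
    obtain ⟨g, hg1, hg2⟩ := (ha.and (hU a ha0)).exists
    have hg3 : φ g a = 0 := (map_eq_zero (ψ g)).mp hg1
    obtain ⟨r, hr⟩ := hg2
    exact hφ1 g (by rw [hr, map_mul, hg3, zero_mul])
  have hred := not_irreducible_map_ultraMk (U := U) (hf.map (mapRingHom χ)) (by
    refine Filter.Eventually.of_forall fun g => ?_
    have h3 := hψ g
    rw [Polynomial.map_map, mapRingHom_comp] at h3 ⊢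
    exact h3)
  rw [Polynomial.map_map, mapRingHom_comp] at hred
  obtain ⟨N, _, i, j, hij⟩ := exists_field_comp_eq hι hχ
  have hirr := habs N i
  rw [Polynomial.map_map, mapRingHom_comp, hij, ← mapRingHom_comp, ← Polynomial.map_map] at hirr
  exact hred ((hf.map _).irreducible_of_irreducible_map _ _ hirr)

end SpecializeAbsIrr

section PlaneModel

lemma finiteDimensional_of_isAlgebraic_of_essFiniteType (F E : Type*) [Field F] [Field E]
    [Algebra F E] [Algebra.IsAlgebraic F E] [Algebra.EssFiniteType F E] :
    FiniteDimensional F E := by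
  obtain ⟨s, hs⟩ := IntermediateField.fg_top F E
  have h : FiniteDimensional F (IntermediateField.adjoin F (s : Set E)) :=
    IntermediateField.finiteDimensional_adjoin fun x _ => Algebra.IsIntegral.isIntegral x
  rw [hs] at h
  exact LinearEquiv.finiteDimensional (IntermediateField.topEquiv (F := F) (E := E)).toLinearEquiv

lemma evalHom_C {k E : Type*} [CommRing k] [CommRing E] [Algebra k E] (t y : E) (p : k[X]) :
    evalHom t y (C p) = aeval t p := by
  rw [evalHom_apply, specX, map_C, eval_C]
  rfl

/-- A separable extension of a rational function field in one variable is the function field of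
a plane curve. -/
theorem exists_plane_model {k E : Type*} [Field k] [Field E] [Algebra k E]
    [Algebra.EssFiniteType k E] {t : E} (ht : Transcendental k t)
    [Algebra.IsSeparable (IntermediateField.adjoin k {t}) E] :
    ∃ (y : E) (f : k[X][X]), f.Monic ∧ Irreducible f ∧ disc f ≠ 0 ∧ evalHom t y f = 0 ∧
      ∀ z : E, ∃ (c : k[X][X]) (v : k[X]), v ≠ 0 ∧ z * aeval t v = evalHom t y c := by
  let Q := IntermediateField.adjoin k {t}
  have : Algebra.EssFiniteType Q E := Algebra.EssFiniteType.of_comp k Q E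
  have : FiniteDimensional Q E := finiteDimensional_of_isAlgebraic_of_essFiniteType Q E
  let tQ : Q := ⟨t, IntermediateField.mem_adjoin_simple_self k t⟩
  let _ : Algebra k[X] E := (aeval t : k[X] →ₐ[k] E).toRingHom.toAlgebra
  let _ : Algebra k[X] Q := (aeval tQ : k[X] →ₐ[k] Q).toRingHom.toAlgebra
  have hmapQ : ∀ p : k[X], ((algebraMap k[X] Q p : Q) : E) = aeval t p := by
    intro p
    exact (aeval_algHom_apply Q.val tQ p).symm
  have htow : IsScalarTower k[X] Q E := IsScalarTower.of_algebraMap_eq fun p => (hmapQ p).symm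
  have hinj : ∀ p : k[X], aeval t p = 0 → p = 0 := transcendental_iff.mp ht
  have hfaith : FaithfulSMul k[X] Q := by
    rw [faithfulSMul_iff_algebraMap_injective, injective_iff_map_eq_zero]
    intro p hp
    apply hinj
    rw [← hmapQ, hp]
    rfl
  have hfrac : IsFractionRing k[X] Q := by
    refine IsFractionRing.of_field _ _ fun z => ?_
    obtain ⟨r, s, hrs⟩ := (IntermediateField.mem_adjoin_simple_iff k z.1).mp z.2
    refine ⟨r, s, Subtype.ext ?_⟩
    rw [hrs, ← hmapQ, ← hmapQ]
    rfl
  have halg : Algebra.IsAlgebraic k[X] E :=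
    (IsFractionRing.comap_isAlgebraic_iff (A := k[X]) (K := Q) (C := E)).mpr inferInstance
  obtain ⟨y₀, hy₀⟩ := Field.exists_primitive_element Q E
  obtain ⟨b, hb0, hb⟩ := (halg.isAlgebraic y₀).exists_integral_multiple
  set y := b • y₀ with hydef
  have hy : IntermediateField.adjoin Q {y} = ⊤ := by
    rw [eq_top_iff, ← hy₀, IntermediateField.adjoin_simple_le_iff]
    have h1 : y₀ = algebraMap Q E (algebraMap k[X] Q b)⁻¹ * y := by
      have h2 : algebraMap Q E (algebraMap k[X] Q b) ≠ 0 := by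
        rw [Ne, map_eq_zero]
        exact fun h => hb0 ((map_eq_zero_iff _ (FaithfulSMul.algebraMap_injective k[X] Q)).mp h)
      rw [hydef, Algebra.smul_def, IsScalarTower.algebraMap_apply k[X] Q E, map_inv₀,
        inv_mul_cancel_left₀ h2]
    rw [h1]
    exact mul_mem (IntermediateField.algebraMap_mem _ _)
      (IntermediateField.mem_adjoin_simple_self Q y)
  have hfm : (minpoly k[X] y).Monic := minpoly.monic hb
  have hirr := minpoly.irreducible hb
  have hsepy : (minpoly Q y).Separable := Algebra.IsSeparable.isSeparable Q y
  have hmin : minpoly Q y = (minpoly k[X] y).map (algebraMap k[X] Q) :=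
    minpoly.isIntegrallyClosed_eq_field_fractions Q E hb
  refine ⟨y, minpoly k[X] y, hfm, hirr, ?_, ?_, ?_⟩
  · refine resultant_ne_zero_of_not_dvd hfm hirr (natDegree_derivative_le _) fun hdvd => ?_
    have hd : (minpoly k[X] y).derivative = 0 := by
      by_contra hne
      have h1 := natDegree_le_of_dvd hdvd hne
      have h2 := natDegree_derivative_lt (hfm.natDegree_ne_zero_of_irreducible hirr)
      omega
    rw [hmin] at hsepy
    have h3 := hsepy
    rw [Separable, derivative_map, hd, Polynomial.map_zero, isCoprime_zero_right] at h3
    have h4 := natDegree_eq_zero_of_isUnit h3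
    rw [hfm.natDegree_map] at h4
    exact hfm.natDegree_ne_zero_of_irreducible hirr h4
  · have h := minpoly.aeval k[X] y
    rw [aeval_def, ← eval_map] at h
    rw [evalHom_apply]
    exact h
  · intro z
    have hz : z ∈ Algebra.adjoin Q {y} := by
      rw [← IntermediateField.adjoin_simple_toSubalgebra_of_isAlgebraic
        (Algebra.IsAlgebraic.isAlgebraic y), hy]
      trivial
    induction hz using Algebra.adjoin_induction with
    | mem x hx =>
      rw [Set.mem_singleton_iff] at hx
      exact ⟨X, 1, one_ne_zero, by rw [hx, evalHom_X, map_one, mul_one]⟩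
    | algebraMap r =>
      obtain ⟨a, b, hb, rfl⟩ := IsFractionRing.div_surjective (A := k[X]) r
      have hb0 : b ≠ 0 := nonZeroDivisors.ne_zero hb
      refine ⟨C a, b, hb0, ?_⟩
      have hbt : aeval t b ≠ 0 := fun h => hb0 (hinj _ h)
      rw [evalHom_C, map_div₀]
      have h1 : ∀ p, algebraMap Q E (algebraMap k[X] Q p) = aeval t p := hmapQ
      rw [h1, h1, div_mul_cancel₀ _ hbt]
    | add x x' _ _ hx hx' =>
      obtain ⟨c, v, hv, h⟩ := hx
      obtain ⟨c', v', hv', h'⟩ := hx'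
      refine ⟨c * C v' + c' * C v, v * v', mul_ne_zero hv hv', ?_⟩
      rw [map_add, map_mul, map_mul, map_mul, ← h, ← h', evalHom_C, evalHom_C]
      ring
    | mul x x' _ _ hx hx' =>
      obtain ⟨c, v, hv, h⟩ := hx
      obtain ⟨c', v', hv', h'⟩ := hx'
      refine ⟨c * c', v * v', mul_ne_zero hv hv', ?_⟩
      rw [map_mul, map_mul, ← h, ← h']
      ring

open IntermediateField.algebraAdjoinAdjoin in
/-- A finitely generated transcendental extension of a perfect field is a separable extension of
a rational function field in one variable over a relatively algebraically closed subfield. -/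
theorem exists_relatively_closed_subfield (K E : Type) [Field K] [Field E] [Algebra K E]
    [PerfectField K] [Algebra.EssFiniteType K E] (hE : ¬ Algebra.IsAlgebraic K E) :
    ∃ (k : Type) (_ : Field k) (_ : Algebra K k) (_ : Algebra k E) (_ : IsScalarTower K k E) (t : E),
      algebraicClosure k E = ⊥ ∧ Transcendental k t ∧
        Algebra.trdeg K k + 1 ≤ Algebra.trdeg K E ∧
        Algebra.IsSeparable (IntermediateField.adjoin k {t}) E := by
  classical
  obtain ⟨S, hS, hsep⟩ := exists_isTranscendenceBasis_and_isSeparable_of_perfectField K E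
  have hne : S.Nonempty := by
    by_contra hemp
    rw [Finset.not_nonempty_iff_eq_empty] at hemp
    subst hemp
    exact hE (hS.isEmpty_iff_isAlgebraic.mp inferInstance)
  obtain ⟨t, htS⟩ := hne
  let s : Set S := {j | j ≠ ⟨t, htS⟩}
  let F := IntermediateField.adjoin K ((Subtype.val : S → E) '' s)
  have htF : Transcendental F t := by
    have h := hS.1.transcendental_adjoin (s := s) (i := ⟨t, htS⟩) (fun h => h rfl)
    intro h1
    exact h ((IsFractionRing.isAlgebraic_iff
      (Algebra.adjoin K ((Subtype.val : S → E) '' s)) F E).mpr h1)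
  let k := algebraicClosure F E
  have htow : IsScalarTower K k E := IsScalarTower.of_algebraMap_eq fun _ => rfl
  have hk : algebraicClosure k E = ⊥ := algebraicClosure.algebraicClosure_eq_bot F E
  have htk : Transcendental k t := by
    intro halg
    have h1 : t ∈ algebraicClosure k E := mem_algebraicClosure_iff.mpr halg
    rw [hk, IntermediateField.mem_bot] at h1
    obtain ⟨z, hz⟩ := h1
    have h2 := mem_algebraicClosure_iff.mp z.2
    rw [show (z : E) = t from hz] at h2
    exact htF h2
  refine ⟨k, inferInstance, inferInstance, inferInstance, htow, t, hk, htk, ?_, ?_⟩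
  · refine le_trans (add_le_add le_rfl ?_) (trdeg_add_le (R := K) (S := k) (A := E))
    have : Algebra.Transcendental k E := ⟨t, htk⟩
    exact Cardinal.one_le_iff_pos.mpr (trdeg_pos k E)
  · have hle : IntermediateField.adjoin K (S : Set E) ≤
        (IntermediateField.adjoin k {t}).restrictScalars K := by
      rw [IntermediateField.adjoin_le_iff]
      intro x hx
      by_cases hxt : x = t
      · rw [hxt]
        exact IntermediateField.mem_adjoin_simple_self k t
      · have hxF : x ∈ F := IntermediateField.subset_adjoin K _
          ⟨⟨x, hx⟩, fun h => hxt (congrArg Subtype.val h), rfl⟩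
        have hxk : x ∈ k := (algebraicClosure F E).algebraMap_mem ⟨x, hxF⟩
        exact (IntermediateField.adjoin k {t}).algebraMap_mem ⟨x, hxk⟩
    let j : IntermediateField.adjoin K (S : Set E) →+* IntermediateField.adjoin k {t} :=
      (algebraMap (IntermediateField.adjoin K (S : Set E)) E).codRestrict
        (IntermediateField.adjoin k {t}) fun x => hle x.2
    let _ := j.toAlgebra
    have : IsScalarTower (IntermediateField.adjoin K (S : Set E))
      (IntermediateField.adjoin k {t}) E := IsScalarTower.of_algebraMap_eq fun _ => rfl
    exact Algebra.isSeparable_tower_top_of_isSeparable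
      (IntermediateField.adjoin K (S : Set E)) _ E

end PlaneModel

section SpecializeCurve

lemma aeval_div_eq_zero_of_ker_le {K R E σ : Type*} [Field K] [CommRing R] [Field E] [Algebra K R]
    [Algebra K E] (ev : R →ₐ[K] E) (θ : R →ₐ[K] K) (hker : ∀ r, ev r = 0 → θ r = 0) {v : R}
    (hv : θ v ≠ 0) (c : σ → R) {p : MvPolynomial σ K}
    (hp : MvPolynomial.aeval (fun i => ev (c i) / ev v) p = 0) :
    MvPolynomial.aeval (fun i => θ (c i) / θ v) p = 0 := by
  have hv' : ev v ≠ 0 := fun h => hv (hker v h)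
  have key : ∀ p : MvPolynomial σ K, ∃ (N : ℕ) (r : R),
      ev r = ev v ^ N * MvPolynomial.aeval (fun i => ev (c i) / ev v) p ∧
        θ r = θ v ^ N * MvPolynomial.aeval (fun i => θ (c i) / θ v) p := by
    intro p
    induction p using MvPolynomial.induction_on with
    | C a =>
      refine ⟨0, algebraMap K R a, ?_, ?_⟩
      · rw [AlgHom.commutes, pow_zero, one_mul, MvPolynomial.aeval_C]
      · rw [AlgHom.commutes, pow_zero, one_mul, MvPolynomial.aeval_C]
    | add p q hp hq =>
      obtain ⟨m, r, h1, h2⟩ := hp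
      obtain ⟨n, r', h1', h2'⟩ := hq
      refine ⟨m + n, r * v ^ n + r' * v ^ m, ?_, ?_⟩
      · simp only [map_add, map_mul, map_pow, h1, h1']
        ring
      · simp only [map_add, map_mul, map_pow, h2, h2']
        ring
    | mul_X p i hp =>
      obtain ⟨m, r, h1, h2⟩ := hp
      refine ⟨m + 1, r * c i, ?_, ?_⟩
      · simp only [map_mul, h1, MvPolynomial.aeval_X]
        field_simp
        ring
      · simp only [map_mul, h2, MvPolynomial.aeval_X]
        field_simp
        ring
  obtain ⟨N, r, h1, h2⟩ := key p
  rw [hp, mul_zero] at h1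
  rw [hker r h1] at h2
  exact (mul_eq_zero.mp h2.symm).resolve_left (pow_ne_zero _ hv)

lemma exists_common_denominator {k E ι : Type*} [Field k] [Field E] [Algebra k E] [Fintype ι]
    {t y : E} (hgen : ∀ z : E, ∃ (c : k[X][X]) (v : k[X]), v ≠ 0 ∧
      z * aeval t v = evalHom t y c) (s : ι → E) :
    ∃ (c : ι → k[X][X]) (v : k[X]), v ≠ 0 ∧ ∀ i, s i * aeval t v = evalHom t y (c i) := by
  classical
  choose c v hv h using fun i => hgen (s i)
  refine ⟨fun i => c i * C (∏ j ∈ Finset.univ.erase i, v j), ∏ j, v j,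
    Finset.prod_ne_zero_iff.mpr fun j _ => hv j, fun i => ?_⟩
  rw [map_mul, ← h, evalHom_C, mul_assoc, ← map_mul, Finset.mul_prod_erase _ _ (Finset.mem_univ i)]

lemma map_ne_zero_of_leadingCoeff {A B : Type*} [CommRing A] [CommRing B] (φ : A →+* B) {v : A[X]}
    (h : φ v.leadingCoeff ≠ 0) : v.map φ ≠ 0 := by
  intro h0
  apply h
  have h1 := congrArg (fun p => p.coeff v.natDegree) h0
  simpa [coeff_map] using h1

lemma evalHom_self {K : Type*} [CommRing K] (x y : K) (g : K[X][X]) :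
    evalHom x y g = g.evalEval x y := by
  rw [evalHom_apply, eval_specX_self]

/-- Polynomial relations between elements of a function field presented by a plane model over `A`
persist at the points of any specialization of that model. -/
lemma aeval_eq_zero_of_plane_model {K A k E ι : Type} [Field K] [CommRing A] [Field k] [Field E]
    [Algebra K A] [Algebra K E] [Algebra A k] [Algebra A E] [Algebra k E] [IsScalarTower K A E]
    [IsScalarTower A k E] (hinj : Function.Injective (algebraMap A k)) {t y : E}
    (ht : Transcendental k t) {f : A[X][X]} (hf : f.Monic)
    (hirr : Irreducible (f.map (mapRingHom (algebraMap A k))))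
    (hy : evalHom t y (f.map (mapRingHom (algebraMap A k))) = 0) {v : A[X]} (hv : v ≠ 0)
    {c : ι → A[X][X]} {s : ι → E} (hc : ∀ i, s i * aeval t (v.map (algebraMap A k)) =
      evalHom t y ((c i).map (mapRingHom (algebraMap A k)))) (φ : A →ₐ[K] K) {a b : K}
    (hab : (f.map (mapRingHom (φ : A →+* K))).evalEval a b = 0)
    (hva : (v.map (φ : A →+* K)).eval a ≠ 0) {p : MvPolynomial (Fin 2 ⊕ ι) K}
    (hp : MvPolynomial.aeval (Sum.elim ![t, y] s) p = 0) :
    MvPolynomial.aeval (Sum.elim ![a, b] fun i =>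
      ((c i).map (mapRingHom (φ : A →+* K))).evalEval a b / (v.map (φ : A →+* K)).eval a) p = 0 := by
  let _ : Algebra A K := (φ : A →+* K).toAlgebra
  have : IsScalarTower K A K := IsScalarTower.of_algebraMap_eq fun x => (φ.commutes x).symm
  let ev : A[X][X] →ₐ[K] E := (evalHom (K := A) t y).restrictScalars K
  let θ : A[X][X] →ₐ[K] K := (evalHom (K := A) a b).restrictScalars K
  have hev : ∀ r : A[X][X], ev r = evalHom t y (r.map (mapRingHom (algebraMap A k))) := fun r =>
    (evalHom_map (algebraMap A k) (RingHom.id E)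
      (fun a => (IsScalarTower.algebraMap_apply A k E a).symm) t y r).symm
  have hθ : ∀ r : A[X][X], θ r = (r.map (mapRingHom (φ : A →+* K))).evalEval a b := fun r => by
    rw [← evalHom_self]
    exact (evalHom_map (φ : A →+* K) (RingHom.id K) (fun _ => rfl) a b r).symm
  have hker : ∀ r, ev r = 0 → θ r = 0 := by
    intro r hr
    rw [hev] at hr
    have h1 := dvd_of_evalHom_eq_zero ht (hf.map _) hirr hy hr
    rw [map_dvd_map _ (map_injective _ hinj) hf] at h1
    obtain ⟨q, rfl⟩ := h1
    rw [map_mul, hθ, hab, zero_mul]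
  have hθv : θ (C v) = (v.map (φ : A →+* K)).eval a := by
    rw [hθ, Polynomial.map_C, evalEval_C]
    rfl
  have hevv : ev (C v) = aeval t (v.map (algebraMap A k)) := by
    rw [hev, Polynomial.map_C, evalHom_C, coe_mapRingHom]
  have hevv0 : aeval t (v.map (algebraMap A k)) ≠ 0 := fun h =>
    hv ((Polynomial.map_eq_zero_iff hinj).mp (transcendental_iff.mp ht _ h))
  have hevX : ev (C X) = t := evalHom_C_X ..
  have hevY : ev X = y := evalHom_X ..
  have hθX : θ (C X) = a := evalHom_C_X ..
  have hθY : θ X = b := evalHom_X ..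
  have hs : (fun i => ev (Sum.elim ![C X * C v, X * C v] c i) / ev (C v)) =
      Sum.elim ![t, y] s := by
    funext i
    rcases i with i | i
    · fin_cases i
      · change ev (C X * C v) / ev (C v) = t
        rw [map_mul, hevX, hevv, mul_div_cancel_right₀ _ hevv0]
      · change ev (X * C v) / ev (C v) = y
        rw [map_mul, hevY, hevv, mul_div_cancel_right₀ _ hevv0]
    · simp only [Sum.elim_inr]
      rw [hev, hevv, ← hc, mul_div_cancel_right₀ _ hevv0]
  have hs' : (fun i => θ (Sum.elim ![C X * C v, X * C v] c i) / θ (C v)) =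
      Sum.elim ![a, b] fun i =>
        ((c i).map (mapRingHom (φ : A →+* K))).evalEval a b / (v.map (φ : A →+* K)).eval a := by
    funext i
    rcases i with i | i
    · fin_cases i
      · simp [hθX, hθv, hva]
      · simp [hθY, hθv, hva]
    · simp only [Sum.elim_inr]
      rw [hθ, hθv]
  have hfin := aeval_div_eq_zero_of_ker_le ev θ hker (v := C v) (by rwa [hθv])
    (Sum.elim ![C X * C v, X * C v] c) (p := p) (by rwa [hs])
  rwa [hs'] at hfin

lemma algHom_inclusion_ne_zero {K k : Type*} [Field K] [Field k] [Algebra K k]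
    {A B : Subalgebra K k} (hle : A ≤ B) {g : A} (hg : g ≠ 0) (hmem : (g : k)⁻¹ ∈ B)
    (φ : B →ₐ[K] K) : φ (Subalgebra.inclusion hle g) ≠ 0 := by
  intro h0
  have hg' : (g : k) ≠ 0 := fun h => hg (Subtype.ext h)
  have h1 : Subalgebra.inclusion hle g * ⟨_, hmem⟩ = 1 :=
    Subtype.ext (by
      rw [Subalgebra.coe_mul, Subalgebra.coe_inclusion, Subalgebra.coe_one]
      exact mul_inv_cancel₀ hg')
  have h2 := congrArg φ h1
  rw [map_mul, map_one, h0, zero_mul] at h2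
  exact zero_ne_one h2

lemma exists_algHom_adjoin_ne_zero {K k : Type*} [Field K] [Field k] [Algebra K k]
    (hk : ∀ T : Finset k, Nonempty (Algebra.adjoin K (T : Set k) →ₐ[K] K)) (T : Finset k)
    (g : Algebra.adjoin K (T : Set k)) (hg : g ≠ 0) :
    ∃ φ : Algebra.adjoin K (T : Set k) →ₐ[K] K, φ g ≠ 0 := by
  classical
  obtain ⟨φ⟩ := hk (insert (g : k)⁻¹ T)
  have hle : Algebra.adjoin K (T : Set k) ≤
      Algebra.adjoin K ((insert (g : k)⁻¹ T : Finset k) : Set k) :=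
    Algebra.adjoin_mono (by simp)
  exact ⟨φ.comp (Subalgebra.inclusion hle), algHom_inclusion_ne_zero hle hg
    (Algebra.subset_adjoin (Finset.mem_coe.mpr (Finset.mem_insert_self _ _))) φ⟩

/-- The data of a plane model over a field descends to a finitely generated subalgebra. -/
lemma exists_adjoin_lifts {k ι : Type*} (K : Type*) [Field K] [Field k] [Algebra K k] [Fintype ι]
    {f : k[X][X]} (hf : f.Monic) (v : k[X]) (c : ι → k[X][X]) :
    ∃ (T : Finset k) (f' : (Algebra.adjoin K (T : Set k))[X][X])
      (v' : (Algebra.adjoin K (T : Set k))[X]) (c' : ι → (Algebra.adjoin K (T : Set k))[X][X]),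
      f'.Monic ∧ f'.natDegree = f.natDegree ∧
      f'.map (mapRingHom (algebraMap (Algebra.adjoin K (T : Set k)) k)) = f ∧
      v'.map (algebraMap (Algebra.adjoin K (T : Set k)) k) = v ∧
      ∀ i, (c' i).map (mapRingHom (algebraMap (Algebra.adjoin K (T : Set k)) k)) = c i := by
  classical
  obtain ⟨Tf, hTf⟩ := exists_finset_coeff_coeff_mem f
  obtain ⟨Tv, hTv⟩ := exists_finset_coeff_mem v
  choose Tc hTc using fun i => exists_finset_coeff_coeff_mem (c i)
  obtain ⟨T, hT⟩ : ∃ T, T = Tf ∪ Tv ∪ Finset.univ.biUnion Tc := ⟨_, rfl⟩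
  have hsub : ∀ x ∈ T, x ∈ Set.range (algebraMap (Algebra.adjoin K (T : Set k)) k) := fun x hx =>
    ⟨⟨x, Algebra.subset_adjoin hx⟩, rfl⟩
  obtain ⟨f', hf', hfdeg, hfm⟩ := lifts_and_natDegree_eq_and_monic
    (mem_lifts_mapRingHom (φ := algebraMap (Algebra.adjoin K (T : Set k)) k) fun i j => hsub _
      (hT ▸ Finset.mem_union_left _ (Finset.mem_union_left _ (hTf i j)))) hf
  obtain ⟨v', hv'⟩ : ∃ v' : (Algebra.adjoin K (T : Set k))[X],
      v'.map (algebraMap (Algebra.adjoin K (T : Set k)) k) = v := by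
    rw [← mem_lifts, lifts_iff_coeff_lifts]
    exact fun i => hsub _ (hT ▸ Finset.mem_union_left _ (Finset.mem_union_right _ (hTv i)))
  have hc : ∀ i, ∃ c' : (Algebra.adjoin K (T : Set k))[X][X],
      c'.map (mapRingHom (algebraMap (Algebra.adjoin K (T : Set k)) k)) = c i := by
    intro i
    rw [← mem_lifts]
    exact mem_lifts_mapRingHom fun j l => hsub _ (hT ▸ Finset.mem_union_right _
      (Finset.mem_biUnion.mpr ⟨i, Finset.mem_univ i, hTc i j l⟩))
  choose c' hc' using hc
  exact ⟨T, f', v', c', hfm, hfdeg, hf', hv', hc'⟩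

/-- A plane model over an extension `k` of `K` of a family of elements of `E` specializes to an
absolutely irreducible plane curve over `K`. -/
theorem exists_curve_specialization {K k E ι : Type} [Field K] [Field k] [Field E] [Algebra K k]
    [Algebra K E] [Algebra k E] [IsScalarTower K k E] [Fintype ι]
    (hk : ∀ T : Finset k, Nonempty (Algebra.adjoin K (T : Set k) →ₐ[K] K))
    {t y : E} (ht : Transcendental k t) {f : k[X][X]} (hf : f.Monic) (habs : AbsIrr f)
    (hdisc : disc f ≠ 0) (hy : evalHom t y f = 0)
    (hgen : ∀ z : E, ∃ (c : k[X][X]) (v : k[X]), v ≠ 0 ∧ z * aeval t v = evalHom t y c)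
    (s : ι → E) :
    ∃ (g : K[X][X]) (v : K[X]) (c : ι → K[X][X]), g.Monic ∧ 0 < g.natDegree ∧ disc g ≠ 0 ∧
      AbsIrr g ∧ v ≠ 0 ∧ ∀ a b : K, g.evalEval a b = 0 → v.eval a ≠ 0 →
        ∀ p : MvPolynomial (Fin 2 ⊕ ι) K, MvPolynomial.aeval (Sum.elim ![t, y] s) p = 0 →
          MvPolynomial.aeval (Sum.elim ![a, b] fun i => (c i).evalEval a b / v.eval a) p = 0 := by
  have hirr : Irreducible f := by
    have h := habs k (RingHom.id k)
    rwa [mapRingHom_id, Polynomial.map_id] at h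
  have hdeg := Nat.pos_of_ne_zero (hf.natDegree_ne_zero_of_irreducible hirr)
  obtain ⟨c, v, hv, hc⟩ := exists_common_denominator hgen s
  obtain ⟨T, f', v', c', hfm, hfdeg, rfl, rfl, hc'⟩ := exists_adjoin_lifts K hf v c
  have hinj : Function.Injective (algebraMap (Algebra.adjoin K (T : Set k)) k) :=
    Subtype.val_injective
  have hv0 : v' ≠ 0 := by
    rintro rfl
    exact hv (Polynomial.map_zero _)
  have hd0 : disc f' ≠ 0 := by
    intro h
    rw [disc_map hfm, h, map_zero] at hdisc
    exact hdisc rfl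
  obtain ⟨φ, hφ, hφabs⟩ := exists_specialization_absIrr hinj hfm habs
    (exists_algHom_adjoin_ne_zero hk T)
    (h := (disc f').leadingCoeff * v'.leadingCoeff)
    (mul_ne_zero (leadingCoeff_ne_zero.mpr hd0) (leadingCoeff_ne_zero.mpr hv0))
  rw [map_mul, mul_ne_zero_iff] at hφ
  refine ⟨f'.map (mapRingHom (φ : Algebra.adjoin K (T : Set k) →+* K)),
    v'.map (φ : Algebra.adjoin K (T : Set k) →+* K),
    fun i => (c' i).map (mapRingHom (φ : Algebra.adjoin K (T : Set k) →+* K)), hfm.map _,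
    ?_, ?_, hφabs, map_ne_zero_of_leadingCoeff _ hφ.2, ?_⟩
  · rw [hfm.natDegree_map, hfdeg]
    exact hdeg
  · rw [disc_map hfm]
    exact map_ne_zero_of_leadingCoeff _ hφ.1
  · intro a b hab hva p hp
    exact aeval_eq_zero_of_plane_model hinj ht hfm hirr hy hv0
      (fun i => by rw [hc', hc]) φ hab hva hp

end SpecializeCurve

section RationalPoints

/-- Every finitely generated subalgebra of a regular extension of `K` of transcendence degree at
most `n` has a `K`-rational point. -/
def HasRationalPoints (K : Type) [Field K] (n : ℕ) : Prop :=
  ∀ (E : Type) [Field E] [Algebra K E], algebraicClosure K E = ⊥ → Algebra.trdeg K E ≤ n →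
    ∀ T : Finset E, Nonempty (Algebra.adjoin K (T : Set E) →ₐ[K] K)

lemma algebraicClosure_eq_bot_of_tower {K L E : Type*} [Field K] [Field L] [Field E] [Algebra K L]
    [Algebra K E] [Algebra L E] [IsScalarTower K L E] (h : algebraicClosure K E = ⊥) :
    algebraicClosure K L = ⊥ := by
  rw [eq_bot_iff]
  intro x hx
  rw [mem_algebraicClosure_iff] at hx
  have hx' : algebraMap L E x ∈ algebraicClosure K E :=
    mem_algebraicClosure_iff.mpr hx.algebraMap
  rw [h, IntermediateField.mem_bot] at hx'
  obtain ⟨a, ha⟩ := hx'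
  rw [IntermediateField.mem_bot]
  refine ⟨a, (algebraMap L E).injective ?_⟩
  rw [← ha, ← IsScalarTower.algebraMap_apply]

lemma nonempty_algHom_of_isAlgebraic {K E : Type*} [Field K] [Field E] [Algebra K E]
    (h : algebraicClosure K E = ⊥) (halg : Algebra.IsAlgebraic K E) : Nonempty (E →ₐ[K] K) := by
  rw [← algebraicClosure.eq_top_iff, h] at halg
  exact ⟨((IntermediateField.botEquiv K E).toAlgHom.comp
    (IntermediateField.equivOfEq halg.symm).toAlgHom).comp
      (IntermediateField.topEquiv (F := K) (E := E)).symm.toAlgHom⟩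

lemma nonempty_algHom_adjoin_range {K E σ : Type*} [Field K] [Field E] [Algebra K E] {s : σ → E}
    {x : σ → K} (h : ∀ p : MvPolynomial σ K, MvPolynomial.aeval s p = 0 →
      MvPolynomial.aeval x p = 0) :
    Nonempty (Algebra.adjoin K (Set.range s) →ₐ[K] K) := by
  rw [Algebra.adjoin_range_eq_range_aeval]
  refine ⟨AlgHom.liftOfSurjective (MvPolynomial.aeval s).rangeRestrict
    (AlgHom.rangeRestrict_surjective _) (MvPolynomial.aeval x) fun p hp => h p ?_⟩
  exact congrArg Subtype.val hp

lemma exists_ratio_of_mem_adjoin_range {K E σ : Type*} [Field K] [Field E] [Algebra K E]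
    {s : σ → E} {z : E} (hz : z ∈ IntermediateField.adjoin K (Set.range s)) :
    ∃ r d : MvPolynomial σ K, MvPolynomial.aeval s d ≠ 0 ∧
      z * MvPolynomial.aeval s d = MvPolynomial.aeval s r := by
  obtain ⟨r, d, h⟩ := (IntermediateField.mem_adjoin_range_iff K s z).mp hz
  by_cases hd : MvPolynomial.aeval s d = 0
  · refine ⟨0, 1, by simp, ?_⟩
    rw [h, hd, div_zero, zero_mul, map_zero]
  · exact ⟨r, d, hd, by rw [h, div_mul_cancel₀ _ hd]⟩

/-- A finitely generated regular extension of positive transcendence degree over a perfect field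
with enough rational points specializes birationally to an absolutely irreducible plane curve. -/
theorem exists_curve_parametrization {K E ι : Type} [Field K] [PerfectField K] [Field E]
    [Algebra K E] [Fintype ι] {n : ℕ} (hK : HasRationalPoints K n)
    (hcl : algebraicClosure K E = ⊥) (hn : Algebra.trdeg K E ≤ (n + 1 : ℕ))
    (hE : ¬ Algebra.IsAlgebraic K E) {s : ι → E}
    (hs : IntermediateField.adjoin K (Set.range s) = ⊤) :
    ∃ (g : K[X][X]) (v : K[X]) (c : ι → K[X][X]), g.Monic ∧ 0 < g.natDegree ∧ disc g ≠ 0 ∧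
      AbsIrr g ∧ v ≠ 0 ∧
      (∀ a b : K, g.evalEval a b = 0 → v.eval a ≠ 0 →
        ∀ p : MvPolynomial ι K, MvPolynomial.aeval s p = 0 →
          MvPolynomial.aeval (fun i => (c i).evalEval a b / v.eval a) p = 0) ∧
      ∀ a b a' b' : K, g.evalEval a b = 0 → v.eval a ≠ 0 → g.evalEval a' b' = 0 →
        v.eval a' ≠ 0 →
        (∀ i, (c i).evalEval a b / v.eval a = (c i).evalEval a' b' / v.eval a') →
        a = a' ∧ b = b' := by
  have : Algebra.EssFiniteType K E := by
    rw [← IntermediateField.fg_top_iff, ← hs]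
    exact IntermediateField.fg_adjoin_of_finite (Set.finite_range s)
  obtain ⟨k, _, _, _, _, t, hk, ht, htr, hsep⟩ := exists_relatively_closed_subfield K E hE
  have : Algebra.EssFiniteType k E := Algebra.EssFiniteType.of_comp K k E
  obtain ⟨y, f, hf, hirr, hdisc, hy, hgen⟩ := exists_plane_model ht
  have habs := absIrr_of_algebraicClosure_eq_bot hk ht hf hirr hy hdisc
  have hkn : Algebra.trdeg K k ≤ n := by
    have h := htr.trans hn
    rwa [Nat.cast_add, Nat.cast_one, Cardinal.add_one_le_add_one_iff] at h
  have hkpt := hK k (algebraicClosure_eq_bot_of_tower hcl) hkn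
  have hmem : ∀ z : E, z ∈ IntermediateField.adjoin K (Set.range s) := fun z => by
    rw [hs]
    exact IntermediateField.mem_top
  choose r d hd hrd using fun j : Fin 2 => exists_ratio_of_mem_adjoin_range (hmem (![t, y] j))
  obtain ⟨g, v, c, hg, hgdeg, hgdisc, hgabs, hv, H⟩ := exists_curve_specialization hkpt ht hf habs
    hdisc hy hgen (Sum.elim s fun j => (MvPolynomial.aeval s (d j))⁻¹)
  have hrel : ∀ a b : K, g.evalEval a b = 0 → v.eval a ≠ 0 →
      ∀ p : MvPolynomial ι K, MvPolynomial.aeval s p = 0 →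
        MvPolynomial.aeval (fun i => (c (Sum.inl i)).evalEval a b / v.eval a) p = 0 := by
    intro a b hab hva p hp
    have h := H a b hab hva (MvPolynomial.rename (Sum.inr ∘ Sum.inl) p) (by
      rw [MvPolynomial.aeval_rename]
      exact hp)
    rw [MvPolynomial.aeval_rename] at h
    exact h
  have hcoord : ∀ a b : K, g.evalEval a b = 0 → v.eval a ≠ 0 → ∀ j : Fin 2,
      MvPolynomial.aeval (fun i => (c (Sum.inl i)).evalEval a b / v.eval a) (d j) ≠ 0 ∧
      ![a, b] j * MvPolynomial.aeval (fun i => (c (Sum.inl i)).evalEval a b / v.eval a) (d j) =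
        MvPolynomial.aeval (fun i => (c (Sum.inl i)).evalEval a b / v.eval a) (r j) := by
    intro a b hab hva j
    have h1 := H a b hab hva (MvPolynomial.X (Sum.inr (Sum.inr j)) *
      MvPolynomial.rename (Sum.inr ∘ Sum.inl) (d j) - 1) (by
        rw [map_sub, map_mul, MvPolynomial.aeval_rename, MvPolynomial.aeval_X, map_one,
          sub_eq_zero]
        exact inv_mul_cancel₀ (hd j))
    have h2 := H a b hab hva (MvPolynomial.X (Sum.inl j) *
      MvPolynomial.rename (Sum.inr ∘ Sum.inl) (d j) -
        MvPolynomial.rename (Sum.inr ∘ Sum.inl) (r j)) (by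
        rw [map_sub, map_mul, MvPolynomial.aeval_rename, MvPolynomial.aeval_rename,
          MvPolynomial.aeval_X, sub_eq_zero]
        exact hrd j)
    rw [map_sub, map_mul, MvPolynomial.aeval_rename, MvPolynomial.aeval_X, map_one,
      sub_eq_zero] at h1
    rw [map_sub, map_mul, MvPolynomial.aeval_rename, MvPolynomial.aeval_rename,
      MvPolynomial.aeval_X, sub_eq_zero] at h2
    exact ⟨right_ne_zero_of_mul_eq_one h1, h2⟩
  refine ⟨g, v, fun i => c (Sum.inl i), hg, hgdeg, hgdisc, hgabs, hv, hrel, ?_⟩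
  intro a b a' b' hab hva hab' hva' heq
  have hfun := funext heq
  have key : ∀ j : Fin 2, ![a, b] j = ![a', b'] j := by
    intro j
    obtain ⟨h1, h2⟩ := hcoord a b hab hva j
    obtain ⟨-, h2'⟩ := hcoord a' b' hab' hva' j
    rw [← hfun, ← h2] at h2'
    exact (mul_right_cancel₀ h1 h2').symm
  exact ⟨key 0, key 1⟩

theorem hasRationalPoints_of_curvePAC {K : Type} [Field K] [PerfectField K] (hK : CurvePAC K)
    (n : ℕ) : HasRationalPoints K n := by
  induction n with
  | zero =>
    intro E _ _ hcl htr T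
    rw [Nat.cast_zero, nonpos_iff_eq_zero, trdeg_eq_zero_iff] at htr
    obtain ⟨φ⟩ := nonempty_algHom_of_isAlgebraic hcl htr
    exact ⟨φ.comp (Subalgebra.val _)⟩
  | succ n ih =>
    intro E _ _ hcl htr T
    have hcl' : algebraicClosure K (IntermediateField.adjoin K (T : Set E)) = ⊥ :=
      algebraicClosure_eq_bot_of_tower hcl
    have htr' : Algebra.trdeg K (IntermediateField.adjoin K (T : Set E)) ≤ (n + 1 : ℕ) :=
      (trdeg_le_of_injective (IntermediateField.adjoin K (T : Set E)).val
        Subtype.val_injective).trans htr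
    by_cases halg : Algebra.IsAlgebraic K (IntermediateField.adjoin K (T : Set E))
    · obtain ⟨φ⟩ := nonempty_algHom_of_isAlgebraic hcl' halg
      exact ⟨φ.comp (Subalgebra.inclusion (IntermediateField.algebra_adjoin_le_adjoin K _))⟩
    · obtain ⟨g, v, c, hg, hdeg, hdisc, habs, hv, hrel, -⟩ := exists_curve_parametrization
        (ι := T) (s := fun x => (⟨x, IntermediateField.subset_adjoin K _ x.2⟩ :
          IntermediateField.adjoin K (T : Set E))) ih hcl' htr' halg (by
          apply IntermediateField.map_injective (IntermediateField.adjoin K (T : Set E)).val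
          rw [IntermediateField.adjoin_map, ← Set.range_comp, ← AlgHom.fieldRange_eq_map,
            IntermediateField.fieldRange_val]
          congr 1
          exact Subtype.range_coe)
      obtain ⟨a, b, hab, hva⟩ := hK g hg hdeg hdisc habs v hv
      have h := nonempty_algHom_adjoin_range (s := fun x : T => (x : E))
        (x := fun i => (c i).evalEval a b / v.eval a) fun p hp => hrel a b hab hva p (by
          apply Subtype.val_injective
          change (IntermediateField.adjoin K (T : Set E)).val _ = _
          rw [← AlgHom.comp_apply, MvPolynomial.comp_aeval]
          exact hp)
      have hr : Set.range (fun x : T => (x : E)) = T := Subtype.range_coe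
      rwa [hr] at h

end RationalPoints

section ZeroLocus

open MvPolynomial (zeroLocus)

/-- An ideal with infinitely many rational zeros is contained in a prime ideal with infinitely many
rational zeros, only finitely many of which are zeros of any given polynomial outside the prime. -/
lemma exists_prime_zeroLocus_infinite {K σ : Type*} [Field K] [Finite σ]
    {I : Ideal (MvPolynomial σ K)} (hI : (zeroLocus K I).Infinite) :
    ∃ P : Ideal (MvPolynomial σ K), I ≤ P ∧ P.IsPrime ∧ (zeroLocus K P).Infinite ∧
      ∀ g ∉ P, {x ∈ zeroLocus K P | MvPolynomial.aeval x g = 0}.Finite := by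
  obtain ⟨P, ⟨hIP, hP⟩, hmax⟩ := exists_maximal_of_wellFoundedGT
    (fun J : Ideal (MvPolynomial σ K) => I ≤ J ∧ (zeroLocus K J).Infinite) ⟨I, le_rfl, hI⟩
  have hfin : ∀ g ∉ P, {x ∈ zeroLocus K P | MvPolynomial.aeval x g = 0}.Finite := by
    intro g hg
    by_contra hinf
    have hsub : {x ∈ zeroLocus K P | MvPolynomial.aeval x g = 0} ⊆
        zeroLocus K (P ⊔ Ideal.span {g}) := by
      rintro x ⟨hx, hxg⟩ p hp
      obtain ⟨q, hq, r, hr, rfl⟩ := Submodule.mem_sup.mp hp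
      obtain ⟨r, rfl⟩ := Ideal.mem_span_singleton'.mp hr
      rw [map_add, map_mul, hx q hq, hxg, mul_zero, add_zero]
    have h := hmax ⟨hIP.trans le_sup_left, Set.Infinite.mono hsub hinf⟩ le_sup_left
    exact hg (h (Ideal.mem_sup_right (Ideal.mem_span_singleton_self g)))
  refine ⟨P, hIP, ⟨?_, ?_⟩, hP, hfin⟩
  · rintro rfl
    obtain ⟨x, hx⟩ := hP.nonempty
    simpa using hx 1 Submodule.mem_top
  · intro f g hfg
    by_contra! h
    refine hP (((hfin f h.1).union (hfin g h.2)).subset fun x hx => ?_)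
    have h0 := hx _ hfg
    rw [map_mul, mul_eq_zero] at h0
    exact h0.imp (fun h => ⟨hx, h⟩) fun h => ⟨hx, h⟩

lemma mem_range_algebraMap_of_isAlgebraic_of_point {K R E : Type*} [Field K] [CommRing R] [Field E]
    [Algebra K R] [Algebra K E] (ev : R →ₐ[K] E) (θ : R →ₐ[K] K) (hker : ∀ r, ev r = 0 → θ r = 0)
    {r d : R} (hd : θ d ≠ 0) (halg : IsAlgebraic K (ev r / ev d)) :
    ev r / ev d ∈ Set.range (algebraMap K E) := by
  have hE (z : Unit → E) : MvPolynomial.aeval z (aeval (MvPolynomial.X ())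
      (minpoly K (ev r / ev d)) : MvPolynomial Unit K) = aeval (z ()) (minpoly K (ev r / ev d)) := by
    rw [← aeval_algHom_apply, MvPolynomial.aeval_X]
  have hK (z : Unit → K) : MvPolynomial.aeval z (aeval (MvPolynomial.X ())
      (minpoly K (ev r / ev d)) : MvPolynomial Unit K) = aeval (z ()) (minpoly K (ev r / ev d)) := by
    rw [← aeval_algHom_apply, MvPolynomial.aeval_X]
  have h := aeval_div_eq_zero_of_ker_le ev θ hker hd (fun _ : Unit => r)
    (p := aeval (MvPolynomial.X ()) (minpoly K (ev r / ev d))) (by rw [hE, minpoly.aeval])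
  rw [hK] at h
  exact minpoly.mem_range_of_degree_eq_one K _ (degree_eq_one_of_irreducible_of_root
    (minpoly.irreducible halg.isIntegral) (x := θ r / θ d) (by
      rwa [coe_aeval_eq_eval] at h))

/-- The zero locus of an ideal with infinitely many zeros over a perfect field whose absolutely
irreducible plane curves have rational points contains the birational image of such a curve. -/
theorem exists_curve_in_zeroLocus {K σ : Type} [Field K] [PerfectField K] [Fintype σ]
    (hK : CurvePAC K) {I : Ideal (MvPolynomial σ K)} (hI : (zeroLocus K I).Infinite) :
    ∃ (g : K[X][X]) (v : K[X]) (c : σ → K[X][X]), g.Monic ∧ 0 < g.natDegree ∧ disc g ≠ 0 ∧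
      AbsIrr g ∧ v ≠ 0 ∧
      (∀ a b : K, g.evalEval a b = 0 → v.eval a ≠ 0 →
        (fun i => (c i).evalEval a b / v.eval a) ∈ zeroLocus K I) ∧
      ∀ a b a' b' : K, g.evalEval a b = 0 → v.eval a ≠ 0 → g.evalEval a' b' = 0 →
        v.eval a' ≠ 0 →
        (∀ i, (c i).evalEval a b / v.eval a = (c i).evalEval a' b' / v.eval a') →
        a = a' ∧ b = b' := by
  obtain ⟨P, hIP, hPp, hPinf, hPfin⟩ := exists_prime_zeroLocus_infinite hI
  let ev : MvPolynomial σ K →ₐ[K] FractionRing (MvPolynomial σ K ⧸ P) :=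
    (IsScalarTower.toAlgHom K (MvPolynomial σ K ⧸ P) _).comp (Ideal.Quotient.mkₐ K P)
  have hev : ∀ p, ev p = 0 ↔ p ∈ P := by
    intro p
    change algebraMap (MvPolynomial σ K ⧸ P) (FractionRing (MvPolynomial σ K ⧸ P))
      (Ideal.Quotient.mk P p) = 0 ↔ _
    rw [map_eq_zero_iff _ (IsFractionRing.injective _ _), Ideal.Quotient.eq_zero_iff_mem]
  have hfrac : ∀ z, ∃ r d, ev d ≠ 0 ∧ z = ev r / ev d := by
    intro z
    obtain ⟨x, y, hy, rfl⟩ := IsFractionRing.div_surjective (MvPolynomial σ K ⧸ P) z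
    obtain ⟨r, rfl⟩ := Ideal.Quotient.mk_surjective x
    obtain ⟨d, rfl⟩ := Ideal.Quotient.mk_surjective y
    refine ⟨r, d, ?_, rfl⟩
    rw [Ne, hev, ← Ideal.Quotient.eq_zero_iff_mem]
    exact nonZeroDivisors.ne_zero hy
  have hevs : ∀ p, MvPolynomial.aeval (fun i => ev (MvPolynomial.X i)) p = ev p := fun p =>
    (DFunLike.congr_fun (MvPolynomial.aeval_unique ev) p).symm
  have hgen : IntermediateField.adjoin K (Set.range fun i => ev (MvPolynomial.X i)) = ⊤ := by
    rw [eq_top_iff]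
    rintro z -
    obtain ⟨r, d, -, h⟩ := hfrac z
    rw [IntermediateField.mem_adjoin_range_iff]
    exact ⟨r, d, by rw [hevs, hevs, h]⟩
  have hcl : algebraicClosure K (FractionRing (MvPolynomial σ K ⧸ P)) = ⊥ := by
    rw [eq_bot_iff]
    intro z hz
    obtain ⟨r, d, hd, rfl⟩ := hfrac z
    obtain ⟨x, hx, hxd⟩ := (hPinf.sdiff (hPfin d (by rwa [← hev]))).nonempty
    exact IntermediateField.mem_bot.mpr (mem_range_algebraMap_of_isAlgebraic_of_point ev
      (MvPolynomial.aeval x) (fun r hr => hx r ((hev r).mp hr)) (fun h => hxd ⟨hx, h⟩)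
      (mem_algebraicClosure_iff.mp hz))
  have hnalg : ¬ Algebra.IsAlgebraic K (FractionRing (MvPolynomial σ K ⧸ P)) := by
    intro halg
    rw [← algebraicClosure.eq_top_iff, hcl] at halg
    have hmem : ∀ i, ∃ a, algebraMap K _ a = ev (MvPolynomial.X i) := fun i => by
      have : ev (MvPolynomial.X i) ∈
          (⊥ : IntermediateField K (FractionRing (MvPolynomial σ K ⧸ P))) := by
        rw [halg]
        exact IntermediateField.mem_top
      exact IntermediateField.mem_bot.mp this
    choose a ha using hmem
    refine hPinf ((Set.finite_singleton a).subset fun x hx => funext fun i => ?_)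
    have h := hx (MvPolynomial.X i - algebraMap K _ (a i)) (by
      rw [← hev, map_sub, AlgHom.commutes, ha, sub_self])
    rw [map_sub, AlgHom.commutes, MvPolynomial.aeval_X, sub_eq_zero] at h
    exact h
  have : Algebra.EssFiniteType K (FractionRing (MvPolynomial σ K ⧸ P)) := by
    rw [← IntermediateField.fg_top_iff, ← hgen]
    exact IntermediateField.fg_adjoin_of_finite (Set.finite_range _)
  obtain ⟨n, hn⟩ := Cardinal.lt_aleph0.mp
    (trdeg_lt_aleph0 K (FractionRing (MvPolynomial σ K ⧸ P)))
  obtain ⟨g, v, c, hg, hdeg, hdisc, habs, hv, hrel, hinj⟩ := exists_curve_parametrization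
    (hasRationalPoints_of_curvePAC hK n) hcl
    (hn.le.trans (Nat.cast_le.mpr n.le_succ)) hnalg hgen
  exact ⟨g, v, c, hg, hdeg, hdisc, habs, hv, fun a b hab hva p hp =>
    hrel a b hab hva p ((hevs p).trans ((hev p).mpr (hIP hp))), hinj⟩

end ZeroLocus

section UltraZeroLocus

open MvPolynomial (zeroLocus)

lemma exists_eventually_choice {I : Type*} {l : Filter I} {α : I → Type*} [∀ i, Nonempty (α i)]
    {P : ∀ i, α i → Prop} (h : ∀ᶠ i in l, ∃ x, P i x) : ∃ x : ∀ i, α i, ∀ᶠ i in l, P i (x i) :=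
  ⟨fun i => Classical.epsilon (P i), h.mono fun _ hi => Classical.epsilon_spec hi⟩

/-- Families of polynomials of bounded degree lift to polynomials over the product ring. -/
lemma exists_mvPolynomial_pi_lift {I σ : Type*} [Finite σ] {R : I → Type*}
    [∀ i, CommRing (R i)] {D : ℕ} (f : ∀ i, MvPolynomial σ (R i))
    (hD : ∀ i, (f i).totalDegree ≤ D) :
    ∃ g : MvPolynomial σ (∀ i, R i), ∀ i, MvPolynomial.map (Pi.evalRingHom R i) g = f i := by
  classical
  refine ⟨∑ m ∈ Finset.Icc 0 (Finsupp.equivFunOnFinite.symm fun _ : σ => D),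
    MvPolynomial.monomial m fun i => (f i).coeff m, fun i => ?_⟩
  conv_rhs => rw [(f i).as_sum]
  rw [map_sum]
  refine Eq.symm ((Finset.sum_subset (fun m hm => ?_) fun m _ hm => ?_).trans
    (Finset.sum_congr rfl fun m _ => ?_))
  · rw [Finset.mem_Icc]
    refine ⟨zero_le, fun j => ?_⟩
    exact (Finsupp.le_degree j m).trans ((MvPolynomial.le_totalDegree hm).trans (hD i))
  · rw [MvPolynomial.notMem_support_iff.mp hm, map_zero]
  · rw [MvPolynomial.map_monomial]
    rfl

variable {I : Type} {U : Ultrafilter I} {F : I → Type} [∀ i, Field (F i)]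

lemma evalEval_ultraMk_eq_zero_iff {g : (∀ i, F i)[X][X]} {a b : ∀ i, F i} :
    (g.map (mapRingHom (ultraMk U F))).evalEval (ultraMk U F a) (ultraMk U F b) = 0 ↔
      ∀ᶠ i in U, (g.map (mapRingHom (Pi.evalRingHom F i))).evalEval (a i) (b i) = 0 := by
  rw [map_mapRingHom_evalEval, ultraMk_eq_zero_iff]
  refine Filter.eventually_congr (Filter.Eventually.of_forall fun i => ?_)
  exact (congrArg (· = 0) (map_mapRingHom_evalEval (Pi.evalRingHom F i) g a b)).symm.to_iff

lemma eval_ultraMk_ne_zero_iff {v : (∀ i, F i)[X]} {a : ∀ i, F i} :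
    (v.map (ultraMk U F)).eval (ultraMk U F a) ≠ 0 ↔
      ∀ᶠ i in U, (v.map (Pi.evalRingHom F i)).eval (a i) ≠ 0 := by
  rw [eval_map_apply, ultraMk_ne_zero_iff]
  refine Filter.eventually_congr (Filter.Eventually.of_forall fun i => ?_)
  exact (congrArg (· ≠ 0) (eval_map_apply (Pi.evalRingHom F i) (p := v) a)).symm.to_iff

/-- The value at a point of an ultraproduct of a quotient of polynomials is computed
componentwise. -/
lemma evalEval_div_eval_ultraMk {c : (∀ i, F i)[X][X]} {v : (∀ i, F i)[X]} {a b : ∀ i, F i}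
    (hv : (v.map (ultraMk U F)).eval (ultraMk U F a) ≠ 0) :
    (c.map (mapRingHom (ultraMk U F))).evalEval (ultraMk U F a) (ultraMk U F b) /
        (v.map (ultraMk U F)).eval (ultraMk U F a) =
      ultraMk U F fun i => (c.map (mapRingHom (Pi.evalRingHom F i))).evalEval (a i) (b i) /
        (v.map (Pi.evalRingHom F i)).eval (a i) := by
  rw [div_eq_iff hv, map_mapRingHom_evalEval, eval_map_apply, ← map_mul, ultraMk_eq_iff]
  filter_upwards [eval_ultraMk_ne_zero_iff.mp hv] with i hi
  rw [Pi.mul_apply]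
  have h1 : (v.map (Pi.evalRingHom F i)).eval (a i) = v.eval a i :=
    eval_map_apply (Pi.evalRingHom F i) (p := v) a
  have h2 : (c.map (mapRingHom (Pi.evalRingHom F i))).evalEval (a i) (b i) = c.evalEval a b i :=
    map_mapRingHom_evalEval (Pi.evalRingHom F i) c a b
  rw [← h1, ← h2, div_mul_cancel₀ _ hi]

lemma mvEval_ultraMk_eq_zero_iff {σ : Type*} {φ : MvPolynomial σ (∀ i, F i)} {w : σ → ∀ i, F i} :
    MvPolynomial.eval (fun j => ultraMk U F (w j)) (MvPolynomial.map (ultraMk U F) φ) = 0 ↔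
      ∀ᶠ i in U, MvPolynomial.eval (fun j => w j i)
        (MvPolynomial.map (Pi.evalRingHom F i) φ) = 0 := by
  have h := MvPolynomial.map_eval (ultraMk U F) w φ
  rw [← Function.comp_def (ultraMk U F) w, ← h, ultraMk_eq_zero_iff]
  refine Filter.eventually_congr (Filter.Eventually.of_forall fun i => ?_)
  exact (congrArg (· = 0) (MvPolynomial.map_eval (Pi.evalRingHom F i) w φ)).to_iff

/-- The common zeros of a family of polynomials over a field. -/
abbrev CommonZeros {K σ ι : Type*} [Field K] (f : ι → MvPolynomial σ K) : Type _ :=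
  {y : σ → K // ∀ j, MvPolynomial.eval y (f j) = 0}

lemma infinite_commonZeros_ultraMk {σ ι : Type} [Finite ι] [∀ i, Finite (F i)] [Finite σ]
    {φ : ι → MvPolynomial σ (∀ i, F i)}
    (hW : ∀ N : ℕ, ∀ᶠ i in U,
      N ≤ Nat.card (CommonZeros fun j => MvPolynomial.map (Pi.evalRingHom F i) (φ j))) :
    {x : σ → UltraProd U F |
      ∀ j, MvPolynomial.eval x (MvPolynomial.map (ultraMk U F) (φ j)) = 0}.Infinite := by
  intro hfin
  obtain ⟨M, hM⟩ : ∃ M, M = Set.ncard {x : σ → UltraProd U F |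
      ∀ j, MvPolynomial.eval x (MvPolynomial.map (ultraMk U F) (φ j)) = 0} := ⟨_, rfl⟩
  have hex : ∀ᶠ i in U, ∃ w : Fin (M + 1) → σ → F i, Function.Injective w ∧
      ∀ k j, MvPolynomial.eval (w k) (MvPolynomial.map (Pi.evalRingHom F i) (φ j)) = 0 := by
    filter_upwards [hW (M + 1)] with i hi
    have := Fintype.ofFinite (CommonZeros fun j => MvPolynomial.map (Pi.evalRingHom F i) (φ j))
    rw [Nat.card_eq_fintype_card, ← Fintype.card_fin (M + 1)] at hi
    obtain ⟨e⟩ := Function.Embedding.nonempty_of_card_le hi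
    exact ⟨fun k => (e k).1, Subtype.val_injective.comp e.injective, fun k => (e k).2⟩
  obtain ⟨w, hw⟩ := exists_eventually_choice hex
  let W : Fin (M + 1) → σ → UltraProd U F := fun k l => ultraMk U F fun i => w i k l
  have hWinj : Function.Injective W := by
    intro k k' h
    have h' : ∀ᶠ i in U, ∀ l, w i k l = w i k' l :=
      Filter.eventually_all.mpr fun l => ultraMk_eq_iff.mp (congrFun h l)
    obtain ⟨i, hi, hi'⟩ := (h'.and hw).exists
    exact hi'.1 (funext hi)
  have hWmem : ∀ k, W k ∈ {x : σ → UltraProd U F |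
      ∀ j, MvPolynomial.eval x (MvPolynomial.map (ultraMk U F) (φ j)) = 0} := by
    intro k j
    rw [mvEval_ultraMk_eq_zero_iff (w := fun l i => w i k l)]
    exact hw.mono fun i hi => hi.2 k j
  have hcard := Set.ncard_le_ncard (Set.range_subset_iff.mpr hWmem) hfin
  rw [← hM, Set.ncard_range_of_injective hWinj, Nat.card_eq_fintype_card, Fintype.card_fin] at hcard
  omega

/-- Along an ultrafilter, an unbounded number of common zeros of polynomials of bounded complexity
over finite fields is at least `q - O(√q)`. -/
theorem exists_eventually_card_le_commonZeros {σ ι : Type} [Finite ι] [∀ i, Fintype (F i)]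
    [Fintype σ] {φ : ι → MvPolynomial σ (∀ i, F i)}
    (hF : ∀ N : ℕ, ∀ᶠ i in U, N ≤ Fintype.card (F i))
    (hW : ∀ N : ℕ, ∀ᶠ i in U,
      N ≤ Nat.card (CommonZeros fun j => MvPolynomial.map (Pi.evalRingHom F i) (φ j))) :
    ∃ c : ℕ, ∀ᶠ i in U, Fintype.card (F i) ≤
      Nat.card (CommonZeros fun j => MvPolynomial.map (Pi.evalRingHom F i) (φ j)) +
        c * Nat.sqrt (Fintype.card (F i)) := by
  have hI : (zeroLocus (UltraProd U F) (Ideal.span (Set.range fun j =>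
      MvPolynomial.map (ultraMk U F) (φ j)))).Infinite := by
    refine (infinite_commonZeros_ultraMk hW).mono fun x hx p hp => ?_
    have hle : Ideal.span (Set.range fun j => MvPolynomial.map (ultraMk U F) (φ j)) ≤
        RingHom.ker (MvPolynomial.eval x) := by
      rw [Ideal.span_le]
      rintro _ ⟨j, rfl⟩
      exact hx j
    exact hle hp
  obtain ⟨g, v, c, hg, hdeg, hdisc, habs, hv, hmem, hinj⟩ :=
    exists_curve_in_zeroLocus (curvePAC_ultraProd hF) hI
  obtain ⟨g, hgm, hgd, rfl⟩ := exists_monic_lift hg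
  obtain ⟨v, rfl⟩ := map_surjective _ Ideal.Quotient.mk_surjective v
  have hc : ∀ l, ∃ c' : (∀ i, F i)[X][X], c'.map (mapRingHom (ultraMk U F)) = c l := fun l =>
    map_surjective _ (map_surjective _ Ideal.Quotient.mk_surjective) (c l)
  choose c' hc' using hc
  obtain rfl := funext hc'
  have hzero : ∀ᶠ i in U, ∀ p : F i × F i,
      (g.map (mapRingHom (Pi.evalRingHom F i))).evalEval p.1 p.2 = 0 →
      (v.map (Pi.evalRingHom F i)).eval p.1 ≠ 0 →
      ∀ j, MvPolynomial.eval (fun l => ((c' l).map (mapRingHom (Pi.evalRingHom F i))).evalEval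
        p.1 p.2 / (v.map (Pi.evalRingHom F i)).eval p.1)
        (MvPolynomial.map (Pi.evalRingHom F i) (φ j)) = 0 := by
    by_contra hcon
    rw [← Ultrafilter.eventually_not] at hcon
    push Not at hcon
    obtain ⟨p, hp⟩ := exists_eventually_choice hcon
    have h1 := evalEval_ultraMk_eq_zero_iff.mpr (hp.mono fun i hi => hi.1)
    have h2 := eval_ultraMk_ne_zero_iff.mpr (hp.mono fun i hi => hi.2.1)
    have h3 : ∀ j, MvPolynomial.eval _ (MvPolynomial.map (ultraMk U F) (φ j)) = 0 := fun j =>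
      hmem _ _ h1 h2 _ (Ideal.subset_span ⟨j, rfl⟩)
    simp only [evalEval_div_eval_ultraMk h2] at h3
    have h4 := Filter.eventually_all.mpr fun j => mvEval_ultraMk_eq_zero_iff.mp (h3 j)
    obtain ⟨i, hi, hi'⟩ := (h4.and hp).exists
    obtain ⟨j, hj⟩ := hi'.2.2
    exact hj (hi j)
  have hinjective : ∀ᶠ i in U, ∀ p : (F i × F i) × (F i × F i),
      (g.map (mapRingHom (Pi.evalRingHom F i))).evalEval p.1.1 p.1.2 = 0 →
      (v.map (Pi.evalRingHom F i)).eval p.1.1 ≠ 0 →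
      (g.map (mapRingHom (Pi.evalRingHom F i))).evalEval p.2.1 p.2.2 = 0 →
      (v.map (Pi.evalRingHom F i)).eval p.2.1 ≠ 0 →
      (∀ l, ((c' l).map (mapRingHom (Pi.evalRingHom F i))).evalEval p.1.1 p.1.2 /
          (v.map (Pi.evalRingHom F i)).eval p.1.1 =
        ((c' l).map (mapRingHom (Pi.evalRingHom F i))).evalEval p.2.1 p.2.2 /
          (v.map (Pi.evalRingHom F i)).eval p.2.1) → p.1 = p.2 := by
    by_contra hcon
    rw [← Ultrafilter.eventually_not] at hcon
    push Not at hcon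
    obtain ⟨p, hp⟩ := exists_eventually_choice hcon
    have h1 := evalEval_ultraMk_eq_zero_iff.mpr (hp.mono fun i hi => hi.1)
    have h2 := eval_ultraMk_ne_zero_iff.mpr (hp.mono fun i hi => hi.2.1)
    have h1' := evalEval_ultraMk_eq_zero_iff.mpr (hp.mono fun i hi => hi.2.2.1)
    have h2' := eval_ultraMk_ne_zero_iff.mpr (hp.mono fun i hi => hi.2.2.2.1)
    obtain ⟨h3, h4⟩ := hinj _ _ _ _ h1 h2 h1' h2' fun l => by
      rw [evalEval_div_eval_ultraMk h2, evalEval_div_eval_ultraMk h2', ultraMk_eq_iff]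
      exact hp.mono fun i hi => hi.2.2.2.2.1 l
    obtain ⟨i, hi, hi', hi''⟩ :=
      ((ultraMk_eq_iff.mp h3).and ((ultraMk_eq_iff.mp h4).and hp)).exists
    exact hi''.2.2.2.2.2 (Prod.ext hi hi')
  obtain ⟨N, hN⟩ := exists_eventually_card_le hgm (by rwa [hgd]) habs hdisc hv
  refine ⟨N, ?_⟩
  filter_upwards [hN, hzero, hinjective] with i h1 h2 h3
  refine h1.trans (Nat.add_le_add_right ?_ _)
  rw [← Nat.card_eq_finsetCard]
  refine Nat.card_le_card_of_injective (fun p => (⟨_, h2 p.1 (mem_curvePoints.mp p.2).1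
    (mem_curvePoints.mp p.2).2⟩ : CommonZeros fun j => MvPolynomial.map (Pi.evalRingHom F i) (φ j)))
    fun p p' h => Subtype.ext ?_
  exact h3 (p.1, p'.1) (mem_curvePoints.mp p.2).1 (mem_curvePoints.mp p.2).2
    (mem_curvePoints.mp p'.2).1 (mem_curvePoints.mp p'.2).2
    fun l => congrFun (congrArg Subtype.val h) l

end UltraZeroLocus

end PlaneCurves

open MvPolynomial

/-- Bukh's dimension lemma: for fixed `b, s` there is a constant `c` such that for
every finite field `F_q` and any `b` polynomials on `F_q^b` of total degree at
most `bs`, the common zero set has size `< c` or size `≥ q - c√q`. -/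
theorem bukh_dimension_lemma (b s : ℕ) (hb : 0 < b) (hs : 0 < s) :
    ∃ c : ℝ, 0 < c ∧
      ∀ (q : ℕ) (F : Type) [Field F] [Fintype F], Fintype.card F = q →
        IsPrimePow q →
        ∀ f : Fin b → MvPolynomial (Fin b) F,
          (∀ i, (f i).totalDegree ≤ b * s) →
          ((Nat.card {y : Fin b → F // ∀ i, eval y (f i) = 0} : ℝ) < c ∨
            (q : ℝ) - c * Real.sqrt q ≤
              (Nat.card {y : Fin b → F // ∀ i, eval y (f i) = 0} : ℝ)) := by
  by_contra hcon
  push Not at hcon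
  choose q F instF instFt hq _ f hf hlow hupp using fun n : ℕ => hcon (n + 1) (by positivity)
  choose φ hφ using fun j => exists_mvPolynomial_pi_lift (fun n => f n j) fun n => hf n j
  have hW : ∀ n, Nat.card (CommonZeros (f n)) =
      Nat.card (CommonZeros fun j => MvPolynomial.map (Pi.evalRingHom F n) (φ j)) := by
    intro n
    simp only [hφ]
  have hlow' : ∀ n, n + 1 ≤ Nat.card (CommonZeros (f n)) := fun n => by
    exact_mod_cast hlow n
  have hcard : ∀ n, Nat.card (CommonZeros (f n)) ≤ q n := fun n => by
    have h : (Nat.card (CommonZeros (f n)) : ℝ) ≤ q n :=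
      (hupp n).le.trans (sub_le_self _ (by positivity))
    exact_mod_cast h
  have hlarge : ∀ N : ℕ, ∀ᶠ n in (Filter.hyperfilter ℕ : Filter ℕ), N ≤ n := fun N => by
    have h : ∀ᶠ n in Filter.cofinite, N ≤ n := by
      rw [Nat.cofinite_eq_atTop]
      exact Filter.eventually_ge_atTop N
    exact Filter.hyperfilter_le_cofinite h
  obtain ⟨c, hc⟩ := exists_eventually_card_le_commonZeros (U := Filter.hyperfilter ℕ) (φ := φ)
    (fun N => (hlarge N).mono fun n hn => by
      rw [hq]
      exact (hn.trans n.le_succ).trans ((hlow' n).trans (hcard n)))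
    (fun N => (hlarge N).mono fun n hn => by
      rw [← hW]
      exact (hn.trans n.le_succ).trans (hlow' n))
  obtain ⟨n, hn, hcn⟩ := (hc.and (hlarge c)).exists
  rw [hq, ← hW] at hn
  have h1 : (q n : ℝ) ≤ Nat.card (CommonZeros (f n)) + c * (Nat.sqrt (q n) : ℝ) := by
    exact_mod_cast hn
  have h2 : (c : ℝ) * (Nat.sqrt (q n) : ℝ) ≤ (n + 1) * Real.sqrt (q n) := by
    have hcn' : (c : ℝ) ≤ n + 1 := by exact_mod_cast hcn.trans n.le_succ
    exact mul_le_mul hcn' Real.nat_sqrt_le_real_sqrt (by positivity) (by positivity)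
  have h3 := hupp n
  change (Nat.card (CommonZeros (f n)) : ℝ) < _ at h3
  linarith
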